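/- arXiv:2201.10400 — 3 statements merged into one kernel-verified Lean document; each statement's English description precedes it below -/
import Mathlib

section
/- Let 1 ≤ p, p₁, p₂ < ∞ with 1/p = 1/p₁ + 1/p₂, let m : ℝ² → ℂ be bounded and continuous, and let C ≥ 0. Assume that for all Schwartz functions f, g : ℝ → ℂ one has eLpNorm( x ↦ ∫_{ℝ²} m(ξ,η) · 𝓕f(ξ) · 𝓕g(η) · e^{2πi(ξ+η)x} d(ξ,η), p, volume) ≤ C · eLpNorm(f, p₁, volume) · eLpNorm(g, p₂, volume), where 𝓕 is the Fourier transform with kernel e^{−2πixξ·}. Then for all finitely supported families a, b : ℤ → ℂ one has ‖ Σ_{n,k ∈ ℤ} m(n,k) · a(n) · b(k) · χ_{n+k} ‖_{L^p(𝕋)} ≤ C · ‖ Σ_{n} a(n) χ_n ‖_{L^{p₁}(𝕋)} · ‖ Σ_{k} b(k) χ_k ‖_{L^{p₂}(𝕋)}, where 𝕋 = ℝ/ℤ carries its Haar probability measure and χ_n(x) = exp(2πi n x). -/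
open MeasureTheory Real Complex Function
open scoped ENNReal FourierTransform

lemma SchwartzMap.integrable_fourier (φ : SchwartzMap ℝ ℂ) : Integrable (𝓕 (⇑φ)) := by
  rw [← SchwartzMap.fourier_coe]
  exact (𝓕 φ).integrable

lemma SchwartzMap.continuous_fourier (φ : SchwartzMap ℝ ℂ) : Continuous (𝓕 (⇑φ)) := by
  rw [← SchwartzMap.fourier_coe]
  exact (𝓕 φ).continuous

lemma exists_abs_pow_mul_exp_neg_sq_le {b : ℝ} (hb : 0 < b) (k : ℕ) :
    ∃ D, ∀ x : ℝ, |x| ^ k * rexp (-(b * x ^ 2)) ≤ D := by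
  refine ⟨1 + k.factorial / b ^ k, fun x => ?_⟩
  have h1 : |x| ^ k ≤ 1 + (x ^ 2) ^ k := by
    rw [← sq_abs, ← pow_mul, mul_comm, pow_mul]
    nlinarith [sq_nonneg (|x| ^ k - 1), sq_nonneg (|x| ^ k)]
  have h2 : (b * x ^ 2) ^ k ≤ k.factorial * rexp (b * x ^ 2) := by
    have := Real.pow_div_factorial_le_exp (b * x ^ 2) (by positivity) k
    rwa [div_le_iff₀' (by positivity)] at this
  have h3 : (x ^ 2) ^ k * rexp (-(b * x ^ 2)) ≤ k.factorial / b ^ k := by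
    rw [Real.exp_neg, ← div_eq_mul_inv, div_le_div_iff₀ (by positivity) (by positivity)]
    rw [mul_pow] at h2
    linarith
  have h4 : rexp (-(b * x ^ 2)) ≤ 1 := Real.exp_le_one_iff.2 (by simp; positivity)
  calc |x| ^ k * rexp (-(b * x ^ 2)) ≤ (1 + (x ^ 2) ^ k) * rexp (-(b * x ^ 2)) := by gcongr
    _ ≤ _ := by linarith

lemma exists_abs_pow_mul_polynomial_mul_exp_neg_sq_le {b : ℝ} (hb : 0 < b) (q : Polynomial ℂ)
    (k : ℕ) : ∃ D, ∀ x : ℝ, |x| ^ k * (‖q.eval (x : ℂ)‖ * rexp (-(b * x ^ 2))) ≤ D := by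
  induction q using Polynomial.induction_on' with
  | add p q hp hq =>
    obtain ⟨D, hD⟩ := hp
    obtain ⟨D', hD'⟩ := hq
    refine ⟨D + D', fun x => ?_⟩
    refine le_trans ?_ (add_le_add (hD x) (hD' x))
    rw [← mul_add, ← add_mul, Polynomial.eval_add]
    gcongr
    exact norm_add_le _ _
  | monomial n c =>
    obtain ⟨D, hD⟩ := exists_abs_pow_mul_exp_neg_sq_le hb (k + n)
    refine ⟨‖c‖ * D, fun x => ?_⟩
    refine le_trans (le_of_eq ?_) (mul_le_mul_of_nonneg_left (hD x) (norm_nonneg c))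
    simp only [Polynomial.eval_monomial, norm_mul, norm_pow, Complex.norm_real, Real.norm_eq_abs]
    ring

lemma iteratedDeriv_cexp_quadratic (b c : ℂ) (j : ℕ) :
    ∃ q : Polynomial ℂ, iteratedDeriv j (fun x : ℝ => cexp (b * (x : ℂ) ^ 2 + c * x)) =
      fun x : ℝ => q.eval (x : ℂ) * cexp (b * (x : ℂ) ^ 2 + c * x) := by
  induction j with
  | zero => exact ⟨1, by simp⟩
  | succ j ih =>
    obtain ⟨q, hq⟩ := ih
    refine ⟨q.derivative + q * (Polynomial.C (2 * b) * Polynomial.X + Polynomial.C c), ?_⟩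
    rw [iteratedDeriv_succ, hq]
    ext x
    have h : HasDerivAt (fun z : ℂ => q.eval z * cexp (b * z ^ 2 + c * z)) _ (x : ℂ) :=
      (q.hasDerivAt _).mul
        ((((hasDerivAt_id (x : ℂ)).pow 2).const_mul b |>.add
          ((hasDerivAt_id (x : ℂ)).const_mul c)).cexp)
    refine h.comp_ofReal.deriv.trans ?_
    simp
    ring

/-- The Gaussian `x ↦ exp (-π b x²)` modulated by the frequency `c` is a Schwartz function. -/
noncomputable def modulatedGaussian (b : ℝ) (hb : 0 < b) (c : ℝ) : SchwartzMap ℝ ℂ where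
  toFun x := cexp (-π * b * (x : ℂ) ^ 2 + 2 * π * (I * c) * x)
  smooth' := by
    have : ContDiff ℝ ((⊤ : ℕ∞) : WithTop ℕ∞) (fun x : ℝ => (x : ℂ)) := Complex.ofRealCLM.contDiff
    fun_prop
  decay' k j := by
    obtain ⟨q, hq⟩ := iteratedDeriv_cexp_quadratic (-π * b) (2 * π * (I * c)) j
    obtain ⟨D, hD⟩ := exists_abs_pow_mul_polynomial_mul_exp_neg_sq_le
      (mul_pos Real.pi_pos hb) q k
    refine ⟨D, fun x => ?_⟩
    rw [norm_iteratedFDeriv_eq_norm_iteratedDeriv, hq]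
    refine le_trans (le_of_eq ?_) (hD x)
    rw [norm_mul, Complex.norm_exp, Real.norm_eq_abs]
    congr 4
    simp [← Complex.ofReal_pow]

lemma modulatedGaussian_apply {b : ℝ} (hb : 0 < b) (c x : ℝ) :
    modulatedGaussian b hb c x = cexp (-π * b * (x : ℂ) ^ 2 + 2 * π * (I * c) * x) := rfl

lemma fourier_modulatedGaussian {b : ℝ} (hb : 0 < b) (c ξ : ℝ) :
    𝓕 (⇑(modulatedGaussian b hb c)) ξ = 𝓕 (⇑(modulatedGaussian b hb 0)) (ξ - c) := by
  have h (d : ℝ) := fourier_gaussian_pi' (b := b) (by simpa using hb) (I * d)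
  have e (d : ℝ) : ⇑(modulatedGaussian b hb d) = fun x : ℝ =>
    cexp (-π * b * (x : ℂ) ^ 2 + 2 * π * (I * d) * x) := rfl
  rw [e, e, h, h]
  simp only [← mul_assoc, I_mul_I]
  push_cast
  ring_nf

lemma fourier_modulatedGaussian_dilate {b ε : ℝ} (hb : 0 < b) (hε : 0 < ε)
    (hb' : 0 < b * ε ^ 2) (c s : ℝ) :
    𝓕 (⇑(modulatedGaussian (b * ε ^ 2) hb' c)) (c + ε * s) =
      (ε : ℂ)⁻¹ * 𝓕 (⇑(modulatedGaussian b hb 0)) s := by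
  rw [fourier_modulatedGaussian]
  have h {d : ℝ} (hd : 0 < d) := fourier_gaussian_pi' (b := d) (by simpa using hd) (I * (0 : ℝ))
  have e {d : ℝ} (hd : 0 < d) : ⇑(modulatedGaussian d hd 0) = fun x : ℝ =>
    cexp (-π * d * (x : ℂ) ^ 2 + 2 * π * (I * (0 : ℝ)) * x) := rfl
  rw [e, e, h hb', h hb]
  have h2 : ((b * ε ^ 2 : ℝ) : ℂ) ^ (1 / 2 : ℂ) = ε * (b : ℂ) ^ (1 / 2 : ℂ) := by
    rw [ofReal_mul, Complex.mul_cpow_ofReal_nonneg hb.le (by positivity), mul_comm]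
    congr 1
    have : ((1 / 2 : ℂ)) = ((1 / 2 : ℝ) : ℂ) := by simp
    rw [this, ← Complex.ofReal_cpow (by positivity), ← Real.sqrt_eq_rpow, Real.sqrt_sq hε.le]
  have hε' : (ε : ℂ) ≠ 0 := by exact_mod_cast hε.ne'
  have hbb : (b : ℂ) ≠ 0 := by exact_mod_cast hb.ne'
  beta_reduce
  rw [h2, one_div, mul_inv, ← one_div ((b : ℂ) ^ (1 / 2 : ℂ)), mul_assoc]
  congr 3
  push_cast
  simp only [add_sub_cancel_left, mul_zero, add_zero]
  field_simp

lemma integral_fourier_gaussian_mul_cexp {b : ℝ} (hb : 0 < b) (y : ℝ) :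
    ∫ s : ℝ, 𝓕 (⇑(modulatedGaussian b hb 0)) s * cexp (2 * π * I * s * y) =
      (rexp (-(π * b * y ^ 2)) : ℂ) := by
  set φ := modulatedGaussian b hb 0 with hφ
  have h : 𝓕⁻ (𝓕 (⇑φ)) y = φ y := by
    rw [φ.continuous.fourierInv_fourier_eq φ.integrable φ.integrable_fourier]
  rw [Real.fourierInv_eq'] at h
  calc _ = φ y := by
        rw [← h]
        refine integral_congr_ae (.of_forall fun s => ?_)
        simp only [smul_eq_mul, mul_comm (𝓕 (⇑φ) s)]
        congr 2
        simp
        ring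
    _ = _ := by
        rw [hφ, modulatedGaussian_apply]
        push_cast
        ring_nf

/-- The amplitude at scale `ε` of the bilinear multiplier `m` near the frequency pair `(u, v)`,
tested against the profiles `A` and `B`. -/
noncomputable def rescaledAmplitude (m : ℝ × ℝ → ℂ) (A B : ℝ → ℂ) (u v ε y : ℝ) : ℂ :=
  ∫ z : ℝ × ℝ, m (u + ε * z.1, v + ε * z.2) * A z.1 * B z.2 *
    cexp (2 * π * I * (z.1 + z.2) * y)

lemma integral_prod_comp_affine (F : ℝ × ℝ → ℂ) (u v : ℝ) {ε : ℝ} (hε : 0 < ε) :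
    ∫ z : ℝ × ℝ, F z = (ε : ℂ) ^ 2 * ∫ z : ℝ × ℝ, F (u + ε * z.1, v + ε * z.2) := by
  have h := Measure.integral_comp_smul (volume : Measure (ℝ × ℝ)) (fun z => F ((u, v) + z)) ε
  rw [integral_add_left_eq_self F (u, v)] at h
  have hdim : Module.finrank ℝ (ℝ × ℝ) = 2 := by simp
  simp only [Prod.smul_def, Prod.mk_add_mk, smul_eq_mul] at h
  rw [h, hdim, abs_of_pos (by positivity), Complex.real_smul]
  have : (ε : ℂ) ≠ 0 := by exact_mod_cast hε.ne'
  push_cast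
  field_simp

lemma norm_cexp_two_pi_I_mul (x y z : ℝ) : ‖cexp (2 * π * I * (x + y) * z)‖ = 1 := by
  have : (2 * π * I * (x + y) * z : ℂ) = ((2 * π * (x + y) * z : ℝ) : ℂ) * I := by
    push_cast; ring
  rw [this, Complex.norm_exp_ofReal_mul_I]

lemma integrable_multiplier_mul {m : ℝ × ℝ → ℂ} {M : ℝ} (hm : ∀ ξ, ‖m ξ‖ ≤ M)
    (hm_cont : Continuous m) {A B : ℝ → ℂ} (hA : Integrable A) (hB : Integrable B) (x : ℝ) :
    Integrable fun z : ℝ × ℝ =>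
      m z * A z.1 * B z.2 * cexp (2 * π * I * (z.1 + z.2) * x) := by
  have h1 : Integrable fun z : ℝ × ℝ => A z.1 * B z.2 := hA.mul_prod hB
  have h2 : Integrable fun z : ℝ × ℝ => m z * (A z.1 * B z.2) :=
    h1.bdd_mul hm_cont.aestronglyMeasurable (.of_forall hm)
  have h3 : Integrable fun z : ℝ × ℝ =>
      cexp (2 * π * I * (z.1 + z.2) * x) * (m z * (A z.1 * B z.2)) :=
    h2.bdd_mul (c := 1) (Continuous.aestronglyMeasurable (by fun_prop))
      (.of_forall fun z => (norm_cexp_two_pi_I_mul _ _ _).le)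
  refine h3.congr (.of_forall fun z => ?_)
  ring

lemma bilinear_multiplier_modulatedGaussian (m : ℝ × ℝ → ℂ) {b c ε : ℝ} (hb : 0 < b)
    (hc : 0 < c) (hε : 0 < ε) (hb' : 0 < b * ε ^ 2) (hc' : 0 < c * ε ^ 2) (u v x : ℝ) :
    ∫ z : ℝ × ℝ, m z * 𝓕 (⇑(modulatedGaussian (b * ε ^ 2) hb' u)) z.1 *
        𝓕 (⇑(modulatedGaussian (c * ε ^ 2) hc' v)) z.2 * cexp (2 * π * I * (z.1 + z.2) * x) =
      cexp (2 * π * I * (u + v) * x) *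
        rescaledAmplitude m (𝓕 (⇑(modulatedGaussian b hb 0))) (𝓕 (⇑(modulatedGaussian c hc 0)))
          u v ε (ε * x) := by
  have hε' : (ε : ℂ) ≠ 0 := by exact_mod_cast hε.ne'
  rw [integral_prod_comp_affine _ u v hε, rescaledAmplitude, ← integral_const_mul,
    ← integral_const_mul]
  refine integral_congr_ae (.of_forall fun z => ?_)
  simp only [fourier_modulatedGaussian_dilate hb hε hb', fourier_modulatedGaussian_dilate hc hε hc']
  have : (2 * π * I * ((u + ε * z.1 : ℝ) + (v + ε * z.2 : ℝ)) * x : ℂ) =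
      2 * π * I * (u + v) * x + 2 * π * I * (z.1 + z.2) * (ε * x : ℝ) := by
    push_cast; ring
  rw [this, Complex.exp_add]
  field_simp

lemma tendsto_rescaledAmplitude {m : ℝ × ℝ → ℂ} {M : ℝ} (hm : ∀ ξ, ‖m ξ‖ ≤ M)
    (hm_cont : Continuous m) {A B : ℝ → ℂ} (hA : Integrable A) (hB : Integrable B) (u v y : ℝ)
    {ε : ℕ → ℝ} (hε : Filter.Tendsto ε Filter.atTop (nhds 0)) :
    Filter.Tendsto (fun N => rescaledAmplitude m A B u v (ε N) y) Filter.atTop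
      (nhds (m (u, v) * ((∫ s : ℝ, A s * cexp (2 * π * I * s * y)) *
        ∫ s : ℝ, B s * cexp (2 * π * I * s * y)))) := by
  rw [← integral_prod_mul, ← integral_const_mul]
  have h1 : Integrable fun z : ℝ × ℝ => A z.1 * B z.2 := hA.mul_prod hB
  refine tendsto_integral_of_dominated_convergence (fun z => M * ‖A z.1 * B z.2‖) (fun N => ?_)
    (h1.norm.const_mul M) (fun N => .of_forall fun z => ?_) (.of_forall fun z => ?_)
  · have := (show Continuous fun z : ℝ × ℝ => m (u + ε N * z.1, v + ε N * z.2) by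
      fun_prop).aestronglyMeasurable (μ := volume).mul h1.aestronglyMeasurable
    have h3 := this.mul (show Continuous fun z : ℝ × ℝ => cexp (2 * π * I * (z.1 + z.2) * y) by
      fun_prop).aestronglyMeasurable
    refine h3.congr (.of_forall fun z => ?_)
    simp only [Pi.mul_apply]
    ring
  · rw [norm_mul, norm_cexp_two_pi_I_mul, mul_one, mul_assoc, norm_mul]
    gcongr
    exact hm _
  · have h : Filter.Tendsto (fun N => m (u + ε N * z.1, v + ε N * z.2)) Filter.atTop
        (nhds (m (u, v))) := by
      refine (hm_cont.tendsto _).comp (Filter.Tendsto.prodMk_nhds ?_ ?_)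
      · simpa using (hε.mul_const z.1).const_add u
      · simpa using (hε.mul_const z.2).const_add v
    have h2 := h.mul_const (A z.1 * B z.2 * cexp (2 * π * I * (z.1 + z.2) * y))
    simp only [← mul_assoc] at h2
    convert! h2 using 2
    have : (2 * π * I * (z.1 + z.2) * y : ℂ) = 2 * π * I * z.1 * y + 2 * π * I * z.2 * y := by
      ring
    rw [this, Complex.exp_add]
    ring

lemma measurable_rescaledAmplitude {m : ℝ × ℝ → ℂ} (hm_cont : Continuous m) {A B : ℝ → ℂ}
    (hA : Continuous A) (hB : Continuous B) (u v ε : ℝ) :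
    Measurable (rescaledAmplitude m A B u v ε) := by
  have : Continuous fun q : ℝ × (ℝ × ℝ) => m (u + ε * q.2.1, v + ε * q.2.2) * A q.2.1 * B q.2.2 *
    cexp (2 * π * I * (q.2.1 + q.2.2) * q.1) := by fun_prop
  exact this.stronglyMeasurable.integral_prod_right'.measurable

lemma fourier_sum_smul {ι : Type*} (S : Finset ι) (a : ι → ℂ) (φ : ι → SchwartzMap ℝ ℂ) (ξ : ℝ) :
    𝓕 (⇑(∑ i ∈ S, a i • φ i)) ξ = ∑ i ∈ S, a i * 𝓕 (⇑(φ i)) ξ := by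
  rw [← SchwartzMap.fourier_coe, ← SchwartzMap.fourierTransformCLM_apply ℂ, map_sum, sum_apply]
  simp [SchwartzMap.fourier_coe]

lemma bilinear_multiplier_sum {m : ℝ × ℝ → ℂ} {M : ℝ} (hm : ∀ ξ, ‖m ξ‖ ≤ M)
    (hm_cont : Continuous m) {ι κ : Type*} (S : Finset ι) (T : Finset κ) (a : ι → ℂ) (b : κ → ℂ)
    (φ : ι → SchwartzMap ℝ ℂ) (ψ : κ → SchwartzMap ℝ ℂ) (x : ℝ) :
    ∫ z : ℝ × ℝ, m z * 𝓕 (⇑(∑ i ∈ S, a i • φ i)) z.1 * 𝓕 (⇑(∑ j ∈ T, b j • ψ j)) z.2 *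
        cexp (2 * π * I * (z.1 + z.2) * x) =
      ∑ i ∈ S, ∑ j ∈ T, a i * b j * ∫ z : ℝ × ℝ, m z * 𝓕 (⇑(φ i)) z.1 * 𝓕 (⇑(ψ j)) z.2 *
        cexp (2 * π * I * (z.1 + z.2) * x) := by
  simp_rw [← integral_const_mul]
  have hterm (i j) : Integrable fun z : ℝ × ℝ => a i * b j * (m z * 𝓕 (⇑(φ i)) z.1 *
      𝓕 (⇑(ψ j)) z.2 * cexp (2 * π * I * (z.1 + z.2) * x)) :=
    (integrable_multiplier_mul hm hm_cont (φ i).integrable_fourier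
      (ψ j).integrable_fourier x).const_mul _
  simp_rw [← integral_finsetSum T fun j _ => hterm _ j]
  rw [← integral_finsetSum S fun i _ => integrable_finsetSum T fun j _ => hterm i j]
  refine integral_congr_ae (.of_forall fun z => ?_)
  simp only [fourier_sum_smul, Finset.mul_sum, Finset.sum_mul]
  rw [Finset.sum_comm]
  refine Finset.sum_congr rfl fun i _ => Finset.sum_congr rfl fun j _ => ?_
  ring

lemma lintegral_comp_mul_left (f : ℝ → ℝ≥0∞) {ε : ℝ} (hε : 0 < ε) :
    ∫⁻ x, f (ε * x) = ENNReal.ofReal ε⁻¹ * ∫⁻ x, f x := by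
  have h := lintegral_map_equiv f (Homeomorph.mulLeft₀ ε hε.ne').toMeasurableEquiv (μ := volume)
  have h2 := Real.map_volume_mul_left hε.ne'
  rw [abs_of_pos (inv_pos.2 hε)] at h2
  change ∫⁻ a, f a ∂(Measure.map (ε * ·) volume) = ∫⁻ a, f (ε * a) at h
  rw [← h, h2, lintegral_smul_measure, smul_eq_mul]

lemma lintegral_exp_neg_pi_mul_sq : ∫⁻ y : ℝ, ENNReal.ofReal (rexp (-(π * y ^ 2))) = 1 := by
  have h := integral_gaussian π
  have hi := integrable_exp_neg_mul_sq Real.pi_pos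
  simp only [neg_mul] at h hi
  rw [← ofReal_integral_eq_lintegral_ofReal hi (.of_forall fun _ => (Real.exp_pos _).le), h,
    div_self Real.pi_ne_zero, Real.sqrt_one, ENNReal.ofReal_one]

lemma measurable_translate_dilate {K : AddCircle (1 : ℝ) → ℝ → ℝ≥0∞}
    (hK : Measurable (uncurry K)) (ε : ℝ) :
    Measurable fun q : AddCircle (1 : ℝ) × ℝ => K (q.1 + q.2) (ε * q.2) := by
  have h : Measurable fun q : AddCircle (1 : ℝ) × ℝ => (q.1 + q.2, ε * q.2) :=
    (measurable_fst.add (AddCircle.measurable_mk'.comp measurable_snd)).prodMk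
      (measurable_snd.const_mul ε)
  exact hK.comp h

lemma lintegral_lintegral_translate_dilate {K : AddCircle (1 : ℝ) → ℝ → ℝ≥0∞}
    (hK : Measurable (uncurry K)) {ε : ℝ} (hε : 0 < ε) :
    ∫⁻ t : AddCircle (1 : ℝ), ∫⁻ x : ℝ, K (t + x) (ε * x) =
      ENNReal.ofReal ε⁻¹ * ∫⁻ y : ℝ, ∫⁻ t : AddCircle (1 : ℝ), K t y := by
  rw [lintegral_lintegral_swap (measurable_translate_dilate hK ε).aemeasurable]
  calc _ = ∫⁻ x : ℝ, ∫⁻ t : AddCircle (1 : ℝ), K t (ε * x) :=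
        lintegral_congr fun x => lintegral_add_right_eq_self (fun t => K t (ε * x)) x
    _ = _ := lintegral_comp_mul_left (fun y => ∫⁻ t : AddCircle (1 : ℝ), K t y) hε

lemma eLpNorm_le_mul_eLpNorm_iff {X Y Z : Type*} [MeasurableSpace X] [MeasurableSpace Y]
    [MeasurableSpace Z] {μ : Measure X} {ν : Measure Y} {ρ : Measure Z} {p p₁ p₂ : ℝ≥0∞}
    (hp : p ≠ 0) (hp' : p ≠ ∞) (hp₁ : p₁ ≠ 0) (hp₁' : p₁ ≠ ∞) (hp₂ : p₂ ≠ 0) (hp₂' : p₂ ≠ ∞)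
    (C : ℝ≥0∞) (F : X → ℂ) (f : Y → ℂ) (g : Z → ℂ) :
    eLpNorm F p μ ≤ C * eLpNorm f p₁ ν * eLpNorm g p₂ ρ ↔
      ∫⁻ x, ‖F x‖ₑ ^ p.toReal ∂μ ≤ C ^ p.toReal *
        (∫⁻ x, ‖f x‖ₑ ^ p₁.toReal ∂ν) ^ (p.toReal / p₁.toReal) *
        (∫⁻ x, ‖g x‖ₑ ^ p₂.toReal ∂ρ) ^ (p.toReal / p₂.toReal) := by
  have h := ENNReal.toReal_pos hp hp'
  rw [eLpNorm_eq_lintegral_rpow_enorm_toReal hp hp',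
    eLpNorm_eq_lintegral_rpow_enorm_toReal hp₁ hp₁',
    eLpNorm_eq_lintegral_rpow_enorm_toReal hp₂ hp₂', one_div p.toReal, ENNReal.rpow_inv_le_iff h,
    ENNReal.mul_rpow_of_nonneg _ _ h.le, ENNReal.mul_rpow_of_nonneg _ _ h.le,
    ← ENNReal.rpow_mul, ← ENNReal.rpow_mul, one_div_mul_eq_div, one_div_mul_eq_div]

/-- The trigonometric polynomial on `ℝ / ℤ` with coefficients `a` and frequencies in `S`. -/
noncomputable def trigPoly (S : Finset ℤ) (a : ℤ → ℂ) (t : AddCircle (1 : ℝ)) : ℂ :=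
  ∑ n ∈ S, a n * fourier n t

lemma continuous_trigPoly (S : Finset ℤ) (a : ℤ → ℂ) : Continuous (trigPoly S a) := by
  unfold trigPoly
  fun_prop

lemma fourier_apply_add (n : ℤ) (s t : AddCircle (1 : ℝ)) :
    fourier n (s + t) = fourier n s * (fourier n t : ℂ) := by
  simp [fourier_apply, smul_add, AddCircle.toCircle_add]

/-- The Schwartz function `x ↦ P (t + x) exp (-π b x²)`, where `P` is the trigonometric polynomial
with coefficients `a`. -/
noncomputable def gaussianTrigPoly (S : Finset ℤ) (a : ℤ → ℂ) (b : ℝ) (hb : 0 < b)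
    (t : AddCircle (1 : ℝ)) : SchwartzMap ℝ ℂ :=
  ∑ n ∈ S, (a n * fourier n t) • modulatedGaussian b hb n

lemma gaussianTrigPoly_apply (S : Finset ℤ) (a : ℤ → ℂ) {b : ℝ} (hb : 0 < b)
    (t : AddCircle (1 : ℝ)) (x : ℝ) :
    gaussianTrigPoly S a b hb t x = trigPoly S a (t + x) * (rexp (-(π * b * x ^ 2)) : ℂ) := by
  simp only [gaussianTrigPoly, trigPoly, sum_apply, Finset.sum_mul]
  refine Finset.sum_congr rfl fun n _ => ?_
  have h : (2 * π * I * n * x / (1 : ℝ) : ℂ) = 2 * π * (I * (n : ℝ)) * x := by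
    push_cast; ring
  have h' : ((-(π * b * x ^ 2) : ℝ) : ℂ) = -π * b * x ^ 2 := by push_cast; ring
  rw [smul_apply, modulatedGaussian_apply, fourier_apply_add, smul_eq_mul,
    fourier_coe_apply, Complex.exp_add, h, ofReal_exp, h']
  ring

lemma lintegral_gaussianTrigPoly (S : Finset ℤ) (a : ℤ → ℂ) {q ε : ℝ} (hq : 0 < q) (hε : 0 < ε)
    (hb : 0 < q⁻¹ * ε ^ 2) (t : AddCircle (1 : ℝ)) :
    ∫⁻ x : ℝ, ‖gaussianTrigPoly S a (q⁻¹ * ε ^ 2) hb t x‖ₑ ^ q =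
      ∫⁻ x : ℝ, ‖trigPoly S a (t + x)‖ₑ ^ q * ENNReal.ofReal (rexp (-(π * (ε * x) ^ 2))) := by
  refine lintegral_congr fun x => ?_
  rw [gaussianTrigPoly_apply, enorm_mul, ENNReal.mul_rpow_of_nonneg _ _ hq.le]
  congr 1
  rw [← ofReal_norm, Complex.norm_real, Real.norm_of_nonneg (Real.exp_pos _).le,
    ENNReal.ofReal_rpow_of_pos (Real.exp_pos _), ← Real.exp_mul]
  congr 2
  field_simp

/-- The two-scale symbol of the bilinear multiplier `m` applied to Gaussian perturbations, at
scale `ε`, of the trigonometric polynomials with coefficients `a` and `b`. -/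
noncomputable def twoScaleSymbol (m : ℝ × ℝ → ℂ) (A B : ℝ → ℂ) (S T : Finset ℤ) (a b : ℤ → ℂ)
    (ε : ℝ) (t : AddCircle (1 : ℝ)) (y : ℝ) : ℂ :=
  ∑ n ∈ S, ∑ k ∈ T, a n * b k * fourier (n + k) t * rescaledAmplitude m A B n k ε y

lemma measurable_twoScaleSymbol {m : ℝ × ℝ → ℂ} (hm_cont : Continuous m) {A B : ℝ → ℂ}
    (hA : Continuous A) (hB : Continuous B) (S T : Finset ℤ) (a b : ℤ → ℂ) (ε : ℝ) :
    Measurable (uncurry (twoScaleSymbol m A B S T a b ε)) := by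
  unfold twoScaleSymbol uncurry
  refine Finset.measurable_sum _ fun n _ => Finset.measurable_sum _ fun k _ => ?_
  refine Measurable.mul ?_
    ((measurable_rescaledAmplitude hm_cont hA hB n k ε).comp measurable_snd)
  exact (((fourier (n + k)).continuous.measurable.comp measurable_fst).const_mul _)

lemma bilinear_multiplier_gaussianTrigPoly {m : ℝ × ℝ → ℂ} {M : ℝ} (hm : ∀ ξ, ‖m ξ‖ ≤ M)
    (hm_cont : Continuous m) (S T : Finset ℤ) (a b : ℤ → ℂ) {c d ε : ℝ} (hc : 0 < c) (hd : 0 < d)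
    (hε : 0 < ε) (hc' : 0 < c * ε ^ 2) (hd' : 0 < d * ε ^ 2) (t : AddCircle (1 : ℝ)) (x : ℝ) :
    ∫ z : ℝ × ℝ, m z * 𝓕 (⇑(gaussianTrigPoly S a (c * ε ^ 2) hc' t)) z.1 *
        𝓕 (⇑(gaussianTrigPoly T b (d * ε ^ 2) hd' t)) z.2 *
        cexp (2 * π * I * (z.1 + z.2) * x) =
      twoScaleSymbol m (𝓕 (⇑(modulatedGaussian c hc 0))) (𝓕 (⇑(modulatedGaussian d hd 0)))
        S T a b ε (t + x) (ε * x) := by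
  simp only [gaussianTrigPoly, bilinear_multiplier_sum hm hm_cont,
    bilinear_multiplier_modulatedGaussian m hc hd hε, twoScaleSymbol]
  refine Finset.sum_congr rfl fun n _ => Finset.sum_congr rfl fun k _ => ?_
  have : (fourier (n + k) (x : AddCircle (1 : ℝ)) : ℂ) = cexp (2 * π * I * (n + k) * x) := by
    rw [fourier_coe_apply]
    push_cast
    ring_nf
  rw [fourier_apply_add, this, fourier_add]
  push_cast
  ring

lemma tendsto_twoScaleSymbol {m : ℝ × ℝ → ℂ} {M : ℝ} (hm : ∀ ξ, ‖m ξ‖ ≤ M)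
    (hm_cont : Continuous m) (S T : Finset ℤ) (a b : ℤ → ℂ) {c d : ℝ} (hc : 0 < c) (hd : 0 < d)
    {ε : ℕ → ℝ} (hε : Filter.Tendsto ε Filter.atTop (nhds 0)) (t : AddCircle (1 : ℝ)) (y : ℝ) :
    Filter.Tendsto (fun N => twoScaleSymbol m (𝓕 (⇑(modulatedGaussian c hc 0)))
        (𝓕 (⇑(modulatedGaussian d hd 0))) S T a b (ε N) t y) Filter.atTop
      (nhds ((∑ n ∈ S, ∑ k ∈ T, m (n, k) * a n * b k * fourier (n + k) t) *
        (rexp (-(π * (c + d) * y ^ 2)) : ℂ))) := by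
  simp only [Finset.sum_mul]
  refine tendsto_finsetSum _ fun n _ => tendsto_finsetSum _ fun k _ => ?_
  have h := (tendsto_rescaledAmplitude hm hm_cont (modulatedGaussian c hc 0).integrable_fourier
    (modulatedGaussian d hd 0).integrable_fourier n k y hε).const_mul (a n * b k * fourier (n + k) t)
  rw [integral_fourier_gaussian_mul_cexp, integral_fourier_gaussian_mul_cexp, ← ofReal_mul,
    ← Real.exp_add] at h
  convert! h using 2
  rw [show -(π * c * y ^ 2) + -(π * d * y ^ 2) = -(π * (c + d) * y ^ 2) by ring]
  ring

lemma lintegral_twoScaleSymbol_le {m : ℝ × ℝ → ℂ} {M : ℝ} (hm : ∀ ξ, ‖m ξ‖ ≤ M)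
    (hm_cont : Continuous m) {r r₁ r₂ : ℝ} (hr : 0 < r) (hr₁ : 0 < r₁) (hr₂ : 0 < r₂)
    (hrr : r / r₁ + r / r₂ = 1) {K : ℝ≥0∞}
    (hmult : ∀ f g : SchwartzMap ℝ ℂ,
      ∫⁻ x : ℝ, ‖∫ z : ℝ × ℝ, m z * 𝓕 (⇑f) z.1 * 𝓕 (⇑g) z.2 *
          cexp (2 * π * I * (z.1 + z.2) * x)‖ₑ ^ r ≤
        K * (∫⁻ x, ‖f x‖ₑ ^ r₁) ^ (r / r₁) * (∫⁻ x, ‖g x‖ₑ ^ r₂) ^ (r / r₂))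
    (S T : Finset ℤ) (a b : ℤ → ℂ) {ε : ℝ} (hε : 0 < ε) :
    ∫⁻ y : ℝ, ∫⁻ t, ‖twoScaleSymbol m (𝓕 (⇑(modulatedGaussian r₁⁻¹ (inv_pos.2 hr₁) 0)))
        (𝓕 (⇑(modulatedGaussian r₂⁻¹ (inv_pos.2 hr₂) 0))) S T a b ε t y‖ₑ ^ r ≤
      K * (∫⁻ t, ‖trigPoly S a t‖ₑ ^ r₁) ^ (r / r₁) *
        (∫⁻ t, ‖trigPoly T b t‖ₑ ^ r₂) ^ (r / r₂) := by
  set A := 𝓕 (⇑(modulatedGaussian r₁⁻¹ (inv_pos.2 hr₁) 0))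
  set B := 𝓕 (⇑(modulatedGaussian r₂⁻¹ (inv_pos.2 hr₂) 0))
  set E : ℝ → ℝ≥0∞ := fun y => ENNReal.ofReal (rexp (-(π * y ^ 2))) with hE
  have hEm : Measurable E := by fun_prop
  have hPm (S a) (q : ℝ) :
      Measurable (uncurry fun (t : AddCircle (1 : ℝ)) (y : ℝ) => ‖trigPoly S a t‖ₑ ^ q * E y) :=
    ((((continuous_trigPoly S a).measurable.comp measurable_fst).enorm).pow_const q).mul
      (hEm.comp measurable_snd)
  have hPint (S a) (q : ℝ) :
      ∫⁻ t : AddCircle (1 : ℝ), ∫⁻ x : ℝ, ‖trigPoly S a (t + x)‖ₑ ^ q * E (ε * x) =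
        ENNReal.ofReal ε⁻¹ * ∫⁻ t, ‖trigPoly S a t‖ₑ ^ q := by
    rw [lintegral_lintegral_translate_dilate (hPm S a q) hε]
    congr 1
    simp_rw [lintegral_mul_const _
      (((continuous_trigPoly S a).measurable.enorm).pow_const q)]
    rw [lintegral_const_mul _ hEm, hE, lintegral_exp_neg_pi_mul_sq, mul_one]
  have hPtm (S a) (q : ℝ) : Measurable fun t : AddCircle (1 : ℝ) =>
      ∫⁻ x : ℝ, ‖trigPoly S a (t + x)‖ₑ ^ q * E (ε * x) :=
    (measurable_translate_dilate (K := fun t y => ‖trigPoly S a t‖ₑ ^ q * E y)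
      (hPm S a q) ε).lintegral_prod_right'
  have hpt (t : AddCircle (1 : ℝ)) :
      ∫⁻ x : ℝ, ‖twoScaleSymbol m A B S T a b ε (t + x) (ε * x)‖ₑ ^ r ≤
        K * ((∫⁻ x : ℝ, ‖trigPoly S a (t + x)‖ₑ ^ r₁ * E (ε * x)) ^ (r / r₁) *
          (∫⁻ x : ℝ, ‖trigPoly T b (t + x)‖ₑ ^ r₂ * E (ε * x)) ^ (r / r₂)) := by
    have h₁ : 0 < r₁⁻¹ * ε ^ 2 := by positivity
    have h₂ : 0 < r₂⁻¹ * ε ^ 2 := by positivity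
    rw [← lintegral_gaussianTrigPoly S a hr₁ hε h₁, ← lintegral_gaussianTrigPoly T b hr₂ hε h₂,
      ← mul_assoc]
    refine le_trans (le_of_eq (lintegral_congr fun x => ?_))
      (hmult (gaussianTrigPoly S a _ h₁ t) (gaussianTrigPoly T b _ h₂ t))
    rw [bilinear_multiplier_gaussianTrigPoly hm hm_cont S T a b (inv_pos.2 hr₁) (inv_pos.2 hr₂) hε]
  have hHm := (measurable_twoScaleSymbol hm_cont (SchwartzMap.continuous_fourier _)
      (SchwartzMap.continuous_fourier _) S T a b ε : Measurable
    (uncurry (twoScaleSymbol m A B S T a b ε))).enorm.pow_const r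
  have hκ : ENNReal.ofReal ε⁻¹ ≠ 0 := by simpa using hε
  refine (ENNReal.mul_le_mul_iff_right hκ ENNReal.ofReal_ne_top).1 ?_
  rw [← lintegral_lintegral_translate_dilate
    (K := fun t y => ‖twoScaleSymbol m A B S T a b ε t y‖ₑ ^ r) hHm hε]
  refine (lintegral_mono hpt).trans ?_
  rw [lintegral_const_mul _ (((hPtm S a r₁).pow_const _).fun_mul ((hPtm T b r₂).pow_const _))]
  have hκ' : ENNReal.ofReal ε⁻¹ =
      ENNReal.ofReal ε⁻¹ ^ (r / r₁) * ENNReal.ofReal ε⁻¹ ^ (r / r₂) := by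
    rw [← ENNReal.rpow_add _ _ hκ ENNReal.ofReal_ne_top, hrr, ENNReal.rpow_one]
  calc _ ≤ K * ((ENNReal.ofReal ε⁻¹ * ∫⁻ t, ‖trigPoly S a t‖ₑ ^ r₁) ^ (r / r₁) *
        (ENNReal.ofReal ε⁻¹ * ∫⁻ t, ‖trigPoly T b t‖ₑ ^ r₂) ^ (r / r₂)) := by
        gcongr
        rw [← hPint, ← hPint]
        exact ENNReal.lintegral_mul_norm_pow_le (hPtm S a r₁).aemeasurable
          (hPtm T b r₂).aemeasurable (by positivity) (by positivity) hrr
    _ = _ := by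
        rw [ENNReal.mul_rpow_of_nonneg _ _ (by positivity),
          ENNReal.mul_rpow_of_nonneg _ _ (by positivity)]
        nth_rewrite 3 [hκ']
        ring

lemma lintegral_restricted_multiplier_le {m : ℝ × ℝ → ℂ} {M : ℝ} (hm : ∀ ξ, ‖m ξ‖ ≤ M)
    (hm_cont : Continuous m) {r r₁ r₂ : ℝ} (hr : 0 < r) (hr₁ : 0 < r₁) (hr₂ : 0 < r₂)
    (hrr : r / r₁ + r / r₂ = 1) {K : ℝ≥0∞}
    (hmult : ∀ f g : SchwartzMap ℝ ℂ,
      ∫⁻ x : ℝ, ‖∫ z : ℝ × ℝ, m z * 𝓕 (⇑f) z.1 * 𝓕 (⇑g) z.2 *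
          cexp (2 * π * I * (z.1 + z.2) * x)‖ₑ ^ r ≤
        K * (∫⁻ x, ‖f x‖ₑ ^ r₁) ^ (r / r₁) * (∫⁻ x, ‖g x‖ₑ ^ r₂) ^ (r / r₂))
    (S T : Finset ℤ) (a b : ℤ → ℂ) :
    ∫⁻ t : AddCircle (1 : ℝ),
        ‖∑ n ∈ S, ∑ k ∈ T, m (n, k) * a n * b k * fourier (n + k) t‖ₑ ^ r ≤
      K * (∫⁻ t, ‖trigPoly S a t‖ₑ ^ r₁) ^ (r / r₁) *
        (∫⁻ t, ‖trigPoly T b t‖ₑ ^ r₂) ^ (r / r₂) := by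
  set R : AddCircle (1 : ℝ) → ℂ :=
    fun t => ∑ n ∈ S, ∑ k ∈ T, m (n, k) * a n * b k * fourier (n + k) t
  have hRm : Measurable R := (show Continuous R by fun_prop).measurable
  set H : ℕ → AddCircle (1 : ℝ) → ℝ → ℂ := fun N =>
    twoScaleSymbol m (𝓕 (⇑(modulatedGaussian r₁⁻¹ (inv_pos.2 hr₁) 0)))
      (𝓕 (⇑(modulatedGaussian r₂⁻¹ (inv_pos.2 hr₂) 0))) S T a b (1 / ((N : ℝ) + 1))
  have hHm (N : ℕ) : Measurable fun z : ℝ × AddCircle (1 : ℝ) => ‖H N z.2 z.1‖ₑ ^ r :=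
    ((measurable_twoScaleSymbol hm_cont (SchwartzMap.continuous_fourier _)
      (SchwartzMap.continuous_fourier _) S T a b _).comp
        measurable_swap).enorm.pow_const r
  have hlim (z : ℝ × AddCircle (1 : ℝ)) : Filter.Tendsto (fun N => ‖H N z.2 z.1‖ₑ ^ r)
      Filter.atTop (nhds (ENNReal.ofReal (rexp (-(π * z.1 ^ 2))) * ‖R z.2‖ₑ ^ r)) := by
    have h := ((ENNReal.continuous_rpow_const (y := r)).tendsto _).comp
      (tendsto_twoScaleSymbol hm hm_cont S T a b (inv_pos.2 hr₁) (inv_pos.2 hr₂)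
        tendsto_one_div_add_atTop_nhds_zero_nat z.2 z.1).enorm
    convert! h using 2
    rw [enorm_mul, ENNReal.mul_rpow_of_nonneg _ _ hr.le, mul_comm]
    congr 1
    rw [← ofReal_norm (_ : ℂ), Complex.norm_real, Real.norm_of_nonneg (Real.exp_pos _).le,
      ENNReal.ofReal_rpow_of_pos (Real.exp_pos _), ← Real.exp_mul]
    congr 2
    have : (r₁⁻¹ + r₂⁻¹) * r = 1 := by rw [← hrr]; ring
    linear_combination π * z.1 ^ 2 * this
  calc ∫⁻ t, ‖R t‖ₑ ^ r
      = ∫⁻ z : ℝ × AddCircle (1 : ℝ), ENNReal.ofReal (rexp (-(π * z.1 ^ 2))) * ‖R z.2‖ₑ ^ r := by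
        rw [Measure.volume_eq_prod, lintegral_prod_mul
          (f := fun y => ENNReal.ofReal (rexp (-(π * y ^ 2)))) (g := fun t => ‖R t‖ₑ ^ r)
          (by fun_prop) (hRm.enorm.pow_const r).aemeasurable, lintegral_exp_neg_pi_mul_sq, one_mul]
    _ = ∫⁻ z : ℝ × AddCircle (1 : ℝ), Filter.liminf (fun N => ‖H N z.2 z.1‖ₑ ^ r) Filter.atTop :=
        lintegral_congr fun z => (hlim z).liminf_eq.symm
    _ ≤ Filter.liminf (fun N => ∫⁻ z : ℝ × AddCircle (1 : ℝ), ‖H N z.2 z.1‖ₑ ^ r) Filter.atTop :=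
        lintegral_liminf_le hHm
    _ ≤ _ := by
        refine Filter.liminf_le_of_frequently_le' (.of_forall fun N => ?_)
        rw [Measure.volume_eq_prod, lintegral_prod _ (hHm N).aemeasurable]
        exact lintegral_twoScaleSymbol_le hm hm_cont hr hr₁ hr₂ hrr hmult S T a b (by positivity)

/-- **Bilinear De Leeuw restriction theorem** for `ℤ < ℝ`: a bounded continuous
bilinear `(p₁, p₂) → p` Fourier multiplier on `ℝ` restricts to a bilinear Fourier
multiplier on `ℤ` (i.e. on the circle `𝕋 = ℝ/ℤ`) with the same bound. -/
theorem bilinear_deLeeuw_restriction_Z_in_R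
    (p p₁ p₂ : ℝ≥0∞) (hp : 1 ≤ p) (hp' : p < ∞)
    (hp₁ : 1 ≤ p₁) (hp₁' : p₁ < ∞) (hp₂ : 1 ≤ p₂) (hp₂' : p₂ < ∞)
    (hpp : 1 / p = 1 / p₁ + 1 / p₂)
    (m : ℝ × ℝ → ℂ) (hm_bdd : ∃ M : ℝ, ∀ ξ, ‖m ξ‖ ≤ M) (hm_cont : Continuous m)
    (C : ℝ) (hC : 0 ≤ C)
    (hmult : ∀ f g : SchwartzMap ℝ ℂ,
      eLpNorm
          (fun x : ℝ =>
            ∫ ξη : ℝ × ℝ,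
              m ξη * 𝓕 (⇑f) ξη.1 * 𝓕 (⇑g) ξη.2 *
                Complex.exp (2 * Real.pi * Complex.I * (ξη.1 + ξη.2) * x)) p volume
        ≤ ENNReal.ofReal C * eLpNorm (⇑f) p₁ volume * eLpNorm (⇑g) p₂ volume) :
    ∀ a b : ℤ → ℂ, (Function.support a).Finite → (Function.support b).Finite →
      eLpNorm
          (fun x : AddCircle (1 : ℝ) =>
            ∑ᶠ n : ℤ, ∑ᶠ k : ℤ, m ((n : ℝ), (k : ℝ)) * a n * b k * fourier (n + k) x)
          p volume
        ≤ ENNReal.ofReal C *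
            eLpNorm (fun x : AddCircle (1 : ℝ) => ∑ᶠ n : ℤ, a n * fourier n x) p₁ volume *
            eLpNorm (fun x : AddCircle (1 : ℝ) => ∑ᶠ k : ℤ, b k * fourier k x) p₂ volume := by
  intro a b ha hb
  obtain ⟨M, hM⟩ := hm_bdd
  have h0 := (zero_lt_one.trans_le hp).ne'
  have h0₁ := (zero_lt_one.trans_le hp₁).ne'
  have h0₂ := (zero_lt_one.trans_le hp₂).ne'
  have hr := ENNReal.toReal_pos h0 hp'.ne
  have hr₁ := ENNReal.toReal_pos h0₁ hp₁'.ne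
  have hr₂ := ENNReal.toReal_pos h0₂ hp₂'.ne
  have hrr : p.toReal / p₁.toReal + p.toReal / p₂.toReal = 1 := by
    have h := congrArg ENNReal.toReal hpp
    rw [ENNReal.toReal_add (by simpa using h0₁) (by simpa using h0₂)] at h
    simp only [one_div, ENNReal.toReal_inv] at h
    rw [div_eq_mul_inv, div_eq_mul_inv, ← mul_add, ← h, mul_inv_cancel₀ hr.ne']
  have hsum (c : ℤ → ℂ) (hc : (support c).Finite) :
      (fun x : AddCircle (1 : ℝ) => ∑ᶠ n : ℤ, c n * fourier n x) = trigPoly hc.toFinset c := by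
    ext x
    refine finsum_eq_sum_of_support_subset _ fun n hn => ?_
    simpa using left_ne_zero_of_mul hn
  have hsum₂ : (fun x : AddCircle (1 : ℝ) =>
      ∑ᶠ n : ℤ, ∑ᶠ k : ℤ, m ((n : ℝ), (k : ℝ)) * a n * b k * fourier (n + k) x) =
      fun x => ∑ n ∈ ha.toFinset, ∑ k ∈ hb.toFinset,
        m ((n : ℝ), (k : ℝ)) * a n * b k * fourier (n + k) x := by
    ext x
    have hin (n : ℤ) : ∑ᶠ k : ℤ, m ((n : ℝ), (k : ℝ)) * a n * b k * fourier (n + k) x =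
        ∑ k ∈ hb.toFinset, m ((n : ℝ), (k : ℝ)) * a n * b k * fourier (n + k) x := by
      refine finsum_eq_sum_of_support_subset _ fun k hk => ?_
      simpa using right_ne_zero_of_mul (left_ne_zero_of_mul hk)
    simp_rw [hin]
    refine finsum_eq_sum_of_support_subset _ fun n hn => ?_
    simp only [Set.Finite.coe_toFinset, mem_support]
    rintro h
    simp [h] at hn
  rw [hsum a ha, hsum b hb, hsum₂,
    eLpNorm_le_mul_eLpNorm_iff h0 hp'.ne h0₁ hp₁'.ne h0₂ hp₂'.ne]
  refine lintegral_restricted_multiplier_le hM hm_cont hr hr₁ hr₂ hrr (fun f g => ?_) _ _ a b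
  exact (eLpNorm_le_mul_eLpNorm_iff h0 hp'.ne h0₁ hp₁'.ne h0₂ hp₂'.ne _ _ _ _).1 (hmult f g)
end

section
/- Fix n ≥ 2 and let G = SL(n,ℝ) with a Haar measure μ (regarded as an outer measure on all subsets of G). For a subset F ⊆ G and a set V ⊆ G with 0 < μ(V) < ∞ set δ_F(V) := μ(⋂_{s∈F} s V s⁻¹) / μ(V), and let δ_F be the supremum, over all sequences (V_i)_{i∈ℕ} of symmetric (V_i = V_i⁻¹), relatively compact, measurable neighbourhoods of the identity that form a neighbourhood basis at the identity, of liminf_i δ_F(V_i). For ρ > 1 let B_ρ := { g ∈ SL(n,ℝ) : ‖Ad_g‖ ≤ ρ }, where Ad_g is the linear map X ↦ gXg⁻¹ on the space of traceless real n×n matrices and ‖Ad_g‖ is its operator norm with respect to the Frobenius inner product ⟨X,Y⟩ = tr(XYᵀ). Then δ_{B_ρ} ≥ ρ^{−n(n−1)/2}. -/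
open MeasureTheory Filter Matrix
open scoped Pointwise ENNReal Topology

/-- The topology on `SL(n, ℝ)` induced from the space of matrices. -/
instance (n : ℕ) : TopologicalSpace (Matrix.SpecialLinearGroup (Fin n) ℝ) :=
  TopologicalSpace.induced (fun g => (g : Matrix (Fin n) (Fin n) ℝ)) inferInstance

instance (n : ℕ) : MeasurableSpace (Matrix.SpecialLinearGroup (Fin n) ℝ) := borel _

instance (n : ℕ) : BorelSpace (Matrix.SpecialLinearGroup (Fin n) ℝ) := ⟨rfl⟩

/-- `δ_F(V) = μ(⋂_{s ∈ F} s V s⁻¹) / μ(V)`. -/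
noncomputable def deltaRatio {G : Type*} [Group G] [MeasurableSpace G]
    (μ : Measure G) (F : Set G) (V : Set G) : ℝ≥0∞ :=
  μ (⋂ s ∈ F, (fun x => s * x * s⁻¹) '' V) / μ V

/-- `δ_F`: the supremum over all sequences of symmetric, relatively compact, measurable
neighbourhoods of the identity forming a neighbourhood basis at the identity, of
`liminf_i δ_F(V_i)`. -/
noncomputable def deltaSup {G : Type*} [Group G] [TopologicalSpace G] [MeasurableSpace G]
    (μ : Measure G) (F : Set G) : ℝ≥0∞ :=
  ⨆ (V : ℕ → Set G) (_ : ∀ i, V i ∈ 𝓝 (1 : G)) (_ : ∀ i, (V i)⁻¹ = V i)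
    (_ : ∀ i, IsCompact (closure (V i))) (_ : ∀ i, MeasurableSet (V i))
    (_ : ∀ U ∈ 𝓝 (1 : G), ∃ i, V i ⊆ U),
    Filter.liminf (fun i => deltaRatio μ F (V i)) Filter.atTop

/-- The ball `B_ρ = { g ∈ SL(n,ℝ) : ‖Ad_g‖ ≤ ρ }`, where `Ad_g X = g X g⁻¹` acts on the
traceless real `n × n` matrices and the operator norm is taken with respect to the
Frobenius norm `‖X‖ = sqrt(tr (X Xᵀ)) = sqrt(Σ_{i,j} X_{ij}²)`; membership is expressed
through the defining property `‖Ad_g X‖ ≤ ρ ‖X‖` for all traceless `X`. -/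
def adjointBall (n : ℕ) (ρ : ℝ) : Set (Matrix.SpecialLinearGroup (Fin n) ℝ) :=
  {g | ∀ X : Matrix (Fin n) (Fin n) ℝ, Matrix.trace X = 0 →
    Real.sqrt (∑ i, ∑ j,
        (((g : Matrix (Fin n) (Fin n) ℝ) * X * ((g⁻¹ : Matrix.SpecialLinearGroup (Fin n) ℝ) :
          Matrix (Fin n) (Fin n) ℝ)) i j) ^ 2)
      ≤ ρ * Real.sqrt (∑ i, ∑ j, (X i j) ^ 2)}

section Eigenvalues

variable {n : ℕ}

/-- `x` lists the eigenvalues of `X` with multiplicity: the characteristic polynomial of `X` is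
`∏ i, (T - x i)`. -/
def HasEigenvalueList (X : Matrix (Fin n) (Fin n) ℝ) (x : Fin n → ℝ) : Prop :=
  X.charpoly = ∏ i, (Polynomial.X - Polynomial.C (x i))

/-- All complex eigenvalues of `X` are real and have absolute value at most `ε`. -/
def HasSmallRealSpectrum (ε : ℝ) (X : Matrix (Fin n) (Fin n) ℝ) : Prop :=
  ∃ x : Fin n → ℝ, (∀ i, |x i| ≤ ε) ∧ HasEigenvalueList X x

theorem hasEigenvalueList_iff {X : Matrix (Fin n) (Fin n) ℝ} {x : Fin n → ℝ} :
    HasEigenvalueList X x ↔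
      ∀ t : ℝ, (t • (1 : Matrix (Fin n) (Fin n) ℝ) - X).det = ∏ i, (t - x i) := by
  have key : ∀ t : ℝ, X.charpoly.eval t = (t • (1 : Matrix (Fin n) (Fin n) ℝ) - X).det := by
    intro t
    rw [Matrix.eval_charpoly, Matrix.scalar_apply, Matrix.smul_one_eq_diagonal]
  constructor
  · intro h t
    rw [← key, h, Polynomial.eval_prod]
    simp
  · intro h
    refine Polynomial.funext fun t => ?_
    rw [key, h, Polynomial.eval_prod]
    simp

namespace HasEigenvalueList

variable {X : Matrix (Fin n) (Fin n) ℝ} {x : Fin n → ℝ}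

theorem det_affine (h : HasEigenvalueList X x) (a b : ℝ) :
    (a • (1 : Matrix (Fin n) (Fin n) ℝ) + b • X).det = ∏ i, (a + b * x i) := by
  rcases eq_or_ne b 0 with rfl | hb
  · simp
  · have h1 := hasEigenvalueList_iff.1 h (-(a / b))
    have h2 : a • (1 : Matrix (Fin n) (Fin n) ℝ) + b • X = (-b) • ((-(a / b)) • 1 - X) := by
      rw [smul_sub, smul_smul, neg_mul_neg, mul_div_cancel₀ _ hb, neg_smul, sub_neg_eq_add]
    rw [h2, Matrix.det_smul, h1, Fintype.card, ← Finset.prod_const, ← Finset.prod_mul_distrib]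
    refine Finset.prod_congr rfl fun i _ => ?_
    field_simp
    ring

theorem affine (h : HasEigenvalueList X x) (a b : ℝ) :
    HasEigenvalueList (a • (1 : Matrix (Fin n) (Fin n) ℝ) + b • X) (fun i => a + b * x i) := by
  refine hasEigenvalueList_iff.2 fun t => ?_
  have : t • (1 : Matrix (Fin n) (Fin n) ℝ) - (a • 1 + b • X) = (t - a) • 1 + (-b) • X := by
    rw [sub_smul, neg_smul]; abel
  rw [this, h.det_affine]
  exact Finset.prod_congr rfl fun i _ => by ring

theorem trace_eq (h : HasEigenvalueList X x) : X.trace = ∑ i, x i := by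
  have hs : X.charpoly.Splits := by
    rw [h]
    exact Polynomial.Splits.prod fun i _ => Polynomial.Splits.X_sub_C _
  have hr : X.charpoly.roots = Finset.univ.val.map x := by
    rw [h, ← Polynomial.roots_multiset_prod_X_sub_C (Finset.univ.val.map x), Multiset.map_map]
    rfl
  rw [Matrix.trace_eq_sum_roots_charpoly_of_splits hs, hr]
  rfl

theorem conj (h : HasEigenvalueList X x) {A B : Matrix (Fin n) (Fin n) ℝ} (hAB : A * B = 1) :
    HasEigenvalueList (A * X * B) x := by
  refine hasEigenvalueList_iff.2 fun t => ?_
  rw [← hasEigenvalueList_iff.1 h t]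
  have : t • (1 : Matrix (Fin n) (Fin n) ℝ) - A * X * B = A * (t • 1 - X) * B := by
    rw [mul_sub, sub_mul, mul_smul_comm, mul_one, smul_mul_assoc, hAB]
  rw [this, Matrix.det_mul, Matrix.det_mul, mul_right_comm, ← Matrix.det_mul, hAB, Matrix.det_one,
    one_mul]

theorem inv (h : HasEigenvalueList X x) (hx : ∀ i, x i ≠ 0) :
    HasEigenvalueList X⁻¹ (fun i => (x i)⁻¹) := by
  have hdet : X.det = ∏ i, x i := by simpa using h.det_affine 0 1
  have hne : X.det ≠ 0 := by
    rw [hdet]; exact Finset.prod_ne_zero_iff.2 fun i _ => hx i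
  refine hasEigenvalueList_iff.2 fun t => ?_
  have h1 : (t • (1 : Matrix (Fin n) (Fin n) ℝ) - X⁻¹) * X = (-1 : ℝ) • 1 + t • X := by
    rw [sub_mul, Matrix.nonsing_inv_mul _ (isUnit_iff_ne_zero.2 hne), smul_mul_assoc, one_mul,
      neg_smul, one_smul]
    abel
  have h2 := congrArg Matrix.det h1
  rw [Matrix.det_mul, h.det_affine, hdet] at h2
  rw [← hdet] at h2
  refine mul_right_cancel₀ hne (h2.trans ?_)
  rw [hdet, ← Finset.prod_mul_distrib]
  refine Finset.prod_congr rfl fun i _ => ?_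
  rw [sub_mul, inv_mul_cancel₀ (hx i)]
  ring

end HasEigenvalueList

theorem isClosed_hasSmallRealSpectrum (ε : ℝ) :
    IsClosed {X : Matrix (Fin n) (Fin n) ℝ | HasSmallRealSpectrum ε X} := by
  have hK : IsCompact (Set.univ.pi fun _ : Fin n => Set.Icc (-ε) ε) :=
    isCompact_univ_pi fun _ => isCompact_Icc
  have : CompactSpace (Set.univ.pi fun _ : Fin n => Set.Icc (-ε) ε) :=
    isCompact_iff_compactSpace.1 hK
  have hC : IsClosed {p : Matrix (Fin n) (Fin n) ℝ × (Set.univ.pi fun _ : Fin n => Set.Icc (-ε) ε) |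
      ∀ t : ℝ, (t • (1 : Matrix (Fin n) (Fin n) ℝ) - p.1).det = ∏ i, (t - p.2.1 i)} := by
    simp only [Set.ofPred_forall]
    refine isClosed_iInter fun t => isClosed_eq ?_ ?_
    · exact (continuous_const.sub continuous_fst).matrix_det
    · exact continuous_finsetProd _ fun i _ => continuous_const.sub
        ((continuous_apply i).comp (continuous_subtype_val.comp continuous_snd))
  convert isClosedMap_fst_of_compactSpace _ hC using 1
  ext X
  simp only [Set.mem_ofPred_eq, Set.mem_image, Prod.exists, exists_and_right, exists_eq_right,
    Subtype.exists]
  constructor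
  · rintro ⟨x, hx, h⟩
    exact ⟨x, fun i _ => abs_le.1 (hx i), hasEigenvalueList_iff.1 h⟩
  · rintro ⟨x, hx, h⟩
    exact ⟨x, fun i => abs_le.2 (hx i trivial), hasEigenvalueList_iff.2 h⟩

end Eigenvalues

section Deflation

variable {n : ℕ}

theorem det_eq_mul_det_of_column_zero {A : Matrix (Fin (n + 1)) (Fin (n + 1)) ℝ}
    (h : ∀ i : Fin n, A i.succ 0 = 0) : A.det = A 0 0 * (A.submatrix Fin.succ Fin.succ).det := by
  rw [Matrix.det_succ_column_zero, Fin.sum_univ_succ]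
  simp [h]

/-- Splitting off the eigenvector `(1, u)` from a matrix with blocks `p, b, q, Z`. -/
theorem HasEigenvalueList.deflate {Y : Matrix (Fin (n + 1)) (Fin (n + 1)) ℝ} {x : Fin (n + 1) → ℝ}
    (h : HasEigenvalueList Y x) {u : Fin n → ℝ}
    (h0 : Y 0 0 + ∑ j : Fin n, Y 0 j.succ * u j = x 0)
    (h1 : ∀ i : Fin n, Y i.succ 0 + ∑ j : Fin n, Y i.succ j.succ * u j = x 0 * u i) :
    HasEigenvalueList (Y.submatrix Fin.succ Fin.succ - vecMulVec u fun j => Y 0 j.succ)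
      fun i => x i.succ := by
  set Z := Y.submatrix Fin.succ Fin.succ - vecMulVec u fun j => Y 0 j.succ with hZ
  set G : Matrix (Fin (n + 1)) (Fin (n + 1)) ℝ :=
    Matrix.of (Fin.cons (Fin.cons 1 0) fun i => Fin.cons (u i) ((1 : Matrix (Fin n) (Fin n) ℝ) i))
  set T : Matrix (Fin (n + 1)) (Fin (n + 1)) ℝ :=
    Matrix.of (Fin.cons (Fin.cons (x 0) fun j => Y 0 j.succ) fun i => Fin.cons 0 (Z i))
  have hG : G.det = 1 := by
    rw [← Matrix.det_transpose, det_eq_mul_det_of_column_zero (fun i => by simp [G])]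
    have : (Gᵀ.submatrix Fin.succ Fin.succ) = 1 := by
      ext i j
      simp [G, Matrix.one_apply, eq_comm]
    rw [this]
    simp [G]
  have hYG : Y * G = G * T := by
    ext i j
    rw [Matrix.mul_apply, Matrix.mul_apply, Fin.sum_univ_succ, Fin.sum_univ_succ]
    refine Fin.cases ?_ (fun i => ?_) i <;> refine Fin.cases ?_ (fun j => ?_) j
    · simp [G, T, h0]
    · simp [G, T, Matrix.one_apply]
    · simp [G, T, h1, mul_comm (x 0)]
    · simp [G, T, Matrix.one_apply, hZ, vecMulVec_apply]
  have hdet : ∀ t : ℝ, (t - x 0) * (t • (1 : Matrix (Fin n) (Fin n) ℝ) - Z).det =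
      (t - x 0) * ∏ i : Fin n, (t - x i.succ) := by
    intro t
    rw [← Fin.prod_univ_succ (fun i => t - x i), ← hasEigenvalueList_iff.1 h t]
    have e1 : (t • (1 : Matrix (Fin (n + 1)) (Fin (n + 1)) ℝ) - T).det =
        (t - x 0) * (t • (1 : Matrix (Fin n) (Fin n) ℝ) - Z).det := by
      rw [det_eq_mul_det_of_column_zero (fun i => by simp [T])]
      congr 2
      · simp [T]
      · ext i j
        simp [T, Matrix.one_apply]
    rw [← e1]
    have e2 : (t • (1 : Matrix (Fin (n + 1)) (Fin (n + 1)) ℝ) - Y) * G = G * (t • 1 - T) := by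
      rw [sub_mul, mul_sub, hYG, smul_mul_assoc, one_mul, mul_smul_comm, mul_one]
    have e3 := congrArg Matrix.det e2
    rw [Matrix.det_mul, Matrix.det_mul, hG, mul_one, one_mul] at e3
    exact e3.symm
  refine mul_left_cancel₀ (Polynomial.X_sub_C_ne_zero (x 0)) (Polynomial.funext fun t => ?_)
  have key : Z.charpoly.eval t = (t • (1 : Matrix (Fin n) (Fin n) ℝ) - Z).det := by
    rw [Matrix.eval_charpoly, Matrix.scalar_apply, Matrix.smul_one_eq_diagonal]
  simpa [Polynomial.eval_prod, key] using hdet t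

/-- Up to a simultaneous permutation of rows and columns, a matrix with real spectrum has an
eigenvector `(1, u)` with entries of absolute value at most one. -/
theorem HasEigenvalueList.exists_pivot {X : Matrix (Fin (n + 1)) (Fin (n + 1)) ℝ}
    {x : Fin (n + 1) → ℝ} (h : HasEigenvalueList X x) :
    ∃ k : Fin (n + 1), ∃ u : Fin n → ℝ, (∀ i, |u i| ≤ 1) ∧
      X (Equiv.swap 0 k 0) (Equiv.swap 0 k 0) +
          ∑ j : Fin n, X (Equiv.swap 0 k 0) (Equiv.swap 0 k j.succ) * u j = x 0 ∧
      ∀ i : Fin n, X (Equiv.swap 0 k i.succ) (Equiv.swap 0 k 0) +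
          ∑ j : Fin n, X (Equiv.swap 0 k i.succ) (Equiv.swap 0 k j.succ) * u j = x 0 * u i := by
  have hdet : (x 0 • (1 : Matrix (Fin (n + 1)) (Fin (n + 1)) ℝ) - X).det = 0 := by
    rw [hasEigenvalueList_iff.1 h]
    exact Finset.prod_eq_zero (Finset.mem_univ 0) (sub_self _)
  obtain ⟨v, hv, hXv⟩ := Matrix.exists_mulVec_eq_zero_iff.2 hdet
  obtain ⟨k, hk⟩ := Finite.exists_max fun i => |v i|
  have hvk : v k ≠ 0 := by
    intro h0
    refine hv (funext fun i => ?_)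
    have := hk i
    rw [h0, abs_zero] at this
    exact abs_nonpos_iff.1 this
  have hrow : ∀ i, ∑ j, X i j * v j = x 0 * v i := by
    intro i
    have := congrFun hXv i
    rw [Matrix.sub_mulVec, Matrix.smul_mulVec, Matrix.one_mulVec] at this
    simp only [Pi.sub_apply, Pi.smul_apply, smul_eq_mul, Pi.zero_apply, sub_eq_zero] at this
    rw [this]; rfl
  have hrow' : ∀ i, X i (Equiv.swap 0 k 0) * v k +
      ∑ j : Fin n, X i (Equiv.swap 0 k j.succ) * v (Equiv.swap 0 k j.succ) = x 0 * v i := by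
    intro i
    rw [← hrow i, ← Equiv.sum_comp (Equiv.swap 0 k), Fin.sum_univ_succ, Equiv.swap_apply_left]
  refine ⟨k, fun i => v (Equiv.swap 0 k i.succ) / v k, fun i => ?_, ?_, fun i => ?_⟩
  · rw [abs_div]
    exact div_le_one_of_le₀ (hk _) (abs_nonneg _)
  · have := hrow' (Equiv.swap 0 k 0)
    refine mul_right_cancel₀ hvk ?_
    rw [add_mul, Finset.sum_mul]
    rw [Equiv.swap_apply_left] at this ⊢
    rw [← this]
    congr 1
    exact Finset.sum_congr rfl fun j _ => by field_simp
  · have := hrow' (Equiv.swap 0 k i.succ)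
    refine mul_right_cancel₀ hvk ?_
    rw [add_mul, Finset.sum_mul, mul_assoc (x 0), div_mul_cancel₀ _ hvk, ← this]
    congr 1
    exact Finset.sum_congr rfl fun j _ => by field_simp

end Deflation

section MatrixVolume

instance isAddHaarMeasure_volume_pi_pi (n : ℕ) :
    (volume : Measure (Fin n → Fin n → ℝ)).IsAddHaarMeasure :=
  Measure.pi.isAddHaarMeasure fun _ : Fin n => (volume : Measure (Fin n → ℝ))

theorem exists_measure_preimage_le {E F : Type*} [NormedAddCommGroup E] [NormedSpace ℝ E]
    [FiniteDimensional ℝ E] [MeasurableSpace E] [BorelSpace E] [NormedAddCommGroup F]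
    [NormedSpace ℝ F] [FiniteDimensional ℝ F] [MeasurableSpace F] [BorelSpace F]
    (μ : Measure E) [μ.IsAddHaarMeasure] (ν : Measure F) [ν.IsAddHaarMeasure] (e : E ≃ₗ[ℝ] F) :
    ∃ c : ℝ≥0∞, c ≠ ∞ ∧ ∀ S : Set F, MeasurableSet S → μ (e ⁻¹' S) ≤ c * ν S := by
  have : (μ.map e).IsAddHaarMeasure := e.toContinuousLinearEquiv.isAddHaarMeasure_map μ
  have h := Measure.isAddLeftInvariant_eq_smul (μ.map e) ν
  refine ⟨((μ.map e).addHaarScalarFactor ν : ℝ≥0∞), ENNReal.coe_ne_top, fun S hS => ?_⟩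
  have hm : Measurable e := e.toContinuousLinearEquiv.continuous.measurable
  rw [← Measure.map_apply hm hS]
  exact (congrArg (fun m : Measure F => m S) h).le

/-- The blocks of an `(n + 1) × (n + 1)` matrix after exchanging the indices `0` and `k`. -/
def blockEquiv {n : ℕ} (k : Fin (n + 1)) :
    (Fin (n + 1) → Fin (n + 1) → ℝ) ≃ₗ[ℝ]
      ((Fin n → ℝ) × (ℝ × (Fin n → Fin n → ℝ))) × (Fin n → ℝ) where
  toFun X := ((fun j => X (Equiv.swap 0 k 0) (Equiv.swap 0 k j.succ),
    (X (Equiv.swap 0 k 0) (Equiv.swap 0 k 0),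
      fun i j => X (Equiv.swap 0 k i.succ) (Equiv.swap 0 k j.succ))),
    fun i => X (Equiv.swap 0 k i.succ) (Equiv.swap 0 k 0))
  map_add' _ _ := rfl
  map_smul' _ _ := rfl
  invFun e i j :=
    (Fin.cons (Fin.cons e.1.2.1 e.1.1) fun i => Fin.cons (e.2 i) (e.1.2.2 i) :
      Fin (n + 1) → Fin (n + 1) → ℝ) (Equiv.swap 0 k i) (Equiv.swap 0 k j)
  left_inv X := by
    have : (Fin.cons (Fin.cons (X (Equiv.swap 0 k 0) (Equiv.swap 0 k 0))
          fun j => X (Equiv.swap 0 k 0) (Equiv.swap 0 k j.succ)) fun i =>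
          Fin.cons (X (Equiv.swap 0 k i.succ) (Equiv.swap 0 k 0))
            fun j => X (Equiv.swap 0 k i.succ) (Equiv.swap 0 k j.succ) :
        Fin (n + 1) → Fin (n + 1) → ℝ) = fun i j => X (Equiv.swap 0 k i) (Equiv.swap 0 k j) := by
      funext i j
      refine Fin.cases ?_ (fun i => ?_) i <;> refine Fin.cases ?_ (fun j => ?_) j <;>
        simp only [Fin.cons_zero, Fin.cons_succ]
    funext i j
    simp only [this, Equiv.swap_apply_self]
  right_inv e := by
    simp only [Equiv.swap_apply_self, Fin.cons_zero, Fin.cons_succ]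

/-- The last column block of a matrix with eigenvector `(1, u)` and remaining blocks `a`. -/
def columnBlock {n : ℕ} (a : (Fin n → ℝ) × (ℝ × (Fin n → Fin n → ℝ))) (u : Fin n → ℝ) :
    Fin n → ℝ :=
  (a.2.1 + a.1 ⬝ᵥ u) • u - Matrix.of a.2.2 *ᵥ u

theorem hasFDerivAt_columnBlock {n : ℕ} (a : (Fin n → ℝ) × (ℝ × (Fin n → Fin n → ℝ)))
    (u : Fin n → ℝ) :
    HasFDerivAt (columnBlock a) (LinearMap.toContinuousLinearMap (Matrix.toLin'
      ((a.2.1 + a.1 ⬝ᵥ u) • (1 : Matrix (Fin n) (Fin n) ℝ) -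
        (Matrix.of a.2.2 - vecMulVec u a.1)))) u := by
  set L : (Fin n → ℝ) →L[ℝ] ℝ := LinearMap.toContinuousLinearMap (dotProductBilin ℝ ℝ a.1) with hL
  set Z : (Fin n → ℝ) →L[ℝ] (Fin n → ℝ) :=
    LinearMap.toContinuousLinearMap (Matrix.toLin' (Matrix.of a.2.2)) with hZ
  have h := (((L.hasFDerivAt (x := u)).const_add a.2.1).smul (hasFDerivAt_id u)).sub
    (Z.hasFDerivAt (x := u))
  refine (h.congr_fderiv ?_)
  refine ContinuousLinearMap.ext fun w => funext fun i => ?_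
  simp [L, Z, vecMulVec_mulVec]
  ring

/-- Blocks `a` and a vector `u` such that `(1, u)` is an eigenvector with eigenvalue at most `ε`
and the deflated matrix lies in `U`. -/
def pivotSet {n : ℕ} (R ε : ℝ) (U : Set (Fin n → Fin n → ℝ)) :
    Set (((Fin n → ℝ) × (ℝ × (Fin n → Fin n → ℝ))) × (Fin n → ℝ)) :=
  {p | p.2 ∈ Set.Icc (-1) 1 ∧ p.1.1 ∈ Set.Icc (fun _ => -R) (fun _ => R) ∧
    p.1.2.1 + p.1.1 ⬝ᵥ p.2 ∈ Set.Icc (-ε) ε ∧ (fun i j => p.1.2.2 i j - p.2 i * p.1.1 j) ∈ U}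

theorem isClosed_pivotSet {n : ℕ} (R ε : ℝ) {U : Set (Fin n → Fin n → ℝ)} (hU : IsClosed U) :
    IsClosed (pivotSet R ε U) := by
  refine (isClosed_Icc.preimage continuous_snd).inter
    ((isClosed_Icc.preimage (continuous_fst.comp continuous_fst)).inter
      ((isClosed_Icc.preimage ?_).inter (hU.preimage ?_)))
  · unfold dotProduct
    fun_prop
  · fun_prop

theorem volume_pivotSet_le {n : ℕ} (R ε : ℝ) {U : Set (Fin n → Fin n → ℝ)} (hU : IsClosed U) :
    volume (pivotSet R ε U) ≤ volume (Set.Icc (-1 : Fin n → ℝ) 1) *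
      (volume (Set.Icc (fun _ : Fin n => -R) (fun _ => R)) *
        (ENNReal.ofReal (2 * ε) * volume U)) := by
  have hm := (isClosed_pivotSet R ε hU).measurableSet
  have inner : ∀ (u b : Fin n → ℝ), volume {z : ℝ × (Fin n → Fin n → ℝ) |
      z.1 + b ⬝ᵥ u ∈ Set.Icc (-ε) ε ∧ (fun i j => z.2 i j - u i * b j) ∈ U} =
      ENNReal.ofReal (2 * ε) * volume U := by
    intro u b
    have : {z : ℝ × (Fin n → Fin n → ℝ) |
        z.1 + b ⬝ᵥ u ∈ Set.Icc (-ε) ε ∧ (fun i j => z.2 i j - u i * b j) ∈ U} =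
        ((fun t : ℝ => t + b ⬝ᵥ u) ⁻¹' Set.Icc (-ε) ε) ×ˢ
          ((fun Y : Fin n → Fin n → ℝ => Y + fun i j => -(u i * b j)) ⁻¹' U) := by
      ext z
      simp only [Set.mem_ofPred_eq, Set.mem_prod, Set.mem_preimage, sub_eq_add_neg]
      rfl
    rw [this, Measure.volume_eq_prod, Measure.prod_prod, measure_preimage_add_right,
      measure_preimage_add_right, Real.volume_Icc]
    congr 2
    ring
  rw [Measure.volume_eq_prod, Measure.prod_apply_symm hm]
  have slice : ∀ u : Fin n → ℝ, volume ((fun a => (a, u)) ⁻¹' pivotSet R ε U) ≤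
      (Set.Icc (-1 : Fin n → ℝ) 1).indicator (fun _ =>
        volume (Set.Icc (fun _ : Fin n => -R) (fun _ => R)) *
          (ENNReal.ofReal (2 * ε) * volume U)) u := by
    intro u
    by_cases hu : u ∈ Set.Icc (-1 : Fin n → ℝ) 1
    · rw [Set.indicator_of_mem hu, Measure.volume_eq_prod,
        Measure.prod_apply (hm.preimage measurable_prodMk_right)]
      refine (lintegral_mono (g := (Set.Icc (fun _ : Fin n => -R) (fun _ => R)).indicator
        fun _ => ENNReal.ofReal (2 * ε) * volume U) fun b => ?_).trans ?_
      · by_cases hb : b ∈ Set.Icc (fun _ : Fin n => -R) (fun _ => R)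
        · rw [Set.indicator_of_mem hb, ← inner u b]
          exact measure_mono fun z hz => hz.2.2
        · rw [Set.indicator_of_notMem hb, nonpos_iff_eq_zero]
          refine measure_mono_null (t := ∅) (fun z hz => hb hz.2.1) measure_empty
      · rw [lintegral_indicator measurableSet_Icc, setLIntegral_const, mul_comm]
    · rw [Set.indicator_of_notMem hu, nonpos_iff_eq_zero]
      exact measure_mono_null (t := ∅) (fun z hz => hu hz.1) measure_empty
  refine (lintegral_mono slice).trans ?_
  rw [lintegral_indicator measurableSet_Icc, setLIntegral_const, mul_comm]

/-- Blocks of matrices with an eigenvector `(1, u)`, where `(a, u)` lies in `pivotSet R ε U`. -/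
def deflatableSet {n : ℕ} (R ε : ℝ) (U : Set (Fin n → Fin n → ℝ)) :
    Set (((Fin n → ℝ) × (ℝ × (Fin n → Fin n → ℝ))) × (Fin n → ℝ)) :=
  {p | ∃ u, (p.1, u) ∈ pivotSet R ε U ∧ columnBlock p.1 u = p.2}

theorem continuous_columnBlock {n : ℕ} :
    Continuous fun p : ((Fin n → ℝ) × (ℝ × (Fin n → Fin n → ℝ))) × (Fin n → ℝ) =>
      columnBlock p.1 p.2 := by
  unfold columnBlock
  refine continuous_pi fun i => ?_
  simp only [Pi.sub_apply, Pi.smul_apply, smul_eq_mul, Matrix.mulVec, dotProduct, Matrix.of_apply]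
  fun_prop

theorem isClosed_deflatableSet {n : ℕ} (R ε : ℝ) {U : Set (Fin n → Fin n → ℝ)} (hU : IsClosed U) :
    IsClosed (deflatableSet R ε U) := by
  have : CompactSpace (Set.Icc (-1 : Fin n → ℝ) 1) := isCompact_iff_compactSpace.1 isCompact_Icc
  have hC : IsClosed {p : (((Fin n → ℝ) × (ℝ × (Fin n → Fin n → ℝ))) × (Fin n → ℝ)) ×
      (Set.Icc (-1 : Fin n → ℝ) 1) |
      (p.1.1, p.2.1) ∈ pivotSet R ε U ∧ columnBlock p.1.1 p.2.1 = p.1.2} := by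
    have hu : Continuous fun p : (((Fin n → ℝ) × (ℝ × (Fin n → Fin n → ℝ))) × (Fin n → ℝ)) ×
        (Set.Icc (-1 : Fin n → ℝ) 1) => (p.1.1, (p.2 : Fin n → ℝ)) := by fun_prop
    exact ((isClosed_pivotSet R ε hU).preimage hu).inter
      (isClosed_eq (continuous_columnBlock.comp hu) (by fun_prop))
  convert isClosedMap_fst_of_compactSpace _ hC using 1
  ext p
  constructor
  · rintro ⟨u, hu, h⟩
    exact ⟨(p, ⟨u, hu.1⟩), ⟨hu, h⟩, rfl⟩
  · rintro ⟨⟨p, u⟩, h, rfl⟩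
    exact ⟨u, h⟩

theorem HasSmallRealSpectrum.abs_det_sub_le {n : ℕ} {ε : ℝ} {X : Matrix (Fin n) (Fin n) ℝ}
    (h : HasSmallRealSpectrum ε X) {t : ℝ} (ht : |t| ≤ ε) :
    |(t • (1 : Matrix (Fin n) (Fin n) ℝ) - X).det| ≤ (2 * ε) ^ n := by
  obtain ⟨x, hx, h⟩ := h
  rw [hasEigenvalueList_iff.1 h, Finset.abs_prod]
  refine (Finset.prod_le_prod (fun i _ => abs_nonneg _) fun i _ => ?_).trans_eq
    (b := ∏ _i : Fin n, 2 * ε) (by simp)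
  calc |t - x i| ≤ |t| + |x i| := abs_sub _ _
    _ ≤ 2 * ε := by linarith [hx i]

theorem volume_deflatableSet_le {n : ℕ} (R ε : ℝ) {U : Set (Fin n → Fin n → ℝ)} (hU : IsClosed U)
    (hs : ∀ Y ∈ U, HasSmallRealSpectrum ε (Matrix.of Y)) :
    volume (deflatableSet R ε U) ≤ ENNReal.ofReal ((2 * ε) ^ n) * volume (pivotSet R ε U) := by
  have hm := (isClosed_pivotSet R ε hU).measurableSet
  rw [Measure.volume_eq_prod, Measure.prod_apply (isClosed_deflatableSet R ε hU).measurableSet,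
    Measure.prod_apply hm, ← lintegral_const_mul' _ _ ENNReal.ofReal_ne_top]
  refine lintegral_mono fun a => ?_
  have hA : MeasurableSet (Prod.mk a ⁻¹' pivotSet R ε U) := hm.preimage measurable_prodMk_left
  have himage : Prod.mk a ⁻¹' deflatableSet R ε U =
      columnBlock a '' (Prod.mk a ⁻¹' pivotSet R ε U) := rfl
  simp only [himage]
  refine (addHaar_image_le_lintegral_abs_det_fderiv volume hA fun u _ =>
    (hasFDerivAt_columnBlock a u).hasFDerivWithinAt).trans ?_
  refine (setLIntegral_mono measurable_const (g := fun _ => ENNReal.ofReal ((2 * ε) ^ n))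
    fun u hu => ENNReal.ofReal_le_ofReal ?_).trans_eq (setLIntegral_const _ _)
  rw [ContinuousLinearMap.det, LinearMap.coe_toContinuousLinearMap, LinearMap.det_toLin']
  refine HasSmallRealSpectrum.abs_det_sub_le ?_ (abs_le.2 hu.2.2.1)
  exact hs _ hu.2.2.2

instance isAddHaarMeasure_volume_blocks (n : ℕ) : (volume : Measure
    (((Fin n → ℝ) × (ℝ × (Fin n → Fin n → ℝ))) × (Fin n → ℝ))).IsAddHaarMeasure :=
  have : (volume : Measure (ℝ × (Fin n → Fin n → ℝ))).IsAddHaarMeasure :=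
    Measure.prod.instIsAddHaarMeasure volume volume
  have : (volume : Measure ((Fin n → ℝ) × (ℝ × (Fin n → Fin n → ℝ)))).IsAddHaarMeasure :=
    Measure.prod.instIsAddHaarMeasure volume volume
  Measure.prod.instIsAddHaarMeasure volume volume

theorem HasEigenvalueList.submatrix_equiv {n : ℕ} {X : Matrix (Fin n) (Fin n) ℝ} {x : Fin n → ℝ}
    (h : HasEigenvalueList X x) (e : Fin n ≃ Fin n) : HasEigenvalueList (X.submatrix e e) x := by
  have := Matrix.charpoly_reindex e.symm X
  rw [Matrix.reindex_apply, Equiv.symm_symm] at this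
  exact this.trans h

/-- Matrices with entries bounded by `R` and real spectrum bounded by `ε`. -/
def smallSpectrumBox (n : ℕ) (R ε : ℝ) : Set (Fin n → Fin n → ℝ) :=
  {Y | (∀ i j, |Y i j| ≤ R) ∧ HasSmallRealSpectrum ε (Matrix.of Y)}

theorem isClosed_smallSpectrumBox (n : ℕ) (R ε : ℝ) : IsClosed (smallSpectrumBox n R ε) := by
  refine IsClosed.inter (s₁ := {Y : Fin n → Fin n → ℝ | ∀ i j, |Y i j| ≤ R}) ?_
    ((isClosed_hasSmallRealSpectrum ε).preimage
    (continuous_id : Continuous fun Y : Fin n → Fin n → ℝ => Matrix.of Y))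
  simp only [Set.ofPred_forall]
  exact isClosed_iInter fun i => isClosed_iInter fun j => isClosed_le (by fun_prop) continuous_const

theorem smallSpectrumBox_subset (n : ℕ) {R ε : ℝ} :
    smallSpectrumBox (n + 1) R ε ⊆
      ⋃ k, blockEquiv k ⁻¹' deflatableSet R ε (smallSpectrumBox n (2 * R) ε) := by
  rintro Y ⟨hR, x, hx, h⟩
  obtain ⟨k, u, hu, h0, h1⟩ := h.exists_pivot
  have hd := (h.submatrix_equiv (Equiv.swap 0 k)).deflate (u := u) h0 h1
  refine Set.mem_iUnion.2 ⟨k, u, ⟨?_, ?_, ?_, fun i j => ?_, fun i => x i.succ,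
    fun i => hx _, hd⟩, ?_⟩
  · exact ⟨fun i => (abs_le.1 (hu i)).1, fun i => (abs_le.1 (hu i)).2⟩
  · exact ⟨fun i => (abs_le.1 (hR _ _)).1, fun i => (abs_le.1 (hR _ _)).2⟩
  · have : Y (Equiv.swap 0 k 0) (Equiv.swap 0 k 0) +
        (fun j : Fin n => Y (Equiv.swap 0 k 0) (Equiv.swap 0 k j.succ)) ⬝ᵥ u = x 0 := h0
    exact Set.mem_Icc.2 (abs_le.1 (this ▸ hx 0))
  · have e1 := hR (Equiv.swap 0 k i.succ) (Equiv.swap 0 k j.succ)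
    have e2 := hR (Equiv.swap 0 k 0) (Equiv.swap 0 k j.succ)
    calc |Y (Equiv.swap 0 k i.succ) (Equiv.swap 0 k j.succ) -
          u i * Y (Equiv.swap 0 k 0) (Equiv.swap 0 k j.succ)|
        ≤ |Y (Equiv.swap 0 k i.succ) (Equiv.swap 0 k j.succ)| +
          |u i| * |Y (Equiv.swap 0 k 0) (Equiv.swap 0 k j.succ)| := by
          rw [← abs_mul]; exact abs_sub _ _
      _ ≤ R + 1 * R := add_le_add e1 (mul_le_mul (hu i) e2 (abs_nonneg _) zero_le_one)
      _ = 2 * R := by ring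
  · funext i
    have h0' : Y (Equiv.swap 0 k 0) (Equiv.swap 0 k 0) +
        (fun j : Fin n => Y (Equiv.swap 0 k 0) (Equiv.swap 0 k j.succ)) ⬝ᵥ u = x 0 := h0
    have h1' : Y (Equiv.swap 0 k i.succ) (Equiv.swap 0 k 0) +
        ∑ j : Fin n, Y (Equiv.swap 0 k i.succ) (Equiv.swap 0 k j.succ) * u j = x 0 * u i := h1 i
    change (Y (Equiv.swap 0 k 0) (Equiv.swap 0 k 0) +
        (fun j : Fin n => Y (Equiv.swap 0 k 0) (Equiv.swap 0 k j.succ)) ⬝ᵥ u) * u i -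
        ∑ j : Fin n, Y (Equiv.swap 0 k i.succ) (Equiv.swap 0 k j.succ) * u j =
        Y (Equiv.swap 0 k i.succ) (Equiv.swap 0 k 0)
    rw [h0', ← h1', add_sub_cancel_right]

/-- The matrices in a fixed box with real spectrum bounded by `ε` have volume
`O(ε ^ (n * (n + 1) / 2))`. -/
theorem exists_volume_smallSpectrumBox_le (n : ℕ) (R : ℝ) :
    ∃ C : ℝ≥0∞, C ≠ ∞ ∧ ∀ ε : ℝ, 0 < ε →
      volume (smallSpectrumBox n R ε) ≤ C * ENNReal.ofReal (ε ^ (n + 1).choose 2) := by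
  induction n generalizing R with
  | zero =>
    refine ⟨volume (Set.univ : Set (Fin 0 → Fin 0 → ℝ)), ?_, fun ε _ => ?_⟩
    · have : (Set.univ : Set (Fin 0 → Fin 0 → ℝ)) = {0} := Set.eq_singleton_iff_unique_mem.2
        ⟨Set.mem_univ _, fun _ _ => Subsingleton.elim _ _⟩
      rw [this]
      exact isCompact_singleton.measure_lt_top.ne
    · simpa using measure_mono (Set.subset_univ _)
  | succ n ih =>
    obtain ⟨C, hC, hU⟩ := ih (2 * R)
    choose c hc hcS using fun k : Fin (n + 1) => exists_measure_preimage_le volume volume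
      (blockEquiv (n := n) k)
    set K : ℝ≥0∞ := ENNReal.ofReal (2 ^ n) * (volume (Set.Icc (-1 : Fin n → ℝ) 1) *
      (volume (Set.Icc (fun _ : Fin n => -R) (fun _ => R)) * (ENNReal.ofReal 2 * C))) with hK
    have hKtop : K ≠ ∞ := ENNReal.mul_ne_top ENNReal.ofReal_ne_top <|
      ENNReal.mul_ne_top isCompact_Icc.measure_lt_top.ne <|
      ENNReal.mul_ne_top isCompact_Icc.measure_lt_top.ne <|
      ENNReal.mul_ne_top ENNReal.ofReal_ne_top hC
    refine ⟨(∑ k, c k) * K, ENNReal.mul_ne_top (ENNReal.sum_ne_top.2 fun k _ => hc k) hKtop,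
      fun ε hε => ?_⟩
    have hcl := isClosed_smallSpectrumBox n (2 * R) ε
    have hD : volume (deflatableSet R ε (smallSpectrumBox n (2 * R) ε)) ≤
        K * ENNReal.ofReal (ε ^ (n + 1 + 1).choose 2) := by
      refine (volume_deflatableSet_le R ε hcl fun Y hY => hY.2).trans ?_
      calc _ ≤ ENNReal.ofReal ((2 * ε) ^ n) * (volume (Set.Icc (-1 : Fin n → ℝ) 1) *
          (volume (Set.Icc (fun _ : Fin n => -R) (fun _ => R)) * (ENNReal.ofReal (2 * ε) *
            (C * ENNReal.ofReal (ε ^ (n + 1).choose 2))))) := by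
            gcongr
            refine (volume_pivotSet_le R ε hcl).trans ?_
            gcongr
            exact hU ε hε
        _ = K * ENNReal.ofReal (ε ^ (n + 1 + 1).choose 2) := by
          have e1 : (n + 1 + 1).choose 2 = n + 1 + (n + 1).choose 2 := by
            rw [Nat.choose_succ_succ' (n + 1) 1, Nat.choose_one_right]
          rw [e1, pow_add, pow_succ, mul_pow, ENNReal.ofReal_mul (by positivity),
            ENNReal.ofReal_mul (by positivity), ENNReal.ofReal_mul (by positivity),
            ENNReal.ofReal_mul (by positivity), hK]
          ring
    calc volume (smallSpectrumBox (n + 1) R ε)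
        ≤ ∑ k, volume (blockEquiv k ⁻¹' deflatableSet R ε (smallSpectrumBox n (2 * R) ε)) :=
          (measure_mono (smallSpectrumBox_subset n)).trans (measure_iUnion_fintype_le _ _)
      _ ≤ ∑ k, c k * (K * ENNReal.ofReal (ε ^ (n + 1 + 1).choose 2)) :=
          Finset.sum_le_sum fun k _ => (hcS k _ (isClosed_deflatableSet R ε hcl).measurableSet).trans
            (by gcongr)
      _ = _ := by rw [← Finset.sum_mul, mul_assoc (∑ k, c k)]

end MatrixVolume

section SpectralCone

variable {n : ℕ}

/-- The Frobenius norm. -/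
noncomputable def frob (X : Matrix (Fin n) (Fin n) ℝ) : ℝ := √(∑ i, ∑ j, X i j ^ 2)

theorem frob_nonneg (X : Matrix (Fin n) (Fin n) ℝ) : 0 ≤ frob X := Real.sqrt_nonneg _

theorem frob_sq (X : Matrix (Fin n) (Fin n) ℝ) : frob X ^ 2 = ∑ i, ∑ j, X i j ^ 2 :=
  Real.sq_sqrt (Finset.sum_nonneg fun _ _ => Finset.sum_nonneg fun _ _ => sq_nonneg _)

section

attribute [local instance] Matrix.frobeniusNormedRing Matrix.frobeniusNormedSpace

theorem frob_eq_norm (X : Matrix (Fin n) (Fin n) ℝ) : frob X = ‖X‖ := by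
  rw [Matrix.frobenius_norm_def, frob, Real.sqrt_eq_rpow]
  simp

theorem frob_sub_le (X Y : Matrix (Fin n) (Fin n) ℝ) : frob (X - Y) ≤ frob X + frob Y := by
  simpa only [frob_eq_norm] using norm_sub_le X Y

theorem frob_mul_le (X Y : Matrix (Fin n) (Fin n) ℝ) : frob (X * Y) ≤ frob X * frob Y := by
  simpa only [frob_eq_norm] using norm_mul_le X Y

theorem frob_smul (c : ℝ) (X : Matrix (Fin n) (Fin n) ℝ) : frob (c • X) = |c| * frob X := by
  rw [frob_eq_norm, frob_eq_norm, norm_smul, Real.norm_eq_abs]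

end

theorem frob_one : frob (1 : Matrix (Fin n) (Fin n) ℝ) = √n := by
  rw [frob]
  congr 1
  simp [Matrix.one_apply]

theorem frob_transpose (X : Matrix (Fin n) (Fin n) ℝ) : frob Xᵀ = frob X := by
  rw [frob, frob, Finset.sum_comm]
  rfl

theorem abs_apply_le_frob (X : Matrix (Fin n) (Fin n) ℝ) (i j : Fin n) : |X i j| ≤ frob X := by
  refine abs_le_of_sq_le_sq ?_ (frob_nonneg X)
  rw [frob_sq]
  exact (Finset.single_le_sum (f := fun j => X i j ^ 2) (fun _ _ => sq_nonneg _)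
    (Finset.mem_univ j)).trans (Finset.single_le_sum (f := fun i => ∑ j, X i j ^ 2)
      (fun _ _ => Finset.sum_nonneg fun _ _ => sq_nonneg _) (Finset.mem_univ i))

theorem trace_mul_le_frob (X Y : Matrix (Fin n) (Fin n) ℝ) : (X * Y).trace ≤ frob X * frob Y := by
  rw [← frob_transpose Y, frob, frob, ← Fintype.sum_prod_type', ← Fintype.sum_prod_type']
  refine le_trans (le_of_eq ?_) (Real.sum_mul_le_sqrt_mul_sqrt Finset.univ
    (fun p : Fin n × Fin n => X p.1 p.2) fun p => Yᵀ p.1 p.2)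
  rw [Fintype.sum_prod_type]
  rfl

theorem frob_conj_le {ρ : ℝ} {A B : Matrix (Fin n) (Fin n) ℝ} (hAB : A * B = 1)
    (h : ∀ X : Matrix (Fin n) (Fin n) ℝ, X.trace = 0 → frob (A * X * B) ≤ ρ * frob X)
    {X : Matrix (Fin n) (Fin n) ℝ} (hX : X.trace = 0) : frob (B * X * A) ≤ ρ * frob X := by
  set Z := B * X * A with hZ
  have htZ : Zᵀ.trace = 0 := by
    rw [Matrix.trace_transpose, hZ, Matrix.trace_mul_cycle, hAB, one_mul, hX]
  have h1 : frob Z ^ 2 ≤ frob X * (ρ * frob Z) := by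
    have e1 : frob Z ^ 2 = (Z * Zᵀ).trace := by
      rw [frob_sq]
      simp only [Matrix.trace, Matrix.diag, Matrix.mul_apply, Matrix.transpose_apply, sq]
    have e2 : (Z * Zᵀ).trace = (X * (A * Zᵀ * B)).trace := by
      rw [hZ, Matrix.mul_assoc, Matrix.mul_assoc, Matrix.trace_mul_comm]
      simp only [Matrix.mul_assoc]
    rw [e1, e2]
    refine (trace_mul_le_frob _ _).trans ?_
    have := h _ htZ
    rw [frob_transpose] at this
    exact mul_le_mul_of_nonneg_left this (frob_nonneg X)
  rcases (frob_nonneg Z).eq_or_lt with h0 | h0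
  · rw [← h0]
    have := h X hX
    exact (frob_nonneg _).trans this
  · nlinarith

/-- The traceless matrix `X` such that `h` is a multiple of `1 + X`. -/
noncomputable def relPart (h : Matrix (Fin n) (Fin n) ℝ) : Matrix (Fin n) (Fin n) ℝ :=
  ((n : ℝ) / h.trace) • h - 1

/-- Multiples of matrices `1 + X`, where `X` is traceless, has norm at most `R` and real spectrum
bounded by `ε`. -/
def spectralCone (n : ℕ) (R ε : ℝ) : Set (Matrix (Fin n) (Fin n) ℝ) :=
  {h | 0 < h.trace ∧ frob (relPart h) ≤ R ∧ HasSmallRealSpectrum ε (relPart h)}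

theorem trace_relPart {h : Matrix (Fin n) (Fin n) ℝ} (hh : h.trace ≠ 0) :
    (relPart h).trace = 0 := by
  rw [relPart, Matrix.trace_sub, Matrix.trace_smul, Matrix.trace_one, smul_eq_mul,
    div_mul_cancel₀ _ hh, Fintype.card_fin, sub_self]

theorem smul_one_add_relPart [NeZero n] {h : Matrix (Fin n) (Fin n) ℝ} (hh : h.trace ≠ 0) :
    (h.trace / n) • (1 + relPart h) = h := by
  have hn : (n : ℝ) ≠ 0 := NeZero.ne _
  rw [relPart, add_sub_cancel, smul_smul, div_mul_div_cancel₀ hn, div_self hh, one_smul]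

theorem trace_smul_one_add (s : ℝ) {X : Matrix (Fin n) (Fin n) ℝ} (hX : X.trace = 0) :
    (s • (1 + X)).trace = s * n := by
  simp [hX]

theorem relPart_smul_one_add [NeZero n] {s : ℝ} (hs : s ≠ 0) {X : Matrix (Fin n) (Fin n) ℝ}
    (hX : X.trace = 0) : relPart (s • (1 + X)) = X := by
  have hn : (n : ℝ) ≠ 0 := NeZero.ne _
  rw [relPart, trace_smul_one_add s hX, smul_smul]
  have : (n : ℝ) / (s * n) * s = 1 := by field_simp
  rw [this, one_smul, add_sub_cancel_left]

theorem smul_one_add_mem_spectralCone [NeZero n] {R ε s : ℝ} (hs : 0 < s)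
    {X : Matrix (Fin n) (Fin n) ℝ}
    (hX : X.trace = 0) (hR : frob X ≤ R) (hε : HasSmallRealSpectrum ε X) :
    s • (1 + X) ∈ spectralCone n R ε := by
  have hn : (0 : ℝ) < n := Nat.cast_pos.2 (NeZero.pos n)
  refine ⟨?_, ?_, ?_⟩
  · rw [trace_smul_one_add s hX]; positivity
  · rwa [relPart_smul_one_add hs.ne' hX]
  · rwa [relPart_smul_one_add hs.ne' hX]

theorem exists_of_mem_spectralCone [NeZero n] {R ε : ℝ} {h : Matrix (Fin n) (Fin n) ℝ}
    (hh : h ∈ spectralCone n R ε) : ∃ s : ℝ, ∃ X : Matrix (Fin n) (Fin n) ℝ, 0 < s ∧ X.trace = 0 ∧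
      frob X ≤ R ∧ HasSmallRealSpectrum ε X ∧ h.trace = s * n ∧ h = s • (1 + X) := by
  have hn : (0 : ℝ) < n := Nat.cast_pos.2 (NeZero.pos n)
  exact ⟨h.trace / n, relPart h, div_pos hh.1 hn, trace_relPart hh.1.ne', hh.2.1, hh.2.2,
    (div_mul_cancel₀ _ hn.ne').symm, (smul_one_add_relPart hh.1.ne').symm⟩

theorem smul_mem_spectralCone [NeZero n] {R ε t : ℝ} (ht : 0 < t) {h : Matrix (Fin n) (Fin n) ℝ}
    (hh : h ∈ spectralCone n R ε) : t • h ∈ spectralCone n R ε := by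
  obtain ⟨s, X, hs, hX, hR, hε, -, rfl⟩ := exists_of_mem_spectralCone hh
  rw [smul_smul]
  exact smul_one_add_mem_spectralCone (mul_pos ht hs) hX hR hε

theorem conj_mem_spectralCone [NeZero n] {R ε ρ : ℝ} (hρ : 0 < ρ) {A B h : Matrix (Fin n) (Fin n) ℝ}
    (hAB : A * B = 1)
    (hA : ∀ X : Matrix (Fin n) (Fin n) ℝ, X.trace = 0 → frob (A * X * B) ≤ ρ * frob X)
    (hh : h ∈ spectralCone n (R / ρ) ε) : B * h * A ∈ spectralCone n R ε := by
  obtain ⟨s, X, hs, hX, hR, ⟨x, hx, hxX⟩, -, rfl⟩ := exists_of_mem_spectralCone hh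
  have hBA : B * A = 1 := mul_eq_one_comm.1 hAB
  have : B * (s • (1 + X)) * A = s • (1 + B * X * A) := by
    rw [mul_smul_comm, smul_mul_assoc, mul_add, add_mul, mul_one, hBA]
  rw [this]
  refine smul_one_add_mem_spectralCone hs ?_ ?_ ⟨x, hx, hxX.conj hBA⟩
  · rw [Matrix.trace_mul_cycle, hAB, one_mul, hX]
  · refine (frob_conj_le hAB hA hX).trans ?_
    rwa [mul_comm, ← le_div_iff₀ hρ]

theorem det_bounds_of_hasSmallRealSpectrum {ε s : ℝ} (hs : 0 < s) (hε : ε < 1)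
    {X : Matrix (Fin n) (Fin n) ℝ} (hX : HasSmallRealSpectrum ε X) :
    (s * (1 - ε)) ^ n ≤ (s • (1 + X)).det ∧ (s • (1 + X)).det ≤ (s * (1 + ε)) ^ n := by
  obtain ⟨x, hx, h⟩ := hX
  have hdet := h.det_affine s s
  rw [← smul_add] at hdet
  rw [hdet]
  have e : ∀ i, s + s * x i = s * (1 + x i) := fun i => by ring
  have hc : ∀ c : ℝ, c ^ n = ∏ _i : Fin n, c := fun c => by simp
  rw [hc, hc]
  constructor
  · refine Finset.prod_le_prod (fun i _ => mul_nonneg hs.le (by linarith)) fun i _ => ?_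
    rw [e]
    exact mul_le_mul_of_nonneg_left (by linarith [(abs_le.1 (hx i)).1]) hs.le
  · refine Finset.prod_le_prod (fun i _ => ?_) fun i _ => ?_
    · rw [e]
      exact mul_nonneg hs.le (by linarith [(abs_le.1 (hx i)).1])
    · rw [e]
      exact mul_le_mul_of_nonneg_left (by linarith [(abs_le.1 (hx i)).2]) hs.le

theorem inv_mean_bounds [NeZero n] {e : ℝ} (he : e < 1) {x : Fin n → ℝ} (hx : ∀ i, |x i| ≤ e)
    (hsum : ∑ i, x i = 0) :
    1 ≤ (∑ i, (1 + x i)⁻¹) / n ∧ (∑ i, (1 + x i)⁻¹) / n ≤ 1 + e ^ 2 / (1 - e) := by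
  have hn : (0 : ℝ) < n := Nat.cast_pos.2 (NeZero.pos n)
  have hpos : ∀ i, 1 - e ≤ 1 + x i := fun i => by linarith [(abs_le.1 (hx i)).1]
  have h1e : 0 < 1 - e := by linarith
  have hid : ∀ i, (1 + x i)⁻¹ = 1 - x i + x i ^ 2 / (1 + x i) := fun i => by
    have : 1 + x i ≠ 0 := (h1e.trans_le (hpos i)).ne'
    field_simp
    ring
  have hS : ∑ i, (1 + x i)⁻¹ = n + ∑ i, x i ^ 2 / (1 + x i) := by
    simp only [hid, Finset.sum_add_distrib, Finset.sum_sub_distrib, hsum]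
    simp
  have hlo : 0 ≤ ∑ i, x i ^ 2 / (1 + x i) :=
    Finset.sum_nonneg fun i _ => div_nonneg (sq_nonneg _) (h1e.le.trans (hpos i))
  have hhi : ∑ i, x i ^ 2 / (1 + x i) ≤ n * (e ^ 2 / (1 - e)) := by
    refine (Finset.sum_le_sum (g := fun _ => e ^ 2 / (1 - e)) fun i _ => ?_).trans_eq (by simp)
    have : x i ^ 2 ≤ e ^ 2 := sq_le_sq' (abs_le.1 (hx i)).1 (abs_le.1 (hx i)).2
    exact div_le_div₀ (sq_nonneg _) this h1e (hpos i)
  rw [hS]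
  constructor
  · rw [le_div_iff₀ hn]; linarith
  · rw [div_le_iff₀ hn]; linarith

theorem inv_mem_spectralCone [NeZero n] {r e : ℝ} (hr : r < 1) (he0 : 0 ≤ e) (he : e < 1)
    {h : Matrix (Fin n) (Fin n) ℝ} (hh : h ∈ spectralCone n r e) :
    h⁻¹ ∈ spectralCone n (r / (1 - r) + √n * (e ^ 2 / (1 - e))) (e / (1 - e) ^ 2) := by
  obtain ⟨s, X, hs, hX, hR, ⟨x, hx, hxX⟩, -, rfl⟩ := exists_of_mem_spectralCone hh
  have hn : (0 : ℝ) < n := Nat.cast_pos.2 (NeZero.pos n)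
  have h1e : 0 < 1 - e := by linarith
  have hpos : ∀ i, 1 - e ≤ 1 + x i := fun i => by linarith [(abs_le.1 (hx i)).1]
  have hlist : HasEigenvalueList (1 + X) fun i => 1 + x i := by
    have := hxX.affine 1 1
    simpa using this
  have hdet : IsUnit (1 + X).det := by
    have h1 : (1 + X).det = ∏ i, (1 + x i) := by simpa using hxX.det_affine 1 1
    rw [h1]
    exact (Finset.prod_ne_zero_iff.2 fun i _ => (h1e.trans_le (hpos i)).ne').isUnit
  set Y := (1 + X)⁻¹ with hY
  have hYlist : HasEigenvalueList Y fun i => (1 + x i)⁻¹ :=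
    hlist.inv fun i => (h1e.trans_le (hpos i)).ne'
  set m := (∑ i, (1 + x i)⁻¹) / n with hm
  obtain ⟨hm1, hm2⟩ := inv_mean_bounds he hx (by rw [← hxX.trace_eq, hX])
  rw [← hm] at hm1 hm2
  have hm0 : 0 < m := by linarith
  have htr : Y.trace = m * n := by rw [hYlist.trace_eq, hm, div_mul_cancel₀ _ hn.ne']
  have hinv : (s • (1 + X))⁻¹ = s⁻¹ • Y := by
    refine Matrix.inv_eq_right_inv ?_
    rw [smul_mul_smul_comm, mul_inv_cancel₀ hs.ne', one_smul, hY, Matrix.mul_nonsing_inv _ hdet]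
  have hYm : s⁻¹ • Y = (s⁻¹ * m) • (1 + (m⁻¹ • Y - 1)) := by
    rw [add_sub_cancel, smul_smul, mul_assoc, mul_inv_cancel₀ hm0.ne', mul_one]
  rw [hinv, hYm]
  refine smul_one_add_mem_spectralCone (by positivity) ?_ ?_ ?_
  · rw [Matrix.trace_sub, Matrix.trace_smul, htr, Matrix.trace_one, smul_eq_mul, Fintype.card_fin,
      inv_mul_cancel_left₀ hm0.ne', sub_self]
  · have hXY : Y - 1 = -X - X * (Y - 1) := by
      have h1 : (1 + X) * Y = 1 := Matrix.mul_nonsing_inv _ hdet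
      rw [add_mul, one_mul] at h1
      have h2 : X * Y = 1 - Y := by rw [← h1]; abel
      rw [mul_sub, h2, mul_one]
      abel
    have hF : frob (Y - 1) ≤ r / (1 - r) := by
      rw [le_div_iff₀ (by linarith)]
      have h1 : frob (Y - 1) ≤ frob X + frob X * frob (Y - 1) := by
        conv_lhs => rw [hXY]
        refine (frob_sub_le _ _).trans (add_le_add ?_ (frob_mul_le _ _))
        have := frob_smul (-1) X
        simpa using this.le
      nlinarith [frob_nonneg (Y - 1)]
    have e1 : m⁻¹ • Y - 1 = m⁻¹ • ((Y - 1) - (m - 1) • 1) := by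
      rw [smul_sub, smul_sub, smul_smul, mul_sub, inv_mul_cancel₀ hm0.ne', mul_one, sub_smul,
        one_smul]
      abel
    have hmi : |m⁻¹| ≤ 1 := by
      rw [abs_of_pos (inv_pos.2 hm0)]
      exact inv_le_one_of_one_le₀ hm1
    have h2 : frob (Y - 1 - (m - 1) • 1) ≤ r / (1 - r) + √n * (e ^ 2 / (1 - e)) := by
      refine (frob_sub_le _ _).trans (add_le_add hF ?_)
      rw [frob_smul, frob_one, mul_comm, abs_of_nonneg (by linarith)]
      exact mul_le_mul_of_nonneg_left (by linarith) (Real.sqrt_nonneg _)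
    rw [e1, frob_smul]
    exact (mul_le_of_le_one_left (frob_nonneg _) hmi).trans h2
  · refine ⟨fun i => -1 + m⁻¹ * (1 + x i)⁻¹, fun i => ?_, ?_⟩
    · have hp := h1e.trans_le (hpos i)
      have e1 : -1 + m⁻¹ * (1 + x i)⁻¹ = (1 - m - x i * m) / (m * (1 + x i)) := by
        field_simp
        ring
      simp only [e1]
      rw [abs_div, abs_of_pos (mul_pos hm0 hp)]
      have h1 : |1 - m - x i * m| ≤ m * (e ^ 2 / (1 - e)) + e * m := by
        refine (abs_sub _ _).trans (add_le_add ?_ ?_)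
        · rw [abs_of_nonpos (by linarith)]
          have h0 : 0 ≤ e ^ 2 / (1 - e) := by positivity
          nlinarith
        · rw [abs_mul, abs_of_pos hm0]
          exact mul_le_mul_of_nonneg_right (hx i) hm0.le
      rw [div_le_iff₀ (mul_pos hm0 hp)]
      refine h1.trans ?_
      have h2 : m * (e ^ 2 / (1 - e)) + e * m = e / (1 - e) ^ 2 * (m * (1 - e)) := by
        field_simp
        ring
      rw [h2]
      exact mul_le_mul_of_nonneg_left (mul_le_mul_of_nonneg_left (hpos i) hm0.le) (by positivity)
    · have := hYlist.affine (-1) m⁻¹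
      rwa [neg_smul, one_smul, neg_add_eq_sub] at this

theorem spectralCone_mono {R R' ε ε' : ℝ} (hR : R ≤ R') (hε : ε ≤ ε') :
    spectralCone n R ε ⊆ spectralCone n R' ε' := by
  rintro h ⟨h0, h1, x, hx, h2⟩
  exact ⟨h0, h1.trans hR, x, fun i => (hx i).trans hε, h2⟩

/-- Inversion enlarges the cones of small spectrum by an arbitrarily small factor. -/
theorem exists_inv_mem_spectralCone (n : ℕ) [NeZero n] {θ R : ℝ} (hθ0 : 0 < θ) (hθ1 : θ < 1)
    (hR0 : 0 < R) (hR : R ≤ 1 - θ) :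
    ∃ η₀ > 0, ∀ η, 0 < η → η ≤ η₀ → ∀ h ∈ spectralCone n (θ * R) (θ * η),
      h⁻¹ ∈ spectralCone n R η := by
  have h1 : θ * R / (1 - θ * R) < R := by
    rw [div_lt_iff₀ (by nlinarith)]
    nlinarith [mul_pos hR0 hθ0, mul_pos (sub_pos.2 hθ1) (sub_pos.2 hθ1)]
  have hlim : Tendsto (fun η : ℝ => θ * R / (1 - θ * R) + √n * ((θ * η) ^ 2 / (1 - θ * η))) (𝓝 0)
      (𝓝 (θ * R / (1 - θ * R) + √n * ((θ * 0) ^ 2 / (1 - θ * 0)))) := by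
    refine ContinuousAt.tendsto ?_
    refine continuousAt_const.add (continuousAt_const.mul (ContinuousAt.div (by fun_prop)
      (by fun_prop) (by simp)))
  have hev1 := hlim.eventually_lt_const (by simpa using h1)
  have hlim2 : Tendsto (fun η : ℝ => θ / (1 - θ * η) ^ 2) (𝓝 0) (𝓝 (θ / (1 - θ * 0) ^ 2)) :=
    (ContinuousAt.div (by fun_prop) (by fun_prop) (by simp)).tendsto
  have hev2 := hlim2.eventually_lt_const (u := 1) (by simpa using hθ1)
  obtain ⟨δ, hδ, hball⟩ := Metric.eventually_nhds_iff.1 (hev1.and hev2)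
  refine ⟨min (δ / 2) 1, by positivity, fun η hη0 hη h hh => ?_⟩
  have hηδ : η < δ := by linarith [min_le_left (δ / 2) 1]
  have hη1 : η ≤ 1 := hη.trans (min_le_right _ _)
  obtain ⟨k1, k2⟩ := hball (y := η) (by simpa [abs_of_pos hη0] using hηδ)
  refine spectralCone_mono k1.le ?_ (inv_mem_spectralCone (by nlinarith) (by positivity)
    (by nlinarith) hh)
  rw [mul_div_right_comm]
  exact mul_le_of_le_one_left hη0.le k2.le

end SpectralCone

section ConeVolume

variable {n : ℕ}

/-- The linear map `s • (1 + X) ↦ s • (c + X)` for traceless `X`. -/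
noncomputable def traceScaling (n : ℕ) (c : ℝ) :
    (Fin n → Fin n → ℝ) →ₗ[ℝ] (Fin n → Fin n → ℝ) :=
  LinearMap.transvection (Matrix.traceLinearMap (Fin n) ℝ ℝ)
    (((c - 1) / n) • (1 : Matrix (Fin n) (Fin n) ℝ))

theorem det_traceScaling [NeZero n] (c : ℝ) : LinearMap.det (traceScaling n c) = c := by
  have hn : (n : ℝ) ≠ 0 := NeZero.ne _
  refine (LinearMap.transvection.det _ _).trans ?_
  change 1 + (((c - 1) / n) • (1 : Matrix (Fin n) (Fin n) ℝ)).trace = c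
  rw [Matrix.trace_smul, Matrix.trace_one, Fintype.card_fin, smul_eq_mul, div_mul_cancel₀ _ hn]
  ring

theorem traceScaling_smul_one_add [NeZero n] (c s : ℝ) {X : Matrix (Fin n) (Fin n) ℝ}
    (hX : X.trace = 0) : traceScaling n c (s • (1 + X) : Matrix (Fin n) (Fin n) ℝ) =
      (s • (c • (1 : Matrix (Fin n) (Fin n) ℝ) + X) : Matrix (Fin n) (Fin n) ℝ) := by
  have hn : (n : ℝ) ≠ 0 := NeZero.ne _
  refine (LinearMap.transvection.apply (Matrix.traceLinearMap (Fin n) ℝ ℝ) _ _).trans ?_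
  rw [Matrix.traceLinearMap_apply, trace_smul_one_add s hX, smul_smul]
  have : s * n * ((c - 1) / n) = s * (c - 1) := by field_simp
  rw [this]
  module

/-- The part of `spectralCone` of trace at most `n`. -/
def truncCone (n : ℕ) (R ε : ℝ) : Set (Fin n → Fin n → ℝ) :=
  {h | Matrix.of h ∈ spectralCone n R ε ∧ (Matrix.of h).trace ≤ n}

theorem measurableSet_spectralCone (n : ℕ) (R ε : ℝ) :
    MeasurableSet {h : Fin n → Fin n → ℝ | Matrix.of h ∈ spectralCone n R ε} := by
  have hof : Continuous fun h : Fin n → Fin n → ℝ => Matrix.of h := continuous_id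
  have htr : Continuous fun h : Fin n → Fin n → ℝ => (Matrix.of h).trace := hof.matrix_trace
  have hrel : Measurable fun h : Fin n → Fin n → ℝ =>
      (fun i j => relPart (Matrix.of h) i j : Fin n → Fin n → ℝ) := by
    refine measurable_pi_iff.2 fun i => measurable_pi_iff.2 fun j => ?_
    simp only [relPart, Matrix.sub_apply, Matrix.smul_apply, smul_eq_mul, Matrix.of_apply]
    have := htr.measurable
    fun_prop
  have hfrob : Continuous fun X : Fin n → Fin n → ℝ => frob (Matrix.of X) := by
    simp only [frob, Matrix.of_apply]
    fun_prop
  refine (measurableSet_lt measurable_const htr.measurable).inter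
    ((hrel (isClosed_le hfrob continuous_const).measurableSet).inter
      (hrel ((isClosed_hasSmallRealSpectrum ε).preimage hof).measurableSet))

theorem exists_of_mem_truncCone [NeZero n] {R ε : ℝ} {h : Fin n → Fin n → ℝ}
    (hh : h ∈ truncCone n R ε) : ∃ s : ℝ, ∃ X : Matrix (Fin n) (Fin n) ℝ, 0 < s ∧ s ≤ 1 ∧
      X.trace = 0 ∧ frob X ≤ R ∧ HasSmallRealSpectrum ε X ∧
      h = (s • (1 + X) : Matrix (Fin n) (Fin n) ℝ) := by
  have hn : (0 : ℝ) < n := Nat.cast_pos.2 (NeZero.pos n)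
  obtain ⟨s, X, hs, hX, hR, hε, htr, hh'⟩ := exists_of_mem_spectralCone hh.1
  refine ⟨s, X, hs, ?_, hX, hR, hε, hh'⟩
  have := hh.2
  rw [htr] at this
  exact le_of_mul_le_mul_right (by simpa using this) hn

theorem smul_one_add_mem_truncCone [NeZero n] {R ε s : ℝ} (hs : 0 < s) (hs1 : s ≤ 1)
    {X : Matrix (Fin n) (Fin n) ℝ} (hX : X.trace = 0) (hR : frob X ≤ R)
    (hε : HasSmallRealSpectrum ε X) :
    (s • (1 + X) : Matrix (Fin n) (Fin n) ℝ) ∈ truncCone n R ε := by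
  refine ⟨smul_one_add_mem_spectralCone hs hX hR hε, ?_⟩
  have h1 : (s • (1 + X)).trace = s * n := trace_smul_one_add s hX
  exact h1.trans_le (mul_le_of_le_one_left (Nat.cast_nonneg _) hs1)

theorem HasSmallRealSpectrum.affine {ε : ℝ} {X : Matrix (Fin n) (Fin n) ℝ}
    (h : HasSmallRealSpectrum ε X) (a b : ℝ) :
    HasSmallRealSpectrum (|a| + |b| * ε) (a • (1 : Matrix (Fin n) (Fin n) ℝ) + b • X) := by
  obtain ⟨x, hx, h⟩ := h
  refine ⟨_, fun i => ?_, h.affine a b⟩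
  refine (abs_add_le _ _).trans (add_le_add le_rfl ?_)
  rw [abs_mul]
  exact mul_le_mul_of_nonneg_left (hx i) (abs_nonneg _)

theorem HasSmallRealSpectrum.mono {ε ε' : ℝ} {X : Matrix (Fin n) (Fin n) ℝ}
    (h : HasSmallRealSpectrum ε X) (hε : ε ≤ ε') : HasSmallRealSpectrum ε' X :=
  let ⟨x, hx, h⟩ := h
  ⟨x, fun i => (hx i).trans hε, h⟩

theorem volume_smul_pi_pi (n : ℕ) {c : ℝ} (hc : 0 ≤ c) (S : Set (Fin n → Fin n → ℝ)) :
    volume (c • S) = ENNReal.ofReal (c ^ (n * n)) * volume S := by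
  have : Module.finrank ℝ (Fin n → Fin n → ℝ) = n * n := by
    rw [Module.finrank_pi_fintype]; simp
  rw [Measure.addHaar_smul, this, abs_of_nonneg (pow_nonneg hc _)]

theorem volume_truncCone_le_scaled [NeZero n] {R ε κ : ℝ} (hκ : 0 < κ) :
    ENNReal.ofReal κ * volume (truncCone n R ε) ≤
      ENNReal.ofReal (κ ^ (n * n)) * volume (truncCone n (R / κ) (ε / κ)) := by
  have h := Measure.addHaar_image_linearMap volume (traceScaling n κ) (truncCone n R ε)
  rw [det_traceScaling, abs_of_pos hκ] at h
  rw [← h, ← volume_smul_pi_pi n hκ.le]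
  refine measure_mono ?_
  rintro _ ⟨h, hh, rfl⟩
  obtain ⟨s, X, hs, hs1, hX, hR, hε, rfl⟩ := exists_of_mem_truncCone hh
  refine Set.mem_smul_set.2
      ⟨(s • (1 + κ⁻¹ • X) : Matrix (Fin n) (Fin n) ℝ), ?_, ?_⟩
  · refine smul_one_add_mem_truncCone hs hs1 ?_ ?_ ?_
    · rw [Matrix.trace_smul, hX, smul_zero]
    · rw [frob_smul, abs_of_pos (inv_pos.2 hκ), div_eq_inv_mul]
      exact mul_le_mul_of_nonneg_left hR (inv_pos.2 hκ).le
    · have := hε.affine 0 κ⁻¹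
      rw [zero_smul, zero_add, abs_zero, zero_add, abs_of_pos (inv_pos.2 hκ)] at this
      exact this.mono (le_of_eq (by rw [div_eq_inv_mul]))
  · refine Eq.trans ?_ (traceScaling_smul_one_add κ s hX).symm
    change κ • s • (1 + κ⁻¹ • X : Matrix (Fin n) (Fin n) ℝ) = _
    rw [smul_comm, smul_add, smul_smul, mul_inv_cancel₀ hκ.ne', one_smul]

theorem exists_volume_truncCone_le (n : ℕ) [NeZero n] (R : ℝ) :
    ∃ C : ℝ≥0∞, C ≠ ∞ ∧ ∀ ε : ℝ, 0 < ε → ε ≤ 1 →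
      volume (truncCone n R ε) ≤ C * ENNReal.ofReal (ε ^ ((n + 1).choose 2 - 1)) := by
  obtain ⟨C, hC, h⟩ := exists_volume_smallSpectrumBox_le n (1 + R)
  refine ⟨C * ENNReal.ofReal (2 ^ (n + 1).choose 2), ENNReal.mul_ne_top hC ENNReal.ofReal_ne_top,
    fun ε hε hε1 => ?_⟩
  have hsub : traceScaling n ε '' truncCone n R ε ⊆ smallSpectrumBox n (1 + R) (2 * ε) := by
    rintro _ ⟨h, hh, rfl⟩
    obtain ⟨s, X, hs, hs1, hX, hR, hS, rfl⟩ := exists_of_mem_truncCone hh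
    have key := traceScaling_smul_one_add ε s hX
    have hR0 : 0 ≤ R := (frob_nonneg X).trans hR
    refine Set.mem_of_eq_of_mem key ⟨fun i j => ?_, ?_⟩
    · change |s * (ε * (1 : Matrix (Fin n) (Fin n) ℝ) i j + X i j)| ≤ 1 + R
      have e1 : |(1 : Matrix (Fin n) (Fin n) ℝ) i j| ≤ 1 := by
        rw [Matrix.one_apply]; split_ifs <;> simp
      have e2 : |ε * (1 : Matrix (Fin n) (Fin n) ℝ) i j| ≤ 1 := by
        rw [abs_mul, abs_of_pos hε]
        exact mul_le_one₀ hε1 (abs_nonneg _) e1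
      rw [abs_mul, abs_of_pos hs]
      exact (mul_le_of_le_one_left (abs_nonneg _) hs1).trans
        ((abs_add_le _ _).trans (add_le_add e2 ((abs_apply_le_frob X i j).trans hR)))
    · have h1 : |s * ε| + |s| * ε ≤ 2 * ε := by
        rw [abs_of_pos hs, abs_of_pos (mul_pos hs hε)]
        nlinarith
      have h2 : HasSmallRealSpectrum (2 * ε) (s • (ε • (1 : Matrix (Fin n) (Fin n) ℝ) + X)) := by
        rw [smul_add, smul_smul]
        exact (hS.affine (s * ε) s).mono h1
      exact h2
  have h1 := Measure.addHaar_image_linearMap volume (traceScaling n ε) (truncCone n R ε)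
  rw [det_traceScaling, abs_of_pos hε] at h1
  have h2 : ENNReal.ofReal ε * volume (truncCone n R ε) ≤
      ENNReal.ofReal ε * (C * ENNReal.ofReal (2 ^ (n + 1).choose 2) *
        ENNReal.ofReal (ε ^ ((n + 1).choose 2 - 1))) := by
    rw [← h1]
    refine (measure_mono hsub).trans ((h (2 * ε) (by positivity)).trans_eq ?_)
    have hch : (n + 1).choose 2 = (n + 1).choose 2 - 1 + 1 := by
      have : 0 < (n + 1).choose 2 := Nat.choose_pos (by have := NeZero.pos n; omega)
      omega
    rw [mul_pow, ENNReal.ofReal_mul (by positivity)]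
    conv_lhs => rw [hch, pow_succ, pow_succ ε, ENNReal.ofReal_mul (p := ε ^ _) (by positivity),
      ← pow_succ, ← hch]
    ring
  exact (ENNReal.mul_le_mul_iff_right (ENNReal.ofReal_pos.2 hε).ne' ENNReal.ofReal_ne_top).1 h2

section Positivity

theorem hasEigenvalueList_of_injective {n : ℕ} {X : Matrix (Fin n) (Fin n) ℝ} {x : Fin n → ℝ}
    (hx : Function.Injective x)
    (h : ∀ i, (x i • (1 : Matrix (Fin n) (Fin n) ℝ) - X).det = 0) : HasEigenvalueList X x := by
  refine Polynomial.eq_of_monic_of_dvd_of_natDegree_le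
    (Polynomial.monic_prod_X_sub_C x Finset.univ) (Matrix.charpoly_monic X) ?_ ?_
  · refine Finset.prod_dvd_of_coprime (fun i _ j _ hij =>
      Polynomial.pairwise_coprime_X_sub_C hx hij)
      fun i _ => Polynomial.dvd_iff_isRoot.2 ?_
    rw [Polynomial.IsRoot, Matrix.eval_charpoly, Matrix.scalar_apply, ← Matrix.smul_one_eq_diagonal,
      h]
  · rw [Matrix.charpoly_natDegree_eq_dim, Polynomial.natDegree_finsetProd_X_sub_C_eq_card]
    simp

/-- Sign changes of the characteristic polynomial at the points `δ * (2 * k - n)` produce `n` real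
eigenvalues. -/
theorem hasSmallRealSpectrum_of_sign_changes {n : ℕ} {δ : ℝ} (hδ : 0 < δ)
    {X : Matrix (Fin n) (Fin n) ℝ}
    (h : ∀ k : Fin n, ((δ * (2 * (k : ℝ) - n)) • (1 : Matrix (Fin n) (Fin n) ℝ) - X).det *
      ((δ * (2 * (k : ℝ) + 2 - n)) • (1 : Matrix (Fin n) (Fin n) ℝ) - X).det < 0) :
    HasSmallRealSpectrum (δ * n) X := by
  have hcont : Continuous fun t : ℝ => (t • (1 : Matrix (Fin n) (Fin n) ℝ) - X).det := by
    refine Continuous.matrix_det ?_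
    fun_prop
  have hroot : ∀ k : Fin n, ∃ t, δ * (2 * (k : ℝ) - n) < t ∧ t < δ * (2 * (k : ℝ) + 2 - n) ∧
      (t • (1 : Matrix (Fin n) (Fin n) ℝ) - X).det = 0 := by
    intro k
    have hle : δ * (2 * (k : ℝ) - n) ≤ δ * (2 * (k : ℝ) + 2 - n) := by nlinarith
    rcases mul_neg_iff.1 (h k) with ⟨h1, h2⟩ | ⟨h1, h2⟩
    · obtain ⟨t, ht, h0⟩ := intermediate_value_Ioo' hle hcont.continuousOn ⟨h2, h1⟩
      exact ⟨t, ht.1, ht.2, h0⟩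
    · obtain ⟨t, ht, h0⟩ := intermediate_value_Ioo hle hcont.continuousOn ⟨h1, h2⟩
      exact ⟨t, ht.1, ht.2, h0⟩
  choose x h1 h2 h0 using hroot
  have hmono : StrictMono x := by
    intro i j hij
    have : (i : ℝ) + 1 ≤ j := by exact_mod_cast hij
    refine ((h2 i).trans_le ?_).trans (h1 j)
    exact mul_le_mul_of_nonneg_left (by linarith) hδ.le
  refine ⟨x, fun i => abs_le.2 ⟨?_, ?_⟩, hasEigenvalueList_of_injective hmono.injective h0⟩
  · refine le_trans ?_ (h1 i).le
    have : (0 : ℝ) ≤ (i : ℕ) := Nat.cast_nonneg _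
    nlinarith
  · refine (h2 i).le.trans ?_
    have : ((i : ℕ) : ℝ) + 1 ≤ n := by exact_mod_cast i.2
    nlinarith

theorem sign_changes_diagonal {n : ℕ} {δ : ℝ} (hδ : 0 < δ) (k : Fin n) :
    ((δ * (2 * (k : ℝ) - n)) • (1 : Matrix (Fin n) (Fin n) ℝ) -
      δ • Matrix.diagonal fun i : Fin n => 2 * (i : ℝ) + 1 - n).det *
      ((δ * (2 * (k : ℝ) + 2 - n)) • (1 : Matrix (Fin n) (Fin n) ℝ) -
      δ • Matrix.diagonal fun i : Fin n => 2 * (i : ℝ) + 1 - n).det < 0 := by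
  have hdet : ∀ t : ℝ, ((δ * t) • (1 : Matrix (Fin n) (Fin n) ℝ) -
      δ • Matrix.diagonal fun i : Fin n => 2 * (i : ℝ) + 1 - n).det =
      ∏ i : Fin n, δ * (t - (2 * (i : ℝ) + 1 - n)) := by
    intro t
    rw [Matrix.smul_one_eq_diagonal, ← Matrix.diagonal_smul, Matrix.diagonal_sub,
      Matrix.det_diagonal]
    exact Finset.prod_congr rfl fun i _ => by simp [mul_sub]
  rw [hdet, hdet, ← Finset.prod_mul_distrib, ← Finset.mul_prod_erase _ _ (Finset.mem_univ k)]
  refine mul_neg_of_neg_of_pos ?_ (Finset.prod_pos fun i hi => ?_)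
  · have := mul_pos hδ hδ
    nlinarith
  · have h2 := mul_pos hδ hδ
    rcases lt_or_gt_of_ne (Finset.ne_of_mem_erase hi) with hik | hik
    · have : (i : ℝ) + 1 ≤ k := by exact_mod_cast hik
      exact mul_pos (mul_pos hδ (by linarith)) (mul_pos hδ (by linarith))
    · have : (k : ℝ) + 1 ≤ i := by exact_mod_cast hik
      exact mul_pos_of_neg_of_neg (mul_neg_of_pos_of_neg hδ (by linarith))
        (mul_neg_of_pos_of_neg hδ (by linarith))

theorem exists_eventually_hasSmallRealSpectrum (n : ℕ) [NeZero n] {R ε : ℝ} (hR : 0 < R)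
    (hε : 0 < ε) : ∃ X : Matrix (Fin n) (Fin n) ℝ, X.trace = 0 ∧
      ∀ᶠ Y in 𝓝 X, frob Y ≤ R ∧ HasSmallRealSpectrum ε Y := by
  have hn : (0 : ℝ) < n := Nat.cast_pos.2 (NeZero.pos n)
  set D : Matrix (Fin n) (Fin n) ℝ := Matrix.diagonal fun i : Fin n => 2 * (i : ℝ) + 1 - n with hD
  have hf := frob_nonneg D
  set δ := min (ε / n) (R / (frob D + 1)) with hδd
  have hδ : 0 < δ := by positivity
  have hfrob : Continuous fun X : Matrix (Fin n) (Fin n) ℝ => frob X := by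
    unfold frob
    fun_prop
  have hsum : ∑ i : Fin n, (2 * (i : ℝ) + 1 - n) = 0 := by
    rw [Fin.sum_univ_eq_sum_range (fun i : ℕ => 2 * (i : ℝ) + 1 - n) n]
    have : ∀ m : ℕ, ∑ i ∈ Finset.range m, (2 * (i : ℝ) + 1 - n) = m * m - m * n := by
      intro m
      induction m with
      | zero => simp
      | succ m ih => rw [Finset.sum_range_succ, ih]; push_cast; ring
    rw [this, sub_self]
  refine ⟨δ • D, by rw [Matrix.trace_smul, hD, Matrix.trace_diagonal, hsum, smul_zero], ?_⟩
  have h1 : ∀ᶠ Y in 𝓝 (δ • D), frob Y < R := by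
    refine hfrob.continuousAt.tendsto.eventually_lt_const ?_
    rw [frob_smul, abs_of_pos hδ]
    calc δ * frob D ≤ R / (frob D + 1) * frob D :=
          mul_le_mul_of_nonneg_right (min_le_right _ _) hf
      _ < R := by rw [div_mul_eq_mul_div, div_lt_iff₀ (by positivity)]; nlinarith
  have h2 : ∀ᶠ Y in 𝓝 (δ • D), ∀ k : Fin n,
      ((δ * (2 * (k : ℝ) - n)) • (1 : Matrix (Fin n) (Fin n) ℝ) - Y).det *
      ((δ * (2 * (k : ℝ) + 2 - n)) • (1 : Matrix (Fin n) (Fin n) ℝ) - Y).det < 0 := by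
    refine eventually_all.2 fun k => Tendsto.eventually_lt_const (sign_changes_diagonal hδ k)
      (Continuous.tendsto ?_ _)
    refine Continuous.mul (Continuous.matrix_det ?_) (Continuous.matrix_det ?_) <;> fun_prop
  filter_upwards [h1, h2] with Y hY1 hY2
  refine ⟨hY1.le, (hasSmallRealSpectrum_of_sign_changes hδ hY2).mono ?_⟩
  rw [← le_div_iff₀ hn]
  exact min_le_left _ _

theorem volume_truncCone_pos (n : ℕ) [NeZero n] {R ε : ℝ} (hR : 0 < R) (hε : 0 < ε) :
    0 < volume (truncCone n R ε) := by
  have hn : (0 : ℝ) < n := Nat.cast_pos.2 (NeZero.pos n)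
  obtain ⟨X, hX, hev⟩ := exists_eventually_hasSmallRealSpectrum n hR hε
  set h₀ : Matrix (Fin n) (Fin n) ℝ := (2⁻¹ : ℝ) • (1 + X) with hh₀
  have htr : h₀.trace = 2⁻¹ * n := trace_smul_one_add _ hX
  have hcont : Continuous fun h : Matrix (Fin n) (Fin n) ℝ => h.trace :=
    continuous_id.matrix_trace
  have h1 : ∀ᶠ h in 𝓝 h₀, 0 < h.trace :=
    (hcont.tendsto h₀).eventually_const_lt (by rw [htr]; positivity)
  have h2 : ∀ᶠ h in 𝓝 h₀, h.trace < (n : ℝ) :=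
    (hcont.tendsto h₀).eventually_lt_const (by rw [htr]; linarith)
  have h3 : ContinuousAt (relPart (n := n)) h₀ := by
    unfold relPart
    refine ContinuousAt.sub (ContinuousAt.smul (ContinuousAt.div continuousAt_const
      hcont.continuousAt ?_) continuousAt_id) continuousAt_const
    rw [htr]; positivity
  have h4 : Tendsto (relPart (n := n)) (𝓝 h₀) (𝓝 X) := by
    have := h3.tendsto
    rwa [hh₀, relPart_smul_one_add (by norm_num) hX] at this
  have hmem : truncCone n R ε ∈ @nhds (Fin n → Fin n → ℝ) _ h₀ := by
    have : ∀ᶠ h in 𝓝 h₀, (h ∈ spectralCone n R ε ∧ h.trace ≤ (n : ℝ)) := by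
      filter_upwards [h1, h2, h4.eventually hev] with h k1 k2 k3
      exact ⟨⟨k1, k3⟩, k2.le⟩
    exact this
  exact Measure.measure_pos_of_mem_nhds (volume : Measure (Fin n → Fin n → ℝ)) hmem

end Positivity

end ConeVolume

/-- A positive function bounded by a multiple of `ε ^ a` grows by a factor of at least `c < ρ ^ a`
between some arbitrarily small `η` and `ρ * η`. -/
theorem exists_mul_le_of_le_pow {F : ℝ → ℝ≥0∞} {a : ℕ} {C : ℝ≥0∞} (hC : C ≠ ∞)
    (hF0 : ∀ ε, 0 < ε → F ε ≠ 0) (hF : ∀ ε, 0 < ε → ε ≤ 1 → F ε ≤ C * ENNReal.ofReal (ε ^ a))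
    {ρ c : ℝ} (hρ : 1 < ρ) (hc0 : 0 ≤ c) (hc : c < ρ ^ a) {η₀ : ℝ} (hη₀ : 0 < η₀) :
    ∃ η, 0 < η ∧ η ≤ η₀ ∧ ENNReal.ofReal c * F η ≤ F (ρ * η) := by
  by_contra! hcon
  have hρ0 : 0 < ρ := by linarith
  set η₁ := min η₀ 1 with hη₁
  have h1 : 0 < η₁ := by positivity
  have hk : ∀ k : ℕ, F η₁ ≤ ENNReal.ofReal (c ^ k) * F (η₁ / ρ ^ k) := by
    intro k
    induction k with
    | zero => simp
    | succ k ih =>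
      have hlt := hcon (η₁ / ρ ^ (k + 1)) (by positivity)
        ((div_le_self h1.le (one_le_pow₀ hρ.le)).trans (min_le_left _ _))
      have e1 : ρ * (η₁ / ρ ^ (k + 1)) = η₁ / ρ ^ k := by
        field_simp
        ring
      rw [e1] at hlt
      rw [pow_succ, ENNReal.ofReal_mul (by positivity), mul_assoc]
      exact ih.trans (by gcongr)
  have hbound : ∀ k : ℕ, F η₁ ≤ C * ENNReal.ofReal (η₁ ^ a * (c / ρ ^ a) ^ k) := by
    intro k
    refine (hk k).trans ?_
    have hle : η₁ / ρ ^ k ≤ 1 := (div_le_self h1.le (one_le_pow₀ hρ.le)).trans (min_le_right _ _)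
    calc _ ≤ ENNReal.ofReal (c ^ k) * (C * ENNReal.ofReal ((η₁ / ρ ^ k) ^ a)) := by
          gcongr
          exact hF _ (by positivity) hle
      _ = C * ENNReal.ofReal (c ^ k * (η₁ / ρ ^ k) ^ a) := by
          rw [ENNReal.ofReal_mul (by positivity)]
          ring
      _ = _ := by
          congr 2
          rw [div_pow, div_pow, ← pow_mul, ← pow_mul, mul_comm k a]
          ring
  have hlim : Tendsto (fun k : ℕ => C * ENNReal.ofReal (η₁ ^ a * (c / ρ ^ a) ^ k)) atTop (𝓝 0) := by
    have h2 : Tendsto (fun k : ℕ => η₁ ^ a * (c / ρ ^ a) ^ k) atTop (𝓝 0) := by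
      simpa using (tendsto_pow_atTop_nhds_zero_of_lt_one (by positivity)
        ((div_lt_one (by positivity)).2 hc)).const_mul (η₁ ^ a)
    have h3 := ENNReal.Tendsto.const_mul (ENNReal.tendsto_ofReal h2) (Or.inr hC)
    simpa using h3
  exact hF0 _ h1 (nonpos_iff_eq_zero.1 (ge_of_tendsto' hlim hbound))

section HaarMeasure

variable {n : ℕ}

theorem isClosedEmbedding_coe (n : ℕ) : Topology.IsClosedEmbedding
    (fun g : SpecialLinearGroup (Fin n) ℝ => (g : Matrix (Fin n) (Fin n) ℝ)) := by
  refine ⟨⟨⟨rfl⟩, Subtype.val_injective⟩, ?_⟩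
  have : Set.range (fun g : SpecialLinearGroup (Fin n) ℝ => (g : Matrix (Fin n) (Fin n) ℝ)) =
      {A | A.det = 1} := Subtype.range_coe
  rw [this]
  exact isClosed_eq continuous_id.matrix_det continuous_const

instance isTopologicalGroup_specialLinearGroup (n : ℕ) :
    IsTopologicalGroup (SpecialLinearGroup (Fin n) ℝ) where
  continuous_mul := by
    have hc := (isClosedEmbedding_coe n).continuous
    refine (isClosedEmbedding_coe n).isInducing.continuous_iff.2 ?_
    exact (hc.comp continuous_fst).matrix_mul (hc.comp continuous_snd)
  continuous_inv := by
    refine (isClosedEmbedding_coe n).isInducing.continuous_iff.2 ?_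
    have : (fun g : SpecialLinearGroup (Fin n) ℝ => (g : Matrix (Fin n) (Fin n) ℝ)) ∘ Inv.inv =
        fun g : SpecialLinearGroup (Fin n) ℝ => (g : Matrix (Fin n) (Fin n) ℝ).adjugate :=
      funext fun g => Matrix.SpecialLinearGroup.coe_inv g
    rw [this]
    exact (isClosedEmbedding_coe n).continuous.matrix_adjugate

instance locallyCompactSpace_matrix (n : ℕ) : LocallyCompactSpace (Matrix (Fin n) (Fin n) ℝ) :=
  inferInstanceAs (LocallyCompactSpace (Fin n → Fin n → ℝ))

instance secondCountableTopology_matrix (n : ℕ) :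
    SecondCountableTopology (Matrix (Fin n) (Fin n) ℝ) :=
  inferInstanceAs (SecondCountableTopology (Fin n → Fin n → ℝ))

instance locallyCompactSpace_specialLinearGroup (n : ℕ) :
    LocallyCompactSpace (SpecialLinearGroup (Fin n) ℝ) :=
  (isClosedEmbedding_coe n).locallyCompactSpace

instance secondCountableTopology_specialLinearGroup (n : ℕ) :
    SecondCountableTopology (SpecialLinearGroup (Fin n) ℝ) :=
  (isClosedEmbedding_coe n).isInducing.secondCountableTopology

instance t2Space_specialLinearGroup (n : ℕ) : T2Space (SpecialLinearGroup (Fin n) ℝ) :=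
  (isClosedEmbedding_coe n).isEmbedding.t2Space

/-- The multiple of `h` with determinant one, if `h` has positive determinant. -/
noncomputable def unimodularPart (h : Fin n → Fin n → ℝ) : SpecialLinearGroup (Fin n) ℝ :=
  open Classical in
  if H : 0 < n ∧ 0 < (Matrix.of h).det then
    ⟨((Matrix.of h).det ^ (-(n : ℝ)⁻¹)) • Matrix.of h, by
      have hn : (n : ℝ) ≠ 0 := Nat.cast_ne_zero.2 H.1.ne'
      rw [Matrix.det_smul, Fintype.card_fin, ← Real.rpow_natCast, ← Real.rpow_mul H.2.le, neg_mul,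
        inv_mul_cancel₀ hn, Real.rpow_neg_one, inv_mul_cancel₀ H.2.ne']⟩
  else 1

theorem coe_unimodularPart [NeZero n] {h : Fin n → Fin n → ℝ} (H : 0 < (Matrix.of h).det) :
    (unimodularPart h : Matrix (Fin n) (Fin n) ℝ) =
      ((Matrix.of h).det ^ (-(n : ℝ)⁻¹)) • Matrix.of h := by
  have H' : 0 < n ∧ 0 < (Matrix.of h).det := ⟨NeZero.pos n, H⟩
  have h1 : unimodularPart h = _ := dif_pos H'
  rw [h1]

theorem unimodularPart_of_not_pos {h : Fin n → Fin n → ℝ} (H : ¬ 0 < (Matrix.of h).det) :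
    unimodularPart h = 1 := dif_neg fun h => H h.2

theorem unimodularPart_mul [NeZero n] (g : SpecialLinearGroup (Fin n) ℝ) {h : Fin n → Fin n → ℝ}
    (H : 0 < (Matrix.of h).det) :
    unimodularPart ((g : Matrix (Fin n) (Fin n) ℝ) * Matrix.of h : Matrix (Fin n) (Fin n) ℝ) =
      g * unimodularPart h := by
  have hdet : (g * Matrix.of h : Matrix (Fin n) (Fin n) ℝ).det = (Matrix.of h).det := by
    rw [Matrix.det_mul, g.2, one_mul]
  have hmul : ((g * unimodularPart h : SpecialLinearGroup (Fin n) ℝ) : Matrix (Fin n) (Fin n) ℝ) =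
      (g : Matrix (Fin n) (Fin n) ℝ) * unimodularPart h := rfl
  refine Subtype.ext ((coe_unimodularPart (hdet ▸ H)).trans (Eq.trans ?_ hmul.symm))
  rw [coe_unimodularPart H, mul_smul_comm]
  exact congrArg
    (fun t : ℝ => t ^ (-(n : ℝ)⁻¹) • ((g : Matrix (Fin n) (Fin n) ℝ) * Matrix.of h)) hdet

theorem measurable_det_of (n : ℕ) : Measurable fun h : Fin n → Fin n → ℝ => (Matrix.of h).det :=
  (continuous_id : Continuous fun h : Fin n → Fin n → ℝ => Matrix.of h).matrix_det.measurable

theorem measurable_unimodularPart [NeZero n] : Measurable (unimodularPart (n := n)) := by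
  have hborel : (borel (SpecialLinearGroup (Fin n) ℝ)) = MeasurableSpace.comap
      (fun g : SpecialLinearGroup (Fin n) ℝ => (g : Fin n → Fin n → ℝ)) MeasurableSpace.pi := by
    rw [BorelSpace.measurable_eq (α := Fin n → Fin n → ℝ)]
    exact borel_comap
  have key : Measurable fun h : Fin n → Fin n → ℝ =>
      (fun i j => unimodularPart h i j : Fin n → Fin n → ℝ) := by
    classical
    have heq : (fun h : Fin n → Fin n → ℝ =>
        (fun i j => unimodularPart h i j : Fin n → Fin n → ℝ)) = fun h =>
        if 0 < (Matrix.of h).det then ((Matrix.of h).det ^ (-(n : ℝ)⁻¹)) • h else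
          fun i j => (1 : Matrix (Fin n) (Fin n) ℝ) i j := by
      funext h
      split_ifs with H
      · exact coe_unimodularPart H
      · rw [unimodularPart_of_not_pos H]
        rfl
    rw [heq]
    have hd := measurable_det_of n
    exact Measurable.ite (measurableSet_lt measurable_const hd)
      ((hd.pow_const _).smul measurable_id) measurable_const
  intro S hS
  change MeasurableSet[borel _] S at hS
  rw [hborel] at hS
  obtain ⟨T, hT, rfl⟩ := hS
  exact key hT

/-- Haar measure of a set as the volume of the part of the cone over it of determinant at most
one. -/
noncomputable def coneMeasure (n : ℕ) : Measure (SpecialLinearGroup (Fin n) ℝ) :=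
  (volume.restrict {h : Fin n → Fin n → ℝ | 0 < (Matrix.of h).det ∧ (Matrix.of h).det ≤ 1}).map
    unimodularPart

theorem coneMeasure_apply [NeZero n] {W : Set (SpecialLinearGroup (Fin n) ℝ)}
    (hW : MeasurableSet W) : coneMeasure n W = volume {h : Fin n → Fin n → ℝ |
      unimodularPart h ∈ W ∧ 0 < (Matrix.of h).det ∧ (Matrix.of h).det ≤ 1} := by
  rw [coneMeasure, Measure.map_apply measurable_unimodularPart hW,
    Measure.restrict_apply (measurable_unimodularPart hW)]
  rfl

theorem det_mulLeftLinearMap (A : Matrix (Fin n) (Fin n) ℝ) :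
    LinearMap.det (mulLeftLinearMap (Fin n) ℝ A) = A.det ^ n := by
  have h := LinearMap.det_pi fun _ : Fin n => Matrix.toLin' A
  rw [LinearMap.det_toLin', Finset.prod_const, Finset.card_univ, Fintype.card_fin] at h
  rw [← h]
  refine (LinearMap.det_conj _ (Matrix.transposeLinearEquiv (Fin n) (Fin n) ℝ ℝ)).symm.trans ?_
  refine congrArg LinearMap.det (LinearMap.ext fun B => ?_)
  ext i j
  simp [Matrix.mul_apply]
  rfl

theorem volume_preimage_mul (g : SpecialLinearGroup (Fin n) ℝ) (S : Set (Fin n → Fin n → ℝ)) :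
    volume ((fun h : Fin n → Fin n → ℝ => ((g : Matrix (Fin n) (Fin n) ℝ) * Matrix.of h :
      Matrix (Fin n) (Fin n) ℝ)) ⁻¹' S) = volume S := by
  let f : (Fin n → Fin n → ℝ) →ₗ[ℝ] (Fin n → Fin n → ℝ) := mulLeftLinearMap (Fin n) ℝ g.1
  have hf : LinearMap.det f = 1 := by
    have h := det_mulLeftLinearMap g.1
    rw [g.2, one_pow] at h
    exact h
  have h := Measure.addHaar_preimage_linearMap volume (f := f) (by rw [hf]; exact one_ne_zero) S
  rw [hf, inv_one, abs_one, ENNReal.ofReal_one, one_mul] at h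
  exact h

theorem isMulLeftInvariant_coneMeasure [NeZero n] : (coneMeasure n).IsMulLeftInvariant := by
  refine ⟨fun g => Measure.ext fun W hW => ?_⟩
  have hg : Measurable fun x : SpecialLinearGroup (Fin n) ℝ => g * x :=
    (continuous_const_mul g).measurable
  rw [Measure.map_apply hg hW, coneMeasure_apply (hg hW), coneMeasure_apply hW]
  refine Eq.trans (congrArg volume (Set.ext fun h => ?_)) (volume_preimage_mul g _)
  have hdet : (g * Matrix.of h : Matrix (Fin n) (Fin n) ℝ).det = (Matrix.of h).det := by
    rw [Matrix.det_mul, g.2, one_mul]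
  constructor
  · rintro ⟨h1, h2, h3⟩
    refine ⟨?_, hdet.symm ▸ h2, hdet.symm ▸ h3⟩
    exact Set.mem_of_eq_of_mem (unimodularPart_mul g h2) h1
  · rintro ⟨h1, h2, h3⟩
    replace h2 : 0 < (g * Matrix.of h : Matrix (Fin n) (Fin n) ℝ).det := h2
    replace h3 : (g * Matrix.of h : Matrix (Fin n) (Fin n) ℝ).det ≤ 1 := h3
    rw [hdet] at h2 h3
    have h4 : g * unimodularPart h ∈ W := Set.mem_of_eq_of_mem (unimodularPart_mul g h2).symm h1
    exact ⟨h4, h2, h3⟩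

theorem isFiniteMeasureOnCompacts_coneMeasure [NeZero n] :
    IsFiniteMeasureOnCompacts (coneMeasure n) := by
  refine ⟨fun K hK => ?_⟩
  rw [coneMeasure_apply hK.measurableSet]
  let f : ℝ × SpecialLinearGroup (Fin n) ℝ → Fin n → Fin n → ℝ :=
    fun p => (p.1 • (p.2 : Matrix (Fin n) (Fin n) ℝ) : Matrix (Fin n) (Fin n) ℝ)
  have hf : Continuous f :=
    continuous_fst.smul ((isClosedEmbedding_coe n).continuous.comp continuous_snd)
  have hcomp : IsCompact (f '' (Set.Icc (0 : ℝ) 1 ×ˢ K)) := (isCompact_Icc.prod hK).image hf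
  refine lt_of_le_of_lt (measure_mono ?_) hcomp.measure_lt_top
  rintro h ⟨h1, h2, h3⟩
  refine ⟨((Matrix.of h).det ^ (n : ℝ)⁻¹, unimodularPart h), ⟨⟨?_, ?_⟩, h1⟩, ?_⟩
  · positivity
  · exact Real.rpow_le_one h2.le h3 (by positivity)
  · change (Matrix.of h).det ^ (n : ℝ)⁻¹ • (unimodularPart h : Matrix (Fin n) (Fin n) ℝ) = _
    rw [coe_unimodularPart h2, smul_smul, Real.rpow_neg h2.le, mul_inv_cancel₀ (by positivity),
      one_smul]
    rfl

end HaarMeasure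

section UnimodularCone

variable {n : ℕ}

/-- The part of `spectralCone n R ε` of determinant one. -/
def unimodularCone (n : ℕ) (R ε : ℝ) : Set (SpecialLinearGroup (Fin n) ℝ) :=
  {g | (g : Matrix (Fin n) (Fin n) ℝ) ∈ spectralCone n R ε}

theorem measurableSet_unimodularCone (n : ℕ) (R ε : ℝ) :
    MeasurableSet (unimodularCone n R ε) := by
  have hc : Measurable fun g : SpecialLinearGroup (Fin n) ℝ =>
      (fun i j => (g : Matrix (Fin n) (Fin n) ℝ) i j : Fin n → Fin n → ℝ) :=
    Continuous.measurable (γ := Fin n → Fin n → ℝ) (isClosedEmbedding_coe n).continuous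
  exact hc (measurableSet_spectralCone n R ε)

theorem unimodularPart_mem_unimodularCone [NeZero n] {R ε : ℝ} {h : Fin n → Fin n → ℝ}
    (H : 0 < (Matrix.of h).det) :
    unimodularPart h ∈ unimodularCone n R ε ↔ Matrix.of h ∈ spectralCone n R ε := by
  have hc : 0 < (Matrix.of h).det ^ (-(n : ℝ)⁻¹) := Real.rpow_pos_of_pos H _
  have hcoe := coe_unimodularPart H
  constructor
  · intro hh
    have hh' : (unimodularPart h : Matrix (Fin n) (Fin n) ℝ) ∈ spectralCone n R ε := hh
    rw [hcoe] at hh'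
    have := smul_mem_spectralCone (inv_pos.2 hc) hh'
    rwa [smul_smul, inv_mul_cancel₀ hc.ne', one_smul] at this
  · intro hh
    have hh' : (unimodularPart h : Matrix (Fin n) (Fin n) ℝ) ∈ spectralCone n R ε := by
      rw [hcoe]
      exact smul_mem_spectralCone hc hh
    exact hh'

theorem coneMeasure_unimodularCone [NeZero n] (R ε : ℝ) :
    coneMeasure n (unimodularCone n R ε) = volume {h : Fin n → Fin n → ℝ |
      Matrix.of h ∈ spectralCone n R ε ∧ 0 < (Matrix.of h).det ∧ (Matrix.of h).det ≤ 1} := by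
  rw [coneMeasure_apply (measurableSet_unimodularCone n R ε)]
  refine congrArg volume (Set.ext fun h => ?_)
  exact and_congr_left fun H => unimodularPart_mem_unimodularCone H.1

theorem volume_truncCone_le_coneMeasure [NeZero n] {R ε : ℝ} (hε0 : 0 < ε) (hε : ε < 1) :
    ENNReal.ofReal ((1 + ε)⁻¹ ^ (n * n)) * volume (truncCone n R ε) ≤
      coneMeasure n (unimodularCone n R ε) := by
  have h1 : 0 < 1 + ε := by positivity
  rw [coneMeasure_unimodularCone, ← volume_smul_pi_pi n (inv_pos.2 h1).le]
  refine measure_mono ?_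
  rintro _ ⟨h, hh, rfl⟩
  have hmem := smul_mem_spectralCone (inv_pos.2 h1) hh.1
  obtain ⟨s, X, hs, hs1, hX, hR, hεX, rfl⟩ := exists_of_mem_truncCone hh
  obtain ⟨hd1, hd2⟩ := det_bounds_of_hasSmallRealSpectrum hs hε hεX
  have hdet : ((1 + ε)⁻¹ • (s • (1 + X)) : Matrix (Fin n) (Fin n) ℝ).det =
      (1 + ε)⁻¹ ^ n * (s • (1 + X)).det := by
    rw [Matrix.det_smul, Fintype.card_fin]
  have hpos : 0 < (s • (1 + X)).det :=
    (pow_pos (mul_pos hs (by linarith)) n).trans_le hd1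
  refine ⟨hmem, ?_, ?_⟩
  · exact (mul_pos (by positivity) hpos).trans_eq hdet.symm
  · refine hdet.trans_le ?_
    calc (1 + ε)⁻¹ ^ n * (s • (1 + X)).det ≤ (1 + ε)⁻¹ ^ n * (1 * (1 + ε)) ^ n := by
          gcongr
          refine hd2.trans ?_
          gcongr
      _ = 1 := by rw [one_mul, ← mul_pow, inv_mul_cancel₀ h1.ne', one_pow]

theorem coneMeasure_le_volume_truncCone [NeZero n] {R ε : ℝ} (hε : ε < 1) :
    coneMeasure n (unimodularCone n R ε) ≤
      ENNReal.ofReal ((1 - ε)⁻¹ ^ (n * n)) * volume (truncCone n R ε) := by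
  have h1 : 0 < 1 - ε := by linarith
  rw [coneMeasure_unimodularCone, ← volume_smul_pi_pi n (inv_pos.2 h1).le]
  refine measure_mono ?_
  rintro h ⟨hh, h2, h3⟩
  refine Set.mem_smul_set.2
    ⟨(1 - ε) • h, ⟨smul_mem_spectralCone h1 hh, ?_⟩, inv_smul_smul₀ h1.ne' h⟩
  obtain ⟨s, X, hs, hX, hR, hεX, htr, heq⟩ := exists_of_mem_spectralCone hh
  have hd := (det_bounds_of_hasSmallRealSpectrum hs hε hεX).1
  rw [← heq] at hd
  have hs1 : s * (1 - ε) ≤ 1 :=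
    le_of_not_gt fun hlt => absurd (hd.trans h3) (not_le.2 (one_lt_pow₀ hlt (NeZero.ne n)))
  have htr' : (Matrix.of ((1 - ε) • h)).trace = (1 - ε) * (s * n) := by
    rw [← htr]
    exact Matrix.trace_smul (1 - ε) (Matrix.of h)
  rw [htr']
  calc (1 - ε) * (s * n) = s * (1 - ε) * n := by ring
    _ ≤ 1 * n := by gcongr
    _ = n := one_mul _

theorem coneMeasure_ne_zero (n : ℕ) [NeZero n] : coneMeasure n ≠ 0 := by
  intro h0
  have h1 := volume_truncCone_le_coneMeasure (n := n) (R := 1) (ε := 2⁻¹) (by norm_num)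
    (by norm_num)
  rw [h0, Measure.coe_zero, Pi.zero_apply, nonpos_iff_eq_zero, mul_eq_zero] at h1
  rcases h1 with h1 | h1
  · exact absurd h1 (ENNReal.ofReal_pos.2 (by positivity)).ne'
  · exact absurd h1 (volume_truncCone_pos n (by norm_num) (by norm_num)).ne'

theorem coneMeasure_singleton_one (hn : 2 ≤ n) : coneMeasure n {1} = 0 := by
  have : NeZero n := ⟨by omega⟩
  rw [coneMeasure_apply (measurableSet_singleton _)]
  let E : Fin n → Fin n → ℝ := (1 : Matrix (Fin n) (Fin n) ℝ)
  have hE : Submodule.span ℝ {E} ≠ ⊤ := by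
    intro htop
    let F : Fin n → Fin n → ℝ := fun _ _ => 1
    have hF : F ∈ Submodule.span ℝ {E} := htop ▸ Submodule.mem_top
    obtain ⟨c, hc⟩ := Submodule.mem_span_singleton.1 hF
    have h01 : (⟨0, by omega⟩ : Fin n) ≠ ⟨1, by omega⟩ := by simp
    have h := congrFun (congrFun hc ⟨0, by omega⟩) ⟨1, by omega⟩
    have h2 : c * (1 : Matrix (Fin n) (Fin n) ℝ) ⟨0, by omega⟩ ⟨1, by omega⟩ = 1 := h
    rw [Matrix.one_apply_ne h01, mul_zero] at h2
    exact zero_ne_one h2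
  refine measure_mono_null ?_ (Measure.addHaar_submodule volume _ hE)
  rintro h ⟨h1, h2, -⟩
  have hc : 0 < (Matrix.of h).det ^ (-(n : ℝ)⁻¹) := Real.rpow_pos_of_pos h2 _
  have hcoe := coe_unimodularPart h2
  rw [show unimodularPart h = 1 from h1] at hcoe
  refine Submodule.mem_span_singleton.2 ⟨((Matrix.of h).det ^ (-(n : ℝ)⁻¹))⁻¹, ?_⟩
  have hE : E = ((Matrix.of h).det ^ (-(n : ℝ)⁻¹)) • h := hcoe
  rw [hE]
  exact inv_smul_smul₀ hc.ne' h

theorem exists_nhds_one_coneMeasure_le (hn : 2 ≤ n) {U : Set (SpecialLinearGroup (Fin n) ℝ)}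
    (hU : U ∈ 𝓝 1) {δ : ℝ≥0∞} (hδ : 0 < δ) : ∃ N ∈ 𝓝 (1 : SpecialLinearGroup (Fin n) ℝ),
      N ⊆ U ∧ N⁻¹ = N ∧ MeasurableSet N ∧ coneMeasure n N ≤ δ := by
  have : NeZero n := ⟨by omega⟩
  have := isFiniteMeasureOnCompacts_coneMeasure (n := n)
  obtain ⟨O, hO1, hO, hOδ⟩ := Set.exists_isOpen_lt_of_lt {(1 : SpecialLinearGroup (Fin n) ℝ)} δ
    ((coneMeasure_singleton_one hn).trans_lt hδ)
  let P := O ∩ interior U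
  have hP : IsOpen P := hO.inter isOpen_interior
  have h1P : 1 ∈ P := ⟨hO1 rfl, mem_interior_iff_mem_nhds.2 hU⟩
  have hN : IsOpen (P ∩ P⁻¹) := hP.inter hP.inv
  refine ⟨P ∩ P⁻¹, hN.mem_nhds ⟨h1P, ?_⟩, ?_, ?_, hN.measurableSet, ?_⟩
  · rwa [Set.mem_inv, inv_one]
  · exact fun x hx => interior_subset hx.1.2
  · rw [Set.inter_inv, inv_inv, Set.inter_comm]
  · exact (measure_mono fun x hx => hx.1.1).trans hOδ.le

theorem exists_coneMeasure_eq_smul (n : ℕ) [NeZero n]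
    (μ : Measure (SpecialLinearGroup (Fin n) ℝ)) [μ.IsHaarMeasure] :
    ∃ c : ℝ≥0∞, c ≠ 0 ∧ c ≠ ∞ ∧ coneMeasure n = c • μ := by
  have := isFiniteMeasureOnCompacts_coneMeasure (n := n)
  have := isMulLeftInvariant_coneMeasure (n := n)
  have h := Measure.isMulLeftInvariant_eq_smul (coneMeasure n) μ
  refine ⟨((coneMeasure n).haarScalarFactor μ : ℝ≥0∞), fun h0 => coneMeasure_ne_zero n ?_,
    ENNReal.coe_ne_top, h⟩
  rw [h, ENNReal.coe_eq_zero.1 h0, zero_smul]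

theorem deltaRatio_smul {G : Type*} [Group G] [MeasurableSpace G] {c : ℝ≥0∞} (hc : c ≠ 0)
    (hc' : c ≠ ∞) (μ : Measure G) (F V : Set G) : deltaRatio (c • μ) F V = deltaRatio μ F V :=
  ENNReal.mul_div_mul_left _ _ hc hc'

end UnimodularCone

section DeltaBound

variable {n : ℕ}

theorem exists_unimodularCone_subset [NeZero n] {U : Set (SpecialLinearGroup (Fin n) ℝ)}
    (hU : U ∈ 𝓝 1) : ∃ R₀ > 0, ∀ R ≤ R₀, ∀ ε, unimodularCone n R ε ⊆ U := by
  rw [(isClosedEmbedding_coe n).isInducing.nhds_eq_comap, Filter.mem_comap] at hU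
  obtain ⟨T, hT, hTU⟩ := hU
  have h1 : ((1 : SpecialLinearGroup (Fin n) ℝ) : Matrix (Fin n) (Fin n) ℝ) = 1 := rfl
  rw [h1] at hT
  let Φ : (Fin n → Fin n → ℝ) → Matrix (Fin n) (Fin n) ℝ :=
    fun X => (1 + Matrix.of X).det ^ (-(n : ℝ)⁻¹) • (1 + Matrix.of X)
  have hadd : Continuous fun X : Fin n → Fin n → ℝ => 1 + Matrix.of X :=
    continuous_const.add continuous_id
  have hdet : ContinuousAt (fun X : Fin n → Fin n → ℝ =>
      (1 + Matrix.of X).det ^ (-(n : ℝ)⁻¹)) 0 := by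
    refine hadd.matrix_det.continuousAt.rpow_const (Or.inl ?_)
    rw [Matrix.of_zero, add_zero, Matrix.det_one]
    exact one_ne_zero
  have hΦ : ContinuousAt Φ 0 := hdet.smul hadd.continuousAt
  have hΦ0 : Φ 0 = 1 := by
    simp only [Φ, Matrix.of_zero, add_zero, Matrix.det_one, Real.one_rpow, one_smul]
  have hT' : Φ ⁻¹' T ∈ 𝓝 0 := hΦ (by rwa [hΦ0])
  obtain ⟨r, hr, hball⟩ := Metric.mem_nhds_iff.1 hT'
  refine ⟨r / 2, half_pos hr, fun R hR ε g hg => hTU ?_⟩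
  obtain ⟨s, X, hs, hX, hXR, -, -, heq⟩ := exists_of_mem_spectralCone hg
  let Y : Fin n → Fin n → ℝ := X
  have hYball : Y ∈ Metric.ball 0 r := by
    rw [Metric.mem_ball, dist_pi_lt_iff hr]
    intro i
    rw [dist_pi_lt_iff hr]
    intro j
    rw [Pi.zero_apply, Pi.zero_apply, Real.dist_0_eq_abs]
    exact (abs_apply_le_frob X i j).trans_lt (by linarith)
  have hmem : Φ X ∈ T := hball hYball
  have hg1 : s ^ n * (1 + X).det = 1 := by
    have := g.2
    rwa [heq, Matrix.det_smul, Fintype.card_fin] at this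
  have hdetX : (1 + X).det = (s ^ n)⁻¹ := eq_inv_of_mul_eq_one_right hg1
  have hΦX : Φ X = (g : Matrix (Fin n) (Fin n) ℝ) := by
    have h2 : (1 + X).det ^ (-(n : ℝ)⁻¹) = s := by
      rw [hdetX, Real.rpow_neg (by positivity), Real.inv_rpow (by positivity), inv_inv,
        Real.pow_rpow_inv_natCast hs.le (NeZero.ne n)]
    rw [heq]
    exact congrArg (· • (1 + X)) h2
  have hgT : (g : Matrix (Fin n) (Fin n) ℝ) ∈ T := hΦX ▸ hmem
  exact hgT

theorem unimodularCone_subset_iInter [NeZero n] {R ε ρ : ℝ} (hρ : 0 < ρ)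
    {V : Set (SpecialLinearGroup (Fin n) ℝ)} (hV : unimodularCone n R ε ⊆ V) :
    unimodularCone n (R / ρ) ε ⊆ ⋂ s ∈ adjointBall n ρ, (fun x => s * x * s⁻¹) '' V := by
  intro g hg
  refine Set.mem_iInter₂.2 fun s hs => ⟨s⁻¹ * g * s, hV ?_, by group⟩
  have h1 : (s : Matrix (Fin n) (Fin n) ℝ) *
      ((s⁻¹ : SpecialLinearGroup (Fin n) ℝ) : Matrix (Fin n) (Fin n) ℝ) = 1 :=
    congrArg Subtype.val (mul_inv_cancel s)
  exact conj_mem_spectralCone hρ h1 hs hg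

/-- A lower bound for the ratio attained by a suitable small neighbourhood, which tends to
`ρ ^ (-(n * (n - 1)) / 2)` as `τ → 0`. -/
noncomputable def ratioBound (n : ℕ) (ρ τ : ℝ) : ℝ :=
  (1 + τ)⁻¹ ^ (n * n) * ((ρ / (1 - τ))⁻¹ ^ (n * n) * (ρ / (1 - τ)) *
    (ρ ^ ((n + 1).choose 2 - 1) * (1 - τ))) / ((1 - τ)⁻¹ ^ (n * n) + τ)

theorem continuousAt_ratioBound (n : ℕ) {ρ : ℝ} (hρ : 0 < ρ) :
    ContinuousAt (ratioBound n ρ) 0 := by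
  unfold ratioBound
  have h1 : ContinuousAt (fun τ : ℝ => (1 + τ)⁻¹) 0 :=
    (continuousAt_const.add continuousAt_id).inv₀ (by simp)
  have h2 : ContinuousAt (fun τ : ℝ => 1 - τ) 0 := continuousAt_const.sub continuousAt_id
  have h3 : ContinuousAt (fun τ : ℝ => (1 - τ)⁻¹) 0 := h2.inv₀ (by simp)
  have h4 : ContinuousAt (fun τ : ℝ => ρ / (1 - τ)) 0 := continuousAt_const.div h2 (by simp)
  have h5 : ContinuousAt (fun τ : ℝ => (ρ / (1 - τ))⁻¹) 0 := h4.inv₀ (by simpa using hρ.ne')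
  exact ((h1.pow _).mul (((h5.pow _).mul h4).mul (continuousAt_const.mul h2))).div
    ((h3.pow _).add continuousAt_id) (by simp)

theorem ratioBound_zero (n : ℕ) [NeZero n] {ρ : ℝ} (hρ : 0 < ρ) :
    ratioBound n ρ 0 = ρ ^ (-((n * (n - 1) : ℕ) : ℝ) / 2) := by
  have hn := NeZero.pos n
  have h1 : ratioBound n ρ 0 = ρ⁻¹ ^ (n * n) * ρ * ρ ^ ((n + 1).choose 2 - 1) := by
    simp [ratioBound]
  have hch : (((n + 1).choose 2 - 1 : ℕ) : ℝ) = (n + 1) * n / 2 - 1 := by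
    rw [Nat.cast_sub (Nat.choose_pos (by omega)), Nat.cast_choose_two]
    push_cast
    ring
  have h2 : ρ⁻¹ ^ (n * n) * ρ * ρ ^ ((n + 1).choose 2 - 1) =
      ρ ^ (-((n * n : ℕ) : ℝ)) * ρ ^ (1 : ℝ) * ρ ^ (((n + 1).choose 2 - 1 : ℕ) : ℝ) := by
    rw [Real.rpow_neg hρ.le, Real.rpow_natCast, Real.rpow_natCast, Real.rpow_one, inv_pow]
  rw [h1, h2, ← Real.rpow_add hρ, ← Real.rpow_add hρ, hch, Nat.cast_mul, Nat.cast_mul,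
    Nat.cast_sub hn]
  congr 1
  push_cast
  ring

theorem exists_nhds_ratioBound_le (hn : 2 ≤ n) {ρ τ : ℝ} (hρ : 1 < ρ) (hτ0 : 0 < τ) (hτ1 : τ < 1)
    {U : Set (SpecialLinearGroup (Fin n) ℝ)} (hU : U ∈ 𝓝 1) :
    ∃ V ∈ 𝓝 (1 : SpecialLinearGroup (Fin n) ℝ), V ⊆ U ∧ V⁻¹ = V ∧ MeasurableSet V ∧
      ENNReal.ofReal (ratioBound n ρ τ) ≤ deltaRatio (coneMeasure n) (adjointBall n ρ) V := by
  have : NeZero n := ⟨by omega⟩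
  have hρ0 : 0 < ρ := by linarith
  obtain ⟨R₀, hR₀, hRU⟩ := exists_unimodularCone_subset hU
  set θ := 1 - τ with hθ
  have hθ0 : 0 < θ := by linarith
  have hθ1 : θ < 1 := by linarith
  let R := min R₀ τ
  have hR0 : 0 < R := lt_min hR₀ hτ0
  obtain ⟨η₀, hη₀, hinv⟩ := exists_inv_mem_spectralCone n hθ0 hθ1 hR0
    ((min_le_right _ _).trans (by linarith))
  obtain ⟨C, hC, hFC⟩ := exists_volume_truncCone_le n R
  have hc : ρ ^ ((n + 1).choose 2 - 1) * θ < ρ ^ ((n + 1).choose 2 - 1) :=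
    mul_lt_of_lt_one_right (by positivity) hθ1
  obtain ⟨η, hη0, hη, hF⟩ := exists_mul_le_of_le_pow (F := fun ε => volume (truncCone n R ε)) hC
    (fun ε hε => (volume_truncCone_pos n hR0 hε).ne') hFC hρ (by positivity) hc
    (lt_min hη₀ hτ0)
  replace hF : ENNReal.ofReal (ρ ^ ((n + 1).choose 2 - 1) * θ) * volume (truncCone n R η) ≤
    volume (truncCone n R (ρ * η)) := hF
  have hητ : η ≤ τ := hη.trans (min_le_right _ _)
  have hv0 : volume (truncCone n R η) ≠ 0 := (volume_truncCone_pos n hR0 hη0).ne'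
  have hvtop : volume (truncCone n R η) ≠ ∞ :=
    ne_top_of_le_ne_top (ENNReal.mul_ne_top hC ENNReal.ofReal_ne_top) (hFC η hη0 (by linarith))
  obtain ⟨N, hN1, hNU, hNinv, hNm, hN⟩ := exists_nhds_one_coneMeasure_le hn hU
    (δ := ENNReal.ofReal τ * volume (truncCone n R η))
    (ENNReal.mul_pos (ENNReal.ofReal_pos.2 hτ0).ne' hv0)
  set A := unimodularCone n (θ * R) (θ * η) with hA
  have hAm : MeasurableSet A := measurableSet_unimodularCone n _ _
  have hAW : A ∪ A⁻¹ ⊆ unimodularCone n R η := by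
    rintro g (hg | hg)
    · exact spectralCone_mono (by nlinarith) (by nlinarith) hg
    · have h1 := hinv η hη0 (hη.trans (min_le_left _ _)) _ hg
      have h2 : (g⁻¹ : SpecialLinearGroup (Fin n) ℝ).1⁻¹ = g.1 :=
        Matrix.inv_eq_left_inv (congrArg Subtype.val (mul_inv_cancel g))
      rw [h2] at h1
      exact h1
  refine ⟨A ∪ A⁻¹ ∪ N, Filter.mem_of_superset hN1 Set.subset_union_right,
    Set.union_subset (hAW.trans (hRU R (min_le_left _ _) η)) hNU, ?_,
    (hAm.union hAm.inv).union hNm, ?_⟩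
  · rw [Set.union_inv, Set.union_inv, inv_inv, hNinv, Set.union_comm A⁻¹]
  have hupper : coneMeasure n (A ∪ A⁻¹ ∪ N) ≤
      ENNReal.ofReal (θ⁻¹ ^ (n * n) + τ) * volume (truncCone n R η) := by
    rw [ENNReal.ofReal_add (by positivity) hτ0.le, add_mul]
    refine (measure_union_le _ _).trans (add_le_add ?_ hN)
    refine (measure_mono hAW).trans ((coneMeasure_le_volume_truncCone (by linarith)).trans ?_)
    have hθη : θ ≤ 1 - η := by linarith
    exact mul_le_mul_left (ENNReal.ofReal_le_ofReal (pow_le_pow_left₀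
      (inv_nonneg.2 (hθ0.le.trans hθη)) (inv_anti₀ hθ0 hθη) _)) _
  have hlower : ENNReal.ofReal ((1 + τ)⁻¹ ^ (n * n) * ((ρ / θ)⁻¹ ^ (n * n) * (ρ / θ) *
      (ρ ^ ((n + 1).choose 2 - 1) * θ))) * volume (truncCone n R η) ≤
      coneMeasure n (⋂ s ∈ adjointBall n ρ, (fun x => s * x * s⁻¹) '' (A ∪ A⁻¹ ∪ N)) := by
    have hsub := unimodularCone_subset_iInter (V := A ∪ A⁻¹ ∪ N) hρ0
      (Set.subset_union_left.trans Set.subset_union_left : A ⊆ _)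
    have hθη : θ * η < 1 := by nlinarith
    refine le_trans ?_ ((volume_truncCone_le_coneMeasure (by positivity) hθη).trans
      (measure_mono hsub))
    have hκ : 0 < ρ / θ := by positivity
    have hsc := volume_truncCone_le_scaled (n := n) (R := R) (ε := ρ * η) hκ
    have e1 : R / (ρ / θ) = θ * R / ρ := by field_simp
    have e2 : ρ * η / (ρ / θ) = θ * η := by field_simp
    rw [e1, e2] at hsc
    have h1 : (ρ / θ)⁻¹ ^ (n * n) * (ρ / θ) ^ (n * n) = 1 := by
      rw [← mul_pow, inv_mul_cancel₀ hκ.ne', one_pow]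
    rw [ENNReal.ofReal_mul (by positivity), mul_assoc]
    refine mul_le_mul' (ENNReal.ofReal_le_ofReal ?_) ?_
    · gcongr
      nlinarith
    rw [ENNReal.ofReal_mul (by positivity), mul_assoc, ENNReal.ofReal_mul (by positivity),
      mul_assoc]
    calc _ ≤ ENNReal.ofReal ((ρ / θ)⁻¹ ^ (n * n)) * (ENNReal.ofReal (ρ / θ) *
          volume (truncCone n R (ρ * η))) := by gcongr
      _ ≤ ENNReal.ofReal ((ρ / θ)⁻¹ ^ (n * n)) * (ENNReal.ofReal ((ρ / θ) ^ (n * n)) *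
          volume (truncCone n (θ * R / ρ) (θ * η))) := by gcongr
      _ = _ := by
        rw [← mul_assoc, ← ENNReal.ofReal_mul (by positivity), h1, ENNReal.ofReal_one, one_mul]
  have hM : 0 < θ⁻¹ ^ (n * n) + τ := by positivity
  calc ENNReal.ofReal (ratioBound n ρ τ) = _ / _ :=
        (ENNReal.ofReal_div_of_pos hM).trans (ENNReal.mul_div_mul_right _ _ hv0 hvtop).symm
    _ ≤ _ := ENNReal.div_le_div hlower hupper

theorem le_deltaSup_of_forall_nhds {G : Type*} [Group G] [TopologicalSpace G]
    [LocallyCompactSpace G] [T2Space G] [FirstCountableTopology G] [MeasurableSpace G]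
    {μ : Measure G} {F : Set G} {c : ℝ≥0∞}
    (h : ∀ U ∈ 𝓝 (1 : G), ∃ V ∈ 𝓝 (1 : G), V ⊆ U ∧ V⁻¹ = V ∧ MeasurableSet V ∧
      c ≤ deltaRatio μ F V) : c ≤ deltaSup μ F := by
  obtain ⟨K, hK, hK1⟩ := exists_compact_mem_nhds (1 : G)
  obtain ⟨U, hU⟩ := (𝓝 (1 : G)).exists_antitone_basis
  choose V hV hVU hVinv hVm hVc using fun i => h (U i ∩ K) (inter_mem (hU.1.mem_of_mem trivial) hK1)
  refine le_trans ?_ (le_iSup₂_of_le V hV (le_iSup₂_of_le hVinv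
    (fun i => hK.of_isClosed_subset isClosed_closure
      (hK.isClosed.closure_subset_iff.2 ((hVU i).trans Set.inter_subset_right)))
    (le_iSup₂_of_le hVm (fun W hW => ?_) le_rfl)))
  · exact le_liminf_of_le (by isBoundedDefault) (Eventually.of_forall hVc)
  · obtain ⟨i, -, hi⟩ := hU.1.mem_iff.1 hW
    exact ⟨i, ((hVU i).trans Set.inter_subset_left).trans hi⟩

end DeltaBound

/-- Theorem B of the paper for `G = SL(n, ℝ)`: for every Haar measure `μ` and every
`ρ > 1` one has `δ_{B_ρ} ≥ ρ^{−n(n−1)/2}` (the maximal dimension of a nilpotent adjoint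
orbit of `𝔰𝔩(n,ℝ)` being `d = n(n−1)`). -/
theorem deltaSup_adjointBall_ge_SLnR (n : ℕ) (hn : 2 ≤ n)
    (μ : Measure (Matrix.SpecialLinearGroup (Fin n) ℝ)) [μ.IsHaarMeasure]
    (ρ : ℝ) (hρ : 1 < ρ) :
    ENNReal.ofReal (ρ ^ (-(((n * (n - 1) : ℕ) : ℝ)) / 2)) ≤
      deltaSup μ (adjointBall n ρ) := by
  have : NeZero n := ⟨by omega⟩
  have hρ0 : 0 < ρ := by linarith
  obtain ⟨k, hk0, hktop, hk⟩ := exists_coneMeasure_eq_smul n μ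
  rw [← ratioBound_zero n hρ0]
  have hlim : Tendsto (fun τ => ENNReal.ofReal (ratioBound n ρ τ)) (𝓝[>] 0)
      (𝓝 (ENNReal.ofReal (ratioBound n ρ 0))) :=
    ENNReal.tendsto_ofReal ((continuousAt_ratioBound n hρ0).tendsto.mono_left nhdsWithin_le_nhds)
  refine le_of_tendsto hlim ?_
  filter_upwards [Ioo_mem_nhdsGT (zero_lt_one (α := ℝ))] with τ hτ
  refine le_deltaSup_of_forall_nhds fun U hU => ?_
  obtain ⟨V, hV, hVU, hVinv, hVm, hVc⟩ := exists_nhds_ratioBound_le hn hρ hτ.1 hτ.2 hU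
  rw [hk, deltaRatio_smul hk0 hktop] at hVc
  exact ⟨V, hV, hVU, hVinv, hVm, hVc⟩
end

section
/- Let 1 ≤ p, p₁, p₂ < ∞ with 1/p = 1/p₁ + 1/p₂, let m : ℝ² → ℂ be bounded and continuous, and let C ≥ 0. Assume that for every integer j ≥ 1 and all finitely supported families a, b : ℤ → ℂ one has ‖ Σ_{n,k ∈ ℤ} m(n/j, k/j) · a(n) · b(k) · χ^j_{n+k} ‖_{L^p(ℝ/jℤ)} ≤ C · ‖ Σ_n a(n) χ^j_n ‖_{L^{p₁}(ℝ/jℤ)} · ‖ Σ_k b(k) χ^j_k ‖_{L^{p₂}(ℝ/jℤ)}, where ℝ/jℤ (the additive circle of circumference j) carries its Haar measure and χ^j_n(x) = exp(2πi n x / j). Then for all Schwartz functions f, g : ℝ → ℂ one has eLpNorm( x ↦ ∫_{ℝ²} m(ξ,η) · 𝓕f(ξ) · 𝓕g(η) · e^{2πi(ξ+η)x} d(ξ,η), p, volume) ≤ C · eLpNorm(f, p₁, volume) · eLpNorm(g, p₂, volume), where 𝓕 is the Fourier transform with kernel e^{−2πixξ}. -/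
open MeasureTheory Real Complex Function
open scoped ENNReal FourierTransform

/-- A Schwartz function on the line has quadratic decay. -/
theorem SchwartzMap.exists_norm_le_div_one_add_sq (f : SchwartzMap ℝ ℂ) :
    ∃ K : ℝ, 0 ≤ K ∧ ∀ x, ‖f x‖ ≤ K / (1 + x ^ 2) := by
  obtain ⟨A, hA0, hA⟩ := f.decay 0 0
  obtain ⟨B, hB0, hB⟩ := f.decay 2 0
  refine ⟨A + B, by positivity, fun x => ?_⟩
  have h1 := hA x
  have h2 := hB x
  simp only [pow_zero, one_mul, norm_iteratedFDeriv_zero, Real.norm_eq_abs, sq_abs] at h1 h2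
  rw [le_div_iff₀ (by positivity)]
  linarith

/-- Poisson summation for Schwartz functions over the lattice `Tℤ`. -/
theorem SchwartzMap.tsum_comp_add_mul_eq_tsum_fourier (f : SchwartzMap ℝ ℂ) {T : ℝ} (hT : 0 < T)
    (x : ℝ) :
    ∑' n : ℤ, f (x + T * n) =
      ∑' n : ℤ, (T : ℂ)⁻¹ * 𝓕 (⇑f) (n / T) * fourier n (x : AddCircle T) := by
  let e : ℝ ≃L[ℝ] ℝ := ContinuousLinearEquiv.unitsEquivAut ℝ (Units.mk0 T hT.ne')
  have he (y : ℝ) : e y = T * y := by simp [e, mul_comm]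
  have key := SchwartzMap.tsum_eq_tsum_fourier
    (SchwartzMap.compCLMOfContinuousLinearEquiv ℂ e f) (x / T)
  have hF (w : ℝ) : 𝓕 (⇑f ∘ e) w = (T : ℂ)⁻¹ * 𝓕 (⇑f) (w / T) := by
    have h := Measure.integral_comp_mul_left
      (fun v : ℝ => Complex.exp (↑(-2 * π * v * (w / T)) * I) • f v) T
    rw [Real.fourier_real_eq_integral_exp_smul, Real.fourier_real_eq_integral_exp_smul]
    rw [abs_of_pos (inv_pos.2 hT)] at h
    simp only [Function.comp_apply, he]
    rw [Complex.real_smul, Complex.ofReal_inv] at h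
    rw [← h]
    congr 1
    ext v
    congr 4
    field_simp
  simp only [SchwartzMap.compCLMOfContinuousLinearEquiv_apply, Function.comp_apply, he,
    SchwartzMap.fourier_coe, hF] at key
  convert key using 2
  · ext n
    congr 1
    field_simp
  · ext n
    rw [fourier_coe_apply, fourier_coe_apply]
    congr 2
    push_cast
    have : (T : ℂ) ≠ 0 := by exact_mod_cast hT.ne'
    field_simp

/-- The periodization with period `T` is close to the function on the central period. -/
theorem SchwartzMap.exists_norm_tsum_comp_add_mul_sub_le (f : SchwartzMap ℝ ℂ) :
    ∃ K : ℝ, 0 ≤ K ∧ ∀ T : ℝ, 0 < T → ∀ x ∈ Set.Ioc (-(T / 2)) (T / 2),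
      ‖∑' n : ℤ, f (x + T * n) - f x‖ ≤ K / T ^ 2 := by
  obtain ⟨K, hK, hf⟩ := f.exists_norm_le_div_one_add_sq
  have hsum : Summable fun n : ℤ => 1 / (n : ℝ) ^ 2 := Real.summable_one_div_int_pow.2 one_lt_two
  refine ⟨4 * K * ∑' n : ℤ, 1 / (n : ℝ) ^ 2, by positivity, fun T hT x hx => ?_⟩
  have hb (n : ℤ) (hn : n ≠ 0) : ‖f (x + T * n)‖ ≤ 4 * K / T ^ 2 * (1 / (n : ℝ) ^ 2) := by
    refine (hf _).trans ?_
    have hn1 : (1 : ℝ) ≤ |(n : ℝ)| := by exact_mod_cast Int.one_le_abs hn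
    have h1 : T * |(n : ℝ)| / 2 ≤ |x + T * n| := by
      have h2 : |T * (n : ℝ)| ≤ |x + T * n| + |x| := by
        simpa using abs_sub (x + T * n) x
      have h3 : |x| ≤ T / 2 := abs_le.2 ⟨hx.1.le, hx.2⟩
      rw [abs_mul, abs_of_pos hT] at h2
      nlinarith
    have h2 : (T * |(n : ℝ)| / 2) ^ 2 ≤ (x + T * n) ^ 2 := by
      rw [← sq_abs (x + T * n)]
      gcongr
    have h3 : (T * |(n : ℝ)| / 2) ^ 2 = T ^ 2 * (n : ℝ) ^ 2 / 4 := by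
      rw [div_pow, mul_pow, sq_abs]; norm_num
    have hn0 : (0 : ℝ) < (n : ℝ) ^ 2 := by positivity
    calc K / (1 + (x + T * n) ^ 2) ≤ K / (T ^ 2 * (n : ℝ) ^ 2 / 4) := by
          gcongr
          linarith
      _ = _ := by field_simp
  have hs : Summable fun n : ℤ => 4 * K / T ^ 2 * (1 / (n : ℝ) ^ 2) := hsum.mul_left _
  have hfs : Summable fun n : ℤ => f (x + T * n) := by
    refine hs.of_norm_bounded_eventually ?_
    filter_upwards [(Set.finite_singleton (0 : ℤ)).compl_mem_cofinite] with n hn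
    exact hb n hn
  rw [hfs.tsum_eq_add_tsum_ite 0]
  simp only [Int.cast_zero, mul_zero, add_zero, add_sub_cancel_left]
  refine (tsum_of_norm_bounded hs.hasSum fun n => ?_).trans_eq ?_
  · split_ifs with h
    · simp [h]
    · exact hb n h
  · rw [tsum_mul_left]
    ring

theorem Summable.eventually_forall_norm_sum_mul_sub_tsum_le {c : ℤ → ℂ}
    (hc : Summable fun n => ‖c n‖) {ε : ℝ} (hε : 0 < ε) :
    ∀ᶠ s : Finset ℤ in Filter.atTop, ∀ u : ℤ → ℂ, (∀ n, ‖u n‖ ≤ 1) →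
      ‖∑ n ∈ s, c n * u n - ∑' n, c n * u n‖ ≤ ε := by
  filter_upwards [hc.hasSum.eventually_const_lt (sub_lt_self _ hε)] with s hs u hu
  have hle (n : ℤ) : ‖c n * u n‖ ≤ ‖c n‖ := by
    rw [norm_mul]
    exact mul_le_of_le_one_right (norm_nonneg _) (hu n)
  have hcu : Summable fun n => ‖c n * u n‖ := hc.of_nonneg_of_le (fun _ => norm_nonneg _) hle
  have h1 := hcu.of_norm.sum_add_tsum_compl (s := s)
  have h2 := hc.sum_add_tsum_compl (s := s)
  rw [← h1, sub_add_cancel_left, norm_neg]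
  refine (tsum_of_norm_bounded (hc.subtype _).hasSum fun n => hle n).trans ?_
  simp only [Function.comp_def]
  linarith

theorem SchwartzMap.summable_norm_fourier_div (f : SchwartzMap ℝ ℂ) {T : ℝ} (hT : 0 < T) :
    Summable fun n : ℤ => ‖(T : ℂ)⁻¹ * 𝓕 (⇑f) (n / T)‖ := by
  obtain ⟨K, hK, hf⟩ := (𝓕 f).exists_norm_le_div_one_add_sq
  have hsum : Summable fun n : ℤ => K * T * (1 / (n : ℝ) ^ 2) :=
    (Real.summable_one_div_int_pow.2 one_lt_two).mul_left _
  refine hsum.of_norm_bounded_eventually ?_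
  filter_upwards [(Set.finite_singleton (0 : ℤ)).compl_mem_cofinite] with n hn
  have hn' : (n : ℝ) ≠ 0 := by exact_mod_cast hn
  have hn0 : (0 : ℝ) < (n : ℝ) ^ 2 := by positivity
  rw [norm_norm, norm_mul, norm_inv, Complex.norm_real, Real.norm_of_nonneg hT.le]
  calc T⁻¹ * ‖𝓕 (⇑f) (n / T)‖ ≤ T⁻¹ * (K / (1 + (n / T) ^ 2)) := by
        gcongr
        exact hf _
    _ ≤ T⁻¹ * (K / ((n / T) ^ 2)) := by
        gcongr
        linarith
    _ = _ := by field_simp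

/-- Trigonometric polynomials on `ℝ/jℤ`, with coefficients sampled from the Fourier transform of a
Schwartz function, approximate that function on the central period. -/
theorem SchwartzMap.exists_trigPoly_approx (f : SchwartzMap ℝ ℂ) :
    ∃ K : ℝ, 0 ≤ K ∧ ∀ j : ℕ, 1 ≤ j → ∃ s : Finset ℤ, (∀ n : ℤ, |n| ≤ (j : ℤ) ^ 2 → n ∈ s) ∧
      ∀ x ∈ Set.Ioc (-((j : ℝ) / 2)) ((j : ℝ) / 2),
        ‖∑ n ∈ s, (((j : ℝ) : ℂ)⁻¹ * 𝓕 (⇑f) (n / (j : ℝ))) * fourier n (x : AddCircle (j : ℝ))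
          - f x‖ ≤ K / (j : ℝ) ^ 2 := by
  obtain ⟨K, hK, hf⟩ := f.exists_norm_tsum_comp_add_mul_sub_le
  refine ⟨K + 1, by positivity, fun j hj => ?_⟩
  have hj0 : (0 : ℝ) < j := by exact_mod_cast hj
  obtain ⟨s, hs, hsub⟩ := ((f.summable_norm_fourier_div
    hj0).eventually_forall_norm_sum_mul_sub_tsum_le (ε := 1 / (j : ℝ) ^ 2) (by positivity)).and
    (Filter.eventually_ge_atTop (Finset.Icc (-(j : ℤ) ^ 2) ((j : ℤ) ^ 2))) |>.exists
  refine ⟨s, fun n hn => hsub (Finset.mem_Icc.2 (abs_le.1 hn)), fun x hx => ?_⟩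
  have h1 := hs (fun n => fourier n (x : AddCircle (j : ℝ))) fun n => by
    rw [fourier_apply]
    exact (Circle.norm_coe _).le
  have h2 := hf j hj0 x hx
  rw [f.tsum_comp_add_mul_eq_tsum_fourier hj0] at h2
  refine (norm_sub_le_norm_sub_add_norm_sub _ _ _).trans ((add_le_add h1 h2).trans_eq ?_)
  ring


theorem eLpNorm_addCircle_eq_restrict {T : ℝ} [Fact (0 < T)] {F : AddCircle T → ℂ}
    (hF : Continuous F) (q : ℝ≥0∞) :
    eLpNorm F q volume =
      eLpNorm (fun x : ℝ => F x) q (volume.restrict (Set.Ioc (-(T / 2)) (T / 2))) := by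
  have h := AddCircle.measurePreserving_mk T (-(T / 2))
  rw [show -(T / 2) + T = T / 2 by ring] at h
  exact (eLpNorm_comp_measurePreserving hF.aestronglyMeasurable h).symm

theorem eLpNorm_restrict_Ioc_le_add {F f : ℝ → ℂ} (hF : Continuous F) (hf : Continuous f)
    {q : ℝ≥0∞} (hq : 1 ≤ q) (hq' : q < ∞) {K T : ℝ} (hT : 1 ≤ T)
    (h : ∀ x ∈ Set.Ioc (-(T / 2)) (T / 2), ‖F x - f x‖ ≤ K / T ^ 2) :
    eLpNorm F q (volume.restrict (Set.Ioc (-(T / 2)) (T / 2))) ≤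
      eLpNorm f q volume + ENNReal.ofReal (K / T) := by
  set μ : Measure ℝ := volume.restrict (Set.Ioc (-(T / 2)) (T / 2)) with hμ
  have h1 : eLpNorm (F - f) q μ ≤ ENNReal.ofReal (K / T) := by
    have hb : ∀ᵐ x ∂μ, ‖(F - f) x‖ ≤ K / T ^ 2 :=
      (ae_restrict_iff' measurableSet_Ioc).2 (ae_of_all _ h)
    have hq1 : 1 ≤ q.toReal := by
      rw [← ENNReal.toReal_one]
      exact ENNReal.toReal_mono hq'.ne hq
    calc eLpNorm (F - f) q μ ≤ μ Set.univ ^ q.toReal⁻¹ * ENNReal.ofReal (K / T ^ 2) :=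
          eLpNorm_le_of_ae_bound hb
      _ = ENNReal.ofReal T ^ q.toReal⁻¹ * ENNReal.ofReal (K / T ^ 2) := by
          rw [hμ, Measure.restrict_apply_univ, Real.volume_Ioc, show T / 2 - -(T / 2) = T by ring]
      _ ≤ ENNReal.ofReal T ^ (1 : ℝ) * ENNReal.ofReal (K / T ^ 2) := by
          gcongr
          · exact ENNReal.one_le_ofReal.2 hT
          · exact inv_le_one_of_one_le₀ hq1
      _ = ENNReal.ofReal (K / T) := by
          rw [ENNReal.rpow_one, ← ENNReal.ofReal_mul (by positivity)]
          congr 1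
          field_simp
  calc eLpNorm F q μ = eLpNorm (f + (F - f)) q μ := by rw [add_sub_cancel]
    _ ≤ eLpNorm f q μ + eLpNorm (F - f) q μ :=
        eLpNorm_add_le hf.aestronglyMeasurable (hF.sub hf).aestronglyMeasurable hq
    _ ≤ _ := add_le_add (eLpNorm_mono_measure _ Measure.restrict_le_self) h1

theorem integral_ite_floor_mul_mem (Φ : ℝ × ℝ → ℂ) (s t : Finset ℤ) {T : ℝ} (hT : 0 < T) :
    ∫ z : ℝ × ℝ, (if ⌊T * z.1⌋ ∈ s ∧ ⌊T * z.2⌋ ∈ t then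
        Φ ((⌊T * z.1⌋ : ℝ) / T, (⌊T * z.2⌋ : ℝ) / T) else 0) =
      ∑ n ∈ s, ∑ k ∈ t, (T : ℂ)⁻¹ * (T : ℂ)⁻¹ * Φ ((n : ℝ) / T, (k : ℝ) / T) := by
  let cell (n : ℤ) : Set ℝ := Set.Ico (n / T) ((n + 1) / T)
  have mem_cell (n : ℤ) (x : ℝ) : x ∈ cell n ↔ n = ⌊T * x⌋ := by
    rw [eq_comm, Int.floor_eq_iff, Set.mem_Ico, div_le_iff₀ hT, lt_div_iff₀ hT, mul_comm x T]
  have hvol (n : ℤ) : volume (cell n) = ENNReal.ofReal T⁻¹ := by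
    rw [Real.volume_Ico]
    congr 1
    field_simp
    ring
  have hvol2 (n k : ℤ) : (volume : Measure (ℝ × ℝ)).real (cell n ×ˢ cell k) = T⁻¹ * T⁻¹ := by
    rw [Measure.real, Measure.volume_eq_prod, Measure.prod_prod, hvol, hvol,
      ENNReal.toReal_mul, ENNReal.toReal_ofReal (by positivity)]
  have hmeas (n k : ℤ) : MeasurableSet (cell n ×ˢ cell k) := measurableSet_Ico.prod measurableSet_Ico
  have hint (n k : ℤ) : Integrable ((cell n ×ˢ cell k).indicator
      fun _ : ℝ × ℝ => Φ ((n : ℝ) / T, (k : ℝ) / T)) := by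
    refine (integrable_indicator_iff (hmeas n k)).2 (integrableOn_const ?_)
    rw [Measure.volume_eq_prod, Measure.prod_prod, hvol, hvol]
    finiteness
  calc _ = ∫ z : ℝ × ℝ, ∑ n ∈ s, ∑ k ∈ t, (cell n ×ˢ cell k).indicator
        (fun _ : ℝ × ℝ => Φ ((n : ℝ) / T, (k : ℝ) / T)) z := by
        congr 1
        ext z
        simp only [Set.indicator_apply, Set.mem_prod, mem_cell, ite_and, Finset.sum_ite_irrel,
          Finset.sum_ite_eq', Finset.sum_const_zero]
    _ = _ := by
        rw [integral_finsetSum _ fun n _ => integrable_finsetSum _ fun k _ => hint n k]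
        refine Finset.sum_congr rfl fun n _ => ?_
        rw [integral_finsetSum _ fun k _ => hint n k]
        refine Finset.sum_congr rfl fun k _ => ?_
        rw [integral_indicator_const _ (hmeas n k), hvol2, Complex.real_smul]
        push_cast
        ring

theorem abs_floor_mul_div_sub_le (x : ℝ) {T : ℝ} (hT : 0 < T) :
    |(⌊T * x⌋ : ℝ) / T - x| ≤ 1 / T := by
  have h1 := Int.floor_le (T * x)
  have h2 := Int.lt_floor_add_one (T * x)
  rw [show (⌊T * x⌋ : ℝ) / T - x = (⌊T * x⌋ - T * x) / T by field_simp, abs_div, abs_of_pos hT]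
  gcongr
  rw [abs_le]
  constructor <;> linarith

theorem tendsto_floor_mul_div (x : ℝ) :
    Filter.Tendsto (fun j : ℕ => (⌊(j : ℝ) * x⌋ : ℝ) / j) Filter.atTop (nhds x) := by
  rw [tendsto_iff_norm_sub_tendsto_zero]
  refine squeeze_zero' (Filter.Eventually.of_forall fun _ => norm_nonneg _) ?_
    tendsto_one_div_atTop_nhds_zero_nat
  filter_upwards [Filter.eventually_ge_atTop 1] with j hj
  exact abs_floor_mul_div_sub_le x (by exact_mod_cast hj)

theorem eventually_abs_floor_mul_le_sq (x : ℝ) :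
    ∀ᶠ j : ℕ in Filter.atTop, |⌊(j : ℝ) * x⌋| ≤ (j : ℤ) ^ 2 := by
  filter_upwards [Filter.eventually_ge_atTop 1, Filter.eventually_ge_atTop ⌈|x| + 1⌉₊] with j hj hjx
  have hj' : (1 : ℝ) ≤ j := by exact_mod_cast hj
  have h0 : (0 : ℝ) < j := by linarith
  have h1 := abs_floor_mul_div_sub_le x h0
  have h2 : |x| + 1 ≤ j := Nat.ceil_le.1 hjx
  have h3 : |(⌊(j : ℝ) * x⌋ : ℝ) / j| ≤ j := by
    have h4 := abs_sub_abs_le_abs_sub ((⌊(j : ℝ) * x⌋ : ℝ) / j) x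
    have h5 : 1 / (j : ℝ) ≤ 1 := by
      rw [div_le_one h0]
      exact hj'
    linarith
  rw [abs_div, abs_of_pos h0, div_le_iff₀ h0] at h3
  have h6 : ((|⌊(j : ℝ) * x⌋| : ℤ) : ℝ) ≤ (((j : ℤ) ^ 2 : ℤ) : ℝ) := by
    push_cast
    nlinarith
  exact_mod_cast h6

theorem inv_one_add_floor_mul_div_sq_le (x : ℝ) {T : ℝ} (hT : 1 ≤ T) :
    (1 + ((⌊T * x⌋ : ℝ) / T) ^ 2)⁻¹ ≤ 3 * (1 + x ^ 2)⁻¹ := by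
  have h0 : 0 < T := by linarith
  have h1 := abs_floor_mul_div_sub_le x h0
  have h2 : 1 / T ≤ 1 := (div_le_one h0).2 hT
  set y := (⌊T * x⌋ : ℝ) / T
  have h3 := abs_le.1 (h1.trans h2)
  rw [← div_eq_mul_inv, inv_eq_one_div, div_le_div_iff₀ (by positivity) (by positivity)]
  nlinarith [sq_nonneg (2 * y - x)]

/-- Riemann sums over the lattices `(1/j)ℤ × (1/j)ℤ` converge to the integral. -/
theorem tendsto_riemannSum_lattice {Φ : ℝ × ℝ → ℂ} (hΦ : Continuous Φ) {K : ℝ} (hK : 0 ≤ K)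
    (hb : ∀ z, ‖Φ z‖ ≤ K * ((1 + z.1 ^ 2)⁻¹ * (1 + z.2 ^ 2)⁻¹)) {s t : ℕ → Finset ℤ}
    (hs : ∀ j : ℕ, 1 ≤ j → ∀ n : ℤ, |n| ≤ (j : ℤ) ^ 2 → n ∈ s j)
    (ht : ∀ j : ℕ, 1 ≤ j → ∀ n : ℤ, |n| ≤ (j : ℤ) ^ 2 → n ∈ t j) :
    Filter.Tendsto
      (fun j : ℕ => ∑ n ∈ s j, ∑ k ∈ t j,
        ((j : ℝ) : ℂ)⁻¹ * ((j : ℝ) : ℂ)⁻¹ * Φ ((n : ℝ) / (j : ℝ), (k : ℝ) / (j : ℝ)))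
      Filter.atTop (nhds (∫ z, Φ z)) := by
  have hlim : Filter.Tendsto (fun j : ℕ => ∫ z : ℝ × ℝ,
      (if ⌊(j : ℝ) * z.1⌋ ∈ s j ∧ ⌊(j : ℝ) * z.2⌋ ∈ t j then
        Φ ((⌊(j : ℝ) * z.1⌋ : ℝ) / j, (⌊(j : ℝ) * z.2⌋ : ℝ) / j) else 0))
      Filter.atTop (nhds (∫ z, Φ z)) := by
    refine tendsto_integral_filter_of_dominated_convergence
      (fun z => K * ((3 * (1 + z.1 ^ 2)⁻¹) * (3 * (1 + z.2 ^ 2)⁻¹))) ?_ ?_ ?_ ?_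
    · refine Filter.Eventually.of_forall fun j => Measurable.aestronglyMeasurable ?_
      have hm1 : Measurable fun z : ℝ × ℝ => ⌊(j : ℝ) * z.1⌋ := by fun_prop
      have hm2 : Measurable fun z : ℝ × ℝ => ⌊(j : ℝ) * z.2⌋ := by fun_prop
      refine Measurable.ite ?_ ?_ measurable_const
      · exact (hm1 (s j : Set ℤ).to_countable.measurableSet).inter
          (hm2 (t j : Set ℤ).to_countable.measurableSet)
      · have : Measurable fun p : ℤ × ℤ => Φ ((p.1 : ℝ) / j, (p.2 : ℝ) / j) :=
          measurable_of_countable _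
        exact this.comp (hm1.prodMk hm2)
    · filter_upwards [Filter.eventually_ge_atTop 1] with j hj
      refine ae_of_all _ fun z => ?_
      have hj' : (1 : ℝ) ≤ j := by exact_mod_cast hj
      split_ifs
      · refine (hb _).trans ?_
        have h1 := inv_one_add_floor_mul_div_sq_le z.1 hj'
        have h2 := inv_one_add_floor_mul_div_sq_le z.2 hj'
        gcongr
      · rw [norm_zero]
        positivity
    · exact ((integrable_inv_one_add_sq.const_mul 3).mul_prod
        (integrable_inv_one_add_sq.const_mul 3)).const_mul K
    · refine ae_of_all _ fun z => ?_
      refine Filter.Tendsto.congr' ?_ ((hΦ.tendsto z).comp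
        ((tendsto_floor_mul_div z.1).prodMk_nhds (tendsto_floor_mul_div z.2)))
      filter_upwards [Filter.eventually_ge_atTop 1, eventually_abs_floor_mul_le_sq z.1,
        eventually_abs_floor_mul_le_sq z.2] with j hj h1 h2
      rw [if_pos ⟨hs j hj _ h1, ht j hj _ h2⟩]
      rfl
  refine hlim.congr' ?_
  filter_upwards [Filter.eventually_ge_atTop 1] with j hj
  exact integral_ite_floor_mul_mem Φ (s j) (t j) (by exact_mod_cast hj)

theorem finsum_ite_mem {ι : Type*} [DecidableEq ι] (s : Finset ι) (c u : ι → ℂ) :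
    ∑ᶠ n, (if n ∈ s then c n else 0) * u n = ∑ n ∈ s, c n * u n := by
  rw [finsum_eq_sum_of_support_subset (s := s) _ fun n hn => ?_]
  · exact Finset.sum_congr rfl fun n hn => by rw [if_pos hn]
  · by_contra h
    exact hn (by simp [show n ∉ s from h])

theorem finsum_finsum_ite_mem {ι : Type*} [DecidableEq ι] (s t : Finset ι) (c d : ι → ℂ)
    (u : ι → ι → ℂ) (w : ι → ι → ℂ) :
    ∑ᶠ n, ∑ᶠ k, u n k * (if n ∈ s then c n else 0) * (if k ∈ t then d k else 0) * w n k =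
      ∑ n ∈ s, ∑ k ∈ t, u n k * c n * d k * w n k := by
  have h (n : ι) : ∑ᶠ k, u n k * (if n ∈ s then c n else 0) * (if k ∈ t then d k else 0) * w n k =
      (if n ∈ s then c n else 0) * ∑ k ∈ t, u n k * d k * w n k := by
    calc _ = ∑ᶠ k, (if k ∈ t then (if n ∈ s then c n else 0) * d k else 0) * (u n k * w n k) := by
          congr 1
          ext k
          split_ifs <;> ring
      _ = _ := by
          rw [finsum_ite_mem, Finset.mul_sum]
          exact Finset.sum_congr rfl fun k _ => by ring
  simp_rw [h]
  rw [finsum_ite_mem]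
  refine Finset.sum_congr rfl fun n _ => ?_
  rw [Finset.mul_sum]
  exact Finset.sum_congr rfl fun k _ => by ring

theorem eLpNorm_restrict_bilinear_trigPoly_le {p p₁ p₂ : ℝ≥0∞} {m : ℝ × ℝ → ℂ} {C : ℝ}
    {T : ℝ} [Fact (0 < T)]
    (h : ∀ a b : ℤ → ℂ, (Function.support a).Finite → (Function.support b).Finite →
        eLpNorm
            (fun x : AddCircle T =>
              ∑ᶠ n : ℤ, ∑ᶠ k : ℤ, m ((n : ℝ) / T, (k : ℝ) / T) * a n * b k * fourier (n + k) x)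
            p volume
          ≤ ENNReal.ofReal C *
              eLpNorm (fun x : AddCircle T => ∑ᶠ n : ℤ, a n * fourier n x) p₁ volume *
              eLpNorm (fun x : AddCircle T => ∑ᶠ k : ℤ, b k * fourier k x) p₂ volume)
    (s t : Finset ℤ) (c d : ℤ → ℂ) :
    eLpNorm (fun x : ℝ => ∑ n ∈ s, ∑ k ∈ t,
        m ((n : ℝ) / T, (k : ℝ) / T) * c n * d k * fourier (n + k) (x : AddCircle T)) p
        (volume.restrict (Set.Ioc (-(T / 2)) (T / 2))) ≤
      ENNReal.ofReal C *
        eLpNorm (fun x : ℝ => ∑ n ∈ s, c n * fourier n (x : AddCircle T)) p₁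
          (volume.restrict (Set.Ioc (-(T / 2)) (T / 2))) *
        eLpNorm (fun x : ℝ => ∑ k ∈ t, d k * fourier k (x : AddCircle T)) p₂
          (volume.restrict (Set.Ioc (-(T / 2)) (T / 2))) := by
  have hfin (r : Finset ℤ) (e : ℤ → ℂ) :
      (Function.support fun n => if n ∈ r then e n else 0).Finite :=
    r.finite_toSet.subset fun n hn => by
      by_contra h
      exact hn (if_neg h)
  have key := h _ _ (hfin s c) (hfin t d)
  simp_rw [finsum_finsum_ite_mem s t c d (fun n k => m ((n : ℝ) / T, (k : ℝ) / T))
    (fun n k => fourier (n + k) _), finsum_ite_mem] at key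
  rwa [eLpNorm_addCircle_eq_restrict (by fun_prop), eLpNorm_addCircle_eq_restrict (by fun_prop),
    eLpNorm_addCircle_eq_restrict (by fun_prop)] at key

/-- **Bilinear lattice approximation** for `G = ℝ` with lattices `Γ_j = (1/j)ℤ`:
if for every `j ≥ 1` the restriction of the bounded continuous symbol `m` to the
lattice `(1/j)ℤ × (1/j)ℤ` defines a bilinear Fourier multiplier on the circle
`ℝ/jℤ` with uniform bound `C`, then `m` itself defines a bilinear
`(p₁, p₂) → p` Fourier multiplier on `ℝ` with the same bound. -/
theorem bilinear_lattice_approximation_R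
    (p p₁ p₂ : ℝ≥0∞) (hp : 1 ≤ p) (hp' : p < ∞)
    (hp₁ : 1 ≤ p₁) (hp₁' : p₁ < ∞) (hp₂ : 1 ≤ p₂) (hp₂' : p₂ < ∞)
    (hpp : 1 / p = 1 / p₁ + 1 / p₂)
    (m : ℝ × ℝ → ℂ) (hm_bdd : ∃ M : ℝ, ∀ ξ, ‖m ξ‖ ≤ M) (hm_cont : Continuous m)
    (C : ℝ) (hC : 0 ≤ C)
    (hlattice : ∀ (j : ℕ) (hj : 1 ≤ j),
      haveI : Fact ((0 : ℝ) < (j : ℝ)) := ⟨by exact_mod_cast hj⟩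
      ∀ a b : ℤ → ℂ, (Function.support a).Finite → (Function.support b).Finite →
        eLpNorm
            (fun x : AddCircle (j : ℝ) =>
              ∑ᶠ n : ℤ, ∑ᶠ k : ℤ,
                m ((n : ℝ) / (j : ℝ), (k : ℝ) / (j : ℝ)) * a n * b k * fourier (n + k) x)
            p volume
          ≤ ENNReal.ofReal C *
              eLpNorm (fun x : AddCircle (j : ℝ) => ∑ᶠ n : ℤ, a n * fourier n x) p₁ volume *
              eLpNorm (fun x : AddCircle (j : ℝ) => ∑ᶠ k : ℤ, b k * fourier k x) p₂ volume) :
    ∀ f g : SchwartzMap ℝ ℂ,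
      eLpNorm
          (fun x : ℝ =>
            ∫ ξη : ℝ × ℝ,
              m ξη * 𝓕 (⇑f) ξη.1 * 𝓕 (⇑g) ξη.2 *
                Complex.exp (2 * Real.pi * Complex.I * (ξη.1 + ξη.2) * x)) p volume
        ≤ ENNReal.ofReal C * eLpNorm (⇑f) p₁ volume * eLpNorm (⇑g) p₂ volume := by
  intro f g
  obtain ⟨M, hM⟩ := hm_bdd
  have hM0 : 0 ≤ M := (norm_nonneg _).trans (hM 0)
  obtain ⟨A, hA0, hA⟩ := (𝓕 f).exists_norm_le_div_one_add_sq
  obtain ⟨B, hB0, hB⟩ := (𝓕 g).exists_norm_le_div_one_add_sq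
  obtain ⟨K, hK0, hK⟩ := f.exists_trigPoly_approx
  obtain ⟨L, hL0, hL⟩ := g.exists_trigPoly_approx
  choose! s hs hsK using hK
  choose! t ht htL using hL
  let H : ℕ → ℝ → ℂ := fun j x => ∑ n ∈ s j, ∑ k ∈ t j,
    m ((n : ℝ) / (j : ℝ), (k : ℝ) / (j : ℝ)) * (((j : ℝ) : ℂ)⁻¹ * 𝓕 (⇑f) (n / (j : ℝ))) *
      (((j : ℝ) : ℂ)⁻¹ * 𝓕 (⇑g) (k / (j : ℝ))) * fourier (n + k) (x : AddCircle (j : ℝ))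
  let I : ℕ → Set ℝ := fun j => Set.Ioc (-((j : ℝ) / 2)) ((j : ℝ) / 2)
  have hHcont (j : ℕ) : Continuous (H j) := by
    have (i : ℤ) : Continuous fun x : ℝ => fourier i (x : AddCircle (j : ℝ)) :=
      (fourier i).continuous.comp (AddCircle.continuous_mk' _)
    fun_prop
  have hbound (j : ℕ) (hj : 1 ≤ j) : eLpNorm ((I j).indicator (H j)) p volume ≤
      ENNReal.ofReal C * (eLpNorm f p₁ volume + ENNReal.ofReal (K / j)) *
        (eLpNorm g p₂ volume + ENNReal.ofReal (L / j)) := by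
    have hj1 : (1 : ℝ) ≤ j := by exact_mod_cast hj
    have : Fact ((0 : ℝ) < (j : ℝ)) := ⟨by exact_mod_cast hj⟩
    rw [eLpNorm_indicator_eq_eLpNorm_restrict measurableSet_Ioc]
    refine (eLpNorm_restrict_bilinear_trigPoly_le (hlattice j hj) (s j) (t j) _ _).trans ?_
    have (i : ℤ) : Continuous fun x : ℝ => fourier i (x : AddCircle (j : ℝ)) :=
      (fourier i).continuous.comp (AddCircle.continuous_mk' _)
    gcongr
    · exact eLpNorm_restrict_Ioc_le_add (by fun_prop) f.continuous hp₁ hp₁' hj1 (hsK j hj)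
    · exact eLpNorm_restrict_Ioc_le_add (by fun_prop) g.continuous hp₂ hp₂' hj1 (htL j hj)
  have hlim (x : ℝ) : Filter.Tendsto (fun j => (I j).indicator (H j) x) Filter.atTop
      (nhds (∫ ξη : ℝ × ℝ, m ξη * 𝓕 (⇑f) ξη.1 * 𝓕 (⇑g) ξη.2 *
        Complex.exp (2 * Real.pi * Complex.I * (ξη.1 + ξη.2) * x))) := by
    have hFf : Continuous (𝓕 (⇑f)) := (𝓕 f).continuous
    have hFg : Continuous (𝓕 (⇑g)) := (𝓕 g).continuous
    refine (tendsto_riemannSum_lattice (Φ := fun ξη : ℝ × ℝ => m ξη * 𝓕 (⇑f) ξη.1 *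
      𝓕 (⇑g) ξη.2 * Complex.exp (2 * Real.pi * Complex.I * (ξη.1 + ξη.2) * x))
      (by fun_prop) (K := M * (A * B)) (by positivity) (fun z => ?_) hs ht).congr' ?_
    · have he : ‖Complex.exp (2 * Real.pi * Complex.I * (z.1 + z.2) * x)‖ = 1 := by
        rw [show 2 * (Real.pi : ℂ) * Complex.I * (z.1 + z.2) * x =
          ((2 * Real.pi * (z.1 + z.2) * x : ℝ) : ℂ) * Complex.I by push_cast; ring]
        exact Complex.norm_exp_ofReal_mul_I _
      rw [norm_mul, norm_mul, norm_mul, he, mul_one]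
      calc ‖m z‖ * ‖𝓕 (⇑f) z.1‖ * ‖𝓕 (⇑g) z.2‖
          ≤ M * (A / (1 + z.1 ^ 2)) * (B / (1 + z.2 ^ 2)) := by
            gcongr
            · exact hM z
            · exact hA z.1
            · exact hB z.2
        _ = _ := by ring
    · filter_upwards [Filter.eventually_ge_atTop 1,
        Filter.eventually_ge_atTop (⌈2 * |x|⌉₊ + 1)] with j hj hjx
      have h1 : 2 * |x| < j := Nat.lt_of_ceil_lt hjx
      have hx := abs_lt.1 (show |x| < (j : ℝ) / 2 by linarith)
      rw [Set.indicator_of_mem (show x ∈ I j from ⟨hx.1, hx.2.le⟩)]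
      refine Finset.sum_congr rfl fun n _ => Finset.sum_congr rfl fun k _ => ?_
      rw [fourier_coe_apply]
      have : 2 * (Real.pi : ℂ) * Complex.I * (((n : ℝ) / (j : ℝ) : ℝ) + ((k : ℝ) / (j : ℝ) : ℝ)) * x
          = 2 * Real.pi * Complex.I * (n + k : ℤ) * x / (j : ℝ) := by
        push_cast
        ring
      rw [this]
      ring
  have hmeas (j : ℕ) : AEStronglyMeasurable ((I j).indicator (H j)) volume :=
    (hHcont j).aestronglyMeasurable.indicator measurableSet_Ioc
  refine (Lp.eLpNorm_lim_le_liminf_eLpNorm hmeas _ (ae_of_all _ hlim)).trans ?_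
  have hzero (R : ℝ) :
      Filter.Tendsto (fun j : ℕ => ENNReal.ofReal (R / j)) Filter.atTop (nhds 0) := by
    simpa using ENNReal.tendsto_ofReal (tendsto_const_div_atTop_nhds_zero_nat R)
  have hf_top : eLpNorm f p₁ volume ≠ ∞ := (f.memLp p₁ volume).eLpNorm_ne_top
  have hg_top : eLpNorm g p₂ volume ≠ ∞ := (g.memLp p₂ volume).eLpNorm_ne_top
  have hrhs : Filter.Tendsto (fun j : ℕ =>
      ENNReal.ofReal C * (eLpNorm f p₁ volume + ENNReal.ofReal (K / j)) *
        (eLpNorm g p₂ volume + ENNReal.ofReal (L / j))) Filter.atTop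
      (nhds (ENNReal.ofReal C * eLpNorm f p₁ volume * eLpNorm g p₂ volume)) := by
    have h1 := (hzero K).const_add (eLpNorm f p₁ volume)
    have h2 := (hzero L).const_add (eLpNorm g p₂ volume)
    rw [add_zero] at h1 h2
    exact ENNReal.Tendsto.mul (ENNReal.Tendsto.const_mul h1 (Or.inr ENNReal.ofReal_ne_top))
      (Or.inr hg_top) h2 (Or.inr (ENNReal.mul_ne_top ENNReal.ofReal_ne_top hf_top))
  rw [← hrhs.liminf_eq]
  refine Filter.liminf_le_liminf ?_
  filter_upwards [Filter.eventually_ge_atTop 1] with j hj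
  exact hbound j hj
end
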